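/- arXiv:1212.0347 — 2 statements merged into one kernel-verified Lean document; each statement's English description precedes it below -/
import Mathlib

section
/- Let m ≥ 3 be an odd integer and q = 2^m. Partition the Kerdock code 𝒦 into five classes D_0, …, D_4 according to the Lee weight: D_0 = {z ∈ 𝒦 : w_L(z) = 0}, D_1 = {z : w_L(z) = q − 2^{(m−1)/2}}, D_2 = {z : w_L(z) = q}, D_3 = {z : w_L(z) = q + 2^{(m−1)/2}}, D_4 = {z : w_L(z) = 2q}. Then D_0, …, D_4 form a partition of 𝒦 with D_i = −D_i for each i, and the induced translation relations form a 4-class association scheme: for all i, j ∈ {0,…,4} and all codewords z, z′ lying in the same class D_k, the number of pairs (r,s) ∈ D_i × D_j with r + s = z equals the number of pairs (r,s) ∈ D_i × D_j with r + s = z′. -/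
open Polynomial

/-- The Teichmüller set `𝒯 = {z ∈ R : z ^ 2^m = z}` of the Galois ring
`R = GR(4,m) = (ℤ/4ℤ)[x]/(f)`, as a type. -/
abbrev Teich (m : ℕ) (f : Polynomial (ZMod 4)) : Type :=
  {z : AdjoinRoot f // z ^ 2 ^ m = z}

/-- The ambient space `(ℤ/4ℤ)^𝒯` of quaternary words indexed by the Teichmüller set. -/
abbrev Word (m : ℕ) (f : Polynomial (ZMod 4)) : Type := Teich m f → ZMod 4

/-- The codeword `c(u,a,b)` with entry `c(u,a,b)_X = u + T(aX + 2bX³)`, `T` being the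
algebra trace of `R` over `ℤ/4ℤ`. -/
noncomputable def cword (m : ℕ) (f : Polynomial (ZMod 4))
    (u : ZMod 4) (a b : AdjoinRoot f) : Word m f :=
  fun X => u + Algebra.trace (ZMod 4) (AdjoinRoot f) (a * X.1 + 2 * b * X.1 ^ 3)

/-- The Lee weight of a single `ℤ/4ℤ`-symbol: `wt 0 = 0`, `wt 1 = wt 3 = 1`, `wt 2 = 2`. -/
def symWt (x : ZMod 4) : ℕ := if x = 0 then 0 else if x = 2 then 2 else 1

/-- The Lee weight `w_L(v) = Σ_X wt(v_X)`. -/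
noncomputable def leeWt (m : ℕ) (f : Polynomial (ZMod 4)) (v : Word m f) : ℕ :=
  ∑ᶠ X : Teich m f, symWt (v X)

/-- The quaternary Kerdock code `𝒦 = {c(u,a,0) : u ∈ ℤ/4ℤ, a ∈ R}`. -/
def Kerdock (m : ℕ) (f : Polynomial (ZMod 4)) : Set (Word m f) :=
  {v | ∃ u a, v = cword m f u a 0}

/-- The partition `D_0, …, D_4` of the Kerdock code by Lee weights
`0, q - √(q/2), q, q + √(q/2), 2q` (here `q = 2^m` and `√(q/2) = 2^((m-1)/2)`). -/
noncomputable def Kclass (m : ℕ) (f : Polynomial (ZMod 4)) : Fin 5 → Set (Word m f) :=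
  ![{z | z ∈ Kerdock m f ∧ leeWt m f z = 0},
    {z | z ∈ Kerdock m f ∧ leeWt m f z = 2 ^ m - 2 ^ ((m - 1) / 2)},
    {z | z ∈ Kerdock m f ∧ leeWt m f z = 2 ^ m},
    {z | z ∈ Kerdock m f ∧ leeWt m f z = 2 ^ m + 2 ^ ((m - 1) / 2)},
    {z | z ∈ Kerdock m f ∧ leeWt m f z = 2 * 2 ^ m}]

/-- The real part `1, 0, -1, 0` of the fourth root of unity `i ^ x`. -/
def reChar (x : ZMod 4) : ℤ := 1 - symWt x

lemma reChar_add_two (x : ZMod 4) : reChar (x + 2) = -reChar x := by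
  revert x; decide

lemma reChar_neg (x : ZMod 4) : reChar (-x) = reChar x := by
  revert x; decide

lemma two_mul_reChar_mul (x y : ZMod 4) :
    2 * (reChar x * reChar y) = reChar (y + x) + reChar (-y + x) := by
  revert x y; decide

lemma reChar_mul_add_mul (u x y : ZMod 4) :
    reChar (u + x) * reChar (u + y) + reChar (u + 1 + x) * reChar (u + 1 + y) =
      reChar (x - y) := by
  revert u x y; decide

lemma sum_reChar_add_eq_zero {A : Type*} [AddCommGroup A] [Fintype A] (l : A →+ ZMod 4)
    (hl : ∃ a, l a ≠ 0) (c : ZMod 4) : ∑ a, reChar (c + l a) = 0 := by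
  obtain ⟨b, hb⟩ : ∃ b, l b = 2 := by
    obtain ⟨a, ha⟩ := hl
    have key : ∀ x : ZMod 4, x ≠ 0 → x = 2 ∨ x + x = 2 := by decide
    rcases key _ ha with h | h
    · exact ⟨a, h⟩
    · exact ⟨a + a, by rw [map_add, h]⟩
  have h : ∑ a, reChar (c + l a) = ∑ a, reChar (c + l (a + b)) :=
    (Equiv.sum_comp (Equiv.addRight b) _).symm
  simp only [map_add, hb, ← add_assoc, reChar_add_two, Finset.sum_neg_distrib] at h
  omega

lemma sq_eq_of_sq_add_sq_eq_two_pow (n : ℕ) (x y : ℤ) (h : x ^ 2 + y ^ 2 = 2 ^ (2 * n + 1)) :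
    x = 2 ^ n ∨ x = -2 ^ n := by
  induction n generalizing x y with
  | zero =>
    norm_num at h
    have hx : x ^ 2 ≤ 2 := by nlinarith [sq_nonneg y]
    have hy : y ^ 2 ≤ 2 := by nlinarith [sq_nonneg x]
    have h1 : x ≤ 1 := by nlinarith
    have h2 : -1 ≤ x := by nlinarith
    have h3 : y ≤ 1 := by nlinarith
    have h4 : -1 ≤ y := by nlinarith
    interval_cases x <;> interval_cases y <;> simp_all
  | succ n ih =>
    have h4 : x ^ 2 + y ^ 2 = 4 * 2 ^ (2 * n + 1) := by rw [h]; ring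
    have hmod : x % 2 = 0 ∧ y % 2 = 0 := by
      have hd : (x ^ 2 + y ^ 2) % 4 = 0 := by omega
      have hx : x % 4 = 0 ∨ x % 4 = 1 ∨ x % 4 = 2 ∨ x % 4 = 3 := by omega
      have hy : y % 4 = 0 ∨ y % 4 = 1 ∨ y % 4 = 2 ∨ y % 4 = 3 := by omega
      rcases hx with hx | hx | hx | hx <;> rcases hy with hy | hy | hy | hy <;>
        simp [pow_two, Int.add_emod, Int.mul_emod, hx, hy] at hd <;> omega
    obtain ⟨a, rfl⟩ : ∃ a, x = 2 * a := ⟨x / 2, by omega⟩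
    obtain ⟨b, rfl⟩ : ∃ b, y = 2 * b := ⟨y / 2, by omega⟩
    have := ih a b (by linarith)
    rw [pow_succ]
    omega

section Scheme

variable {G : Type*} [AddCommGroup G] [Fintype G]

/-- Convolution of rational functions on a finite abelian group. -/
def conv (g h : G → ℚ) (z : G) : ℚ := ∑ x, g x * h (z - x)

lemma conv_comm (g h : G → ℚ) (z : G) : conv g h z = conv h g z := by
  unfold conv
  rw [← (Equiv.subLeft z).sum_comp]
  exact Finset.sum_congr rfl fun x _ => by simp [mul_comm]

lemma conv_single [DecidableEq G] (a : G) (h : G → ℚ) (z : G) :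
    conv (fun x => if x = a then 1 else 0) h z = h (z - a) := by
  simp [conv]

lemma conv_one (h : G → ℚ) (z : G) : conv (fun _ => 1) h z = ∑ x, h x := by
  simp only [conv, one_mul]
  exact (Equiv.subLeft z).sum_comp h

open Classical in
/-- If the level sets of `F` are `{0}`, `{j}`, `H \ {0, j}` and two halves of the complement of
the subgroup `H` exchanged by translation by `j`, and if `F` is an eigenvector of convolution
with itself, then convolution preserves the functions constant on the level sets of `F`. -/
theorem conv_eq_of_level_eq (F : G → ℤ) (H : AddSubgroup G) (j : G) (q s c : ℤ)
    (hs : 0 < s) (hsq : s < q) (hj : j ∈ H)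
    (hF0 : ∀ x, F x = q ↔ x = 0) (hFj : ∀ x, F (x - j) = -F x)
    (hH : ∀ x ∈ H, F x = q ∨ F x = 0 ∨ F x = -q) (hHc : ∀ x ∉ H, F x = s ∨ F x = -s)
    (hconv : ∀ z, 2 * ∑ x, F x * F (z - x) = c * F z)
    (g h : ℤ → ℚ) (z z' : G) (hz : F z = F z') :
    conv (g ∘ F) (h ∘ F) z = conv (g ∘ F) (h ∘ F) z' := by
  have hFneg : ∀ x, F x = -q ↔ x = j := fun x => by
    rw [← sub_eq_zero (a := x), ← hF0, hFj]; omega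
  have hmem : ∀ x, x ∈ H ↔ F x = q ∨ F x = 0 ∨ F x = -q := fun x =>
    ⟨hH x, fun hx => by by_contra hn; have := hHc x hn; omega⟩
  let δ (a : G) : G → ℚ := fun x => if x = a then 1 else 0
  let χ : G → ℚ := fun x => if x ∈ H then 1 else 0
  let φ : G → ℚ := fun x => F x
  -- functions constant on level sets lie in the span of five functions
  have hdec : ∀ g : ℤ → ℚ, ∃ α β γ d e : ℚ, ∀ x,
      g (F x) = α * δ 0 x + β * δ j x + γ * χ x + d * 1 + e * φ x := by
    intro g
    have hs' : (s : ℚ) ≠ 0 := by exact_mod_cast hs.ne'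
    obtain ⟨d, hd⟩ : ∃ d, d = (g s + g (-s)) / 2 := ⟨_, rfl⟩
    obtain ⟨e, he⟩ : ∃ e, e = (g s - g (-s)) / (2 * s) := ⟨_, rfl⟩
    have hes : e * s = (g s - g (-s)) / 2 := by rw [he]; field_simp
    refine ⟨g q - g 0 - e * q, g (-q) - g 0 + e * q, g 0 - d, d, e, fun x => ?_⟩
    by_cases hx : x ∈ H
    · have h0 : ∀ x, x = 0 ↔ F x = q := fun x => (hF0 x).symm
      have h1 : ∀ x, x = j ↔ F x = -q := fun x => (hFneg x).symm
      simp only [δ, χ, φ, h0 x, h1 x, hx, if_true]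
      rcases hH x hx with hx | hx | hx
      · rw [hx, if_pos rfl, if_neg (by omega)]; ring
      · rw [hx, if_neg (by omega), if_neg (by omega)]; push_cast; ring
      · rw [hx, if_neg (by omega), if_pos rfl]; push_cast; ring
    · have h0 : x ≠ 0 := fun h => hx (h ▸ H.zero_mem)
      have h1 : x ≠ j := fun h => hx (h ▸ hj)
      simp only [δ, χ, φ, h0, h1, hx, if_false]
      rcases hHc x hx with hx | hx
      · rw [hx, hes, hd]; ring
      · rw [hx]; push_cast; rw [mul_neg, hes, hd]; ring
  have hlin : ∀ g k : ℤ → ℚ, ∃ α β γ d e : ℚ, ∀ z, conv (g ∘ F) (k ∘ F) z =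
      α * conv (δ 0) (k ∘ F) z + β * conv (δ j) (k ∘ F) z + γ * conv χ (k ∘ F) z
        + d * conv (fun _ => 1) (k ∘ F) z + e * conv φ (k ∘ F) z := by
    intro g k
    obtain ⟨α, β, γ, d, e, hg⟩ := hdec g
    refine ⟨α, β, γ, d, e, fun z => ?_⟩
    simp only [conv, Finset.mul_sum, ← Finset.sum_add_distrib]
    exact Finset.sum_congr rfl fun x _ => by simp only [Function.comp, hg]; ring
  have hχ : ∃ k : ℤ → ℚ, χ = k ∘ F :=
    ⟨fun v => if v = q ∨ v = 0 ∨ v = -q then 1 else 0, by ext x; simp [χ, hmem]⟩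
  have hφ : ∃ k : ℤ → ℚ, φ = k ∘ F := ⟨fun v => v, rfl⟩
  have hδ0 : ∀ k : ℤ → ℚ, conv (δ 0) (k ∘ F) z = conv (δ 0) (k ∘ F) z' := fun k => by
    simp only [δ, conv_single, sub_zero, Function.comp, hz]
  have hδj : ∀ k : ℤ → ℚ, conv (δ j) (k ∘ F) z = conv (δ j) (k ∘ F) z' := fun k => by
    simp only [δ, conv_single, Function.comp, hFj, hz]
  have hone : ∀ k : ℤ → ℚ, conv (fun _ => 1) (k ∘ F) z = conv (fun _ => 1) (k ∘ F) z' :=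
    fun k => by simp only [conv_one]
  have hχχ : conv χ χ z = conv χ χ z' := by
    have key : ∀ z, conv χ χ z = (∑ x, χ x) * χ z := by
      intro z
      rw [conv, Finset.sum_mul]
      refine Finset.sum_congr rfl fun x _ => ?_
      by_cases hx : x ∈ H
      · simp [χ, hx, sub_eq_add_neg, H.add_mem_cancel_right (H.neg_mem hx)]
      · simp [χ, hx]
    rw [key, key]
    simp only [χ, hmem, hz]
  have hχφ : ∀ z, conv χ φ z = 0 := by
    intro z
    have h1 : conv χ φ z = -conv χ φ z := by
      rw [conv, ← Finset.sum_neg_distrib, ← Equiv.sum_comp (Equiv.addRight j)]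
      refine Finset.sum_congr rfl fun x _ => ?_
      simp [χ, φ, H.add_mem_cancel_right hj, ← sub_sub, hFj]
    linarith
  have hφφ : conv φ φ z = conv φ φ z' := by
    have key : ∀ z, 2 * conv φ φ z = c * F z := fun z => by
      have := hconv z
      simp only [conv, φ]
      exact_mod_cast this
    have h1 := key z
    have h2 := key z'
    rw [hz] at h1
    linarith
  have hχk : ∀ k : ℤ → ℚ, conv χ (k ∘ F) z = conv χ (k ∘ F) z' := by
    intro k
    obtain ⟨l, hl⟩ := hχ
    obtain ⟨α, β, γ, d, e, hk⟩ := hlin k l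
    rw [conv_comm, conv_comm χ, hl, hk, hk, hδ0, hδj, hone, ← hl, hχχ, conv_comm φ,
      conv_comm φ χ, hχφ, hχφ]
  have hφk : ∀ k : ℤ → ℚ, conv φ (k ∘ F) z = conv φ (k ∘ F) z' := by
    intro k
    obtain ⟨l, hl⟩ := hφ
    obtain ⟨α, β, γ, d, e, hk⟩ := hlin k l
    rw [conv_comm, conv_comm φ, hl, hk, hk, hδ0, hδj, hone, ← hl, hφφ, hχφ, hχφ]
  obtain ⟨α, β, γ, d, e, hg⟩ := hlin g h
  rw [hg, hg, hδ0, hδj, hone, hχk, hφk]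

/-- The number of ways to write `z` as `r + (z - r)` with both terms in prescribed level sets. -/
lemma card_level_eq_conv (F : G → ℤ) (a b : ℤ) (z : G) :
    (Nat.card {r : G // F r = a ∧ F (z - r) = b} : ℚ) =
      conv ((fun v => if v = a then 1 else 0) ∘ F) ((fun v => if v = b then 1 else 0) ∘ F) z := by
  classical
  simp [conv, Nat.card_eq_fintype_card, Fintype.card_subtype, ← ite_and,
    and_comm]

end Scheme

section GaloisRing

variable {R k : Type*} [CommRing R] [Field k]

/-- `red` is a reduction modulo 2 of a ring of characteristic 4 onto a field, and `T` is an
additive functional that is nonzero modulo 2. -/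
structure IsTraceReduction (red : R →+* k) (T : R →+ ZMod 4) : Prop where
  surj : Function.Surjective red
  ker : ∀ r, red r = 0 → ∃ s, r = 2 * s
  four : (4 : R) = 0
  trace : ∃ r, T (2 * r) ≠ 0

namespace IsTraceReduction

variable {red : R →+* k} {T : R →+ ZMod 4} (h : IsTraceReduction red T)
include h

lemma red_two : red 2 = 0 := by
  have : red 2 * red 2 = 0 := by
    rw [← map_mul, show (2 : R) * 2 = 4 by norm_num, h.four, map_zero]
  simpa using this

lemma charTwo : CharP k 2 := by
  have : (2 : k) = 0 := by rw [← map_ofNat red 2, h.red_two]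
  exact CharTwo.of_one_ne_zero_of_two_eq_zero one_ne_zero this

lemma exists_eq_add {r s : R} (hrs : red r = red s) : ∃ e, r = s + 2 * e := by
  obtain ⟨e, he⟩ := h.ker (r - s) (by rw [map_sub, hrs, sub_self])
  exact ⟨e, by rw [← he]; ring⟩

lemma two_mul_eq {r s : R} (hrs : red r = red s) : 2 * r = 2 * s := by
  obtain ⟨e, rfl⟩ := h.exists_eq_add hrs
  linear_combination e * h.four

lemma sq_eq {r s : R} (hrs : red r = red s) : r ^ 2 = s ^ 2 := by
  obtain ⟨e, rfl⟩ := h.exists_eq_add hrs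
  linear_combination (s * e + e ^ 2) * h.four

lemma exists_trace_two_mul_ne {c : R} (hc : red c ≠ 0) : ∃ r, T (2 * (c * r)) ≠ 0 := by
  obtain ⟨r, hr⟩ := h.trace
  obtain ⟨c', hc'⟩ := h.surj (red c)⁻¹
  refine ⟨c' * r, ?_⟩
  rwa [h.two_mul_eq (s := r)]
  rw [map_mul, map_mul, hc', mul_inv_cancel_left₀ hc]

lemma eq_zero_of_red {d : R} (hd : red d = 0) : 2 * d = 0 := by
  rw [h.two_mul_eq (s := 0) (by rw [hd, map_zero]), mul_zero]

lemma exists_trace_mul_ne {c : R} (hc : c ≠ 0) : ∃ r, T (c * r) ≠ 0 := by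
  by_cases hr : red c = 0
  · obtain ⟨d, rfl⟩ := h.ker c hr
    obtain ⟨r, hr⟩ := h.exists_trace_two_mul_ne (c := d) fun hd => hc (h.eq_zero_of_red hd)
    exact ⟨r, by rwa [mul_assoc]⟩
  · obtain ⟨r, hr⟩ := h.exists_trace_two_mul_ne hr
    exact ⟨2 * r, by rwa [mul_left_comm]⟩

/-- A set-theoretic section of the reduction. -/
noncomputable def lift : k → R := Function.surjInv h.surj

@[simp]
lemma red_lift (y : k) : red (h.lift y) = y := Function.surjInv_eq h.surj y

lemma lift_zero_sq : h.lift 0 ^ 2 = 0 := by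
  rw [h.sq_eq (s := 0) (by simp)]; ring

lemma lift_add_sq (y z : k) :
    h.lift (y + z) ^ 2 = h.lift y ^ 2 + h.lift z ^ 2 + 2 * (h.lift y * h.lift z) := by
  rw [h.sq_eq (s := h.lift y + h.lift z) (by simp)]; ring

/-- The additive map `y ↦ T (2 c y)` on the residue field. -/
noncomputable def traceHom (c : R) : k →+ ZMod 4 :=
  AddMonoidHom.mk' (fun y => T (2 * (c * h.lift y))) fun y z => by
    rw [← map_add, ← mul_add, ← mul_add]
    exact congrArg T (h.two_mul_eq (by simp))

/-- The additive map `y ↦ T (2 d y²)` on the residue field. -/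
noncomputable def traceSqHom (d : R) : k →+ ZMod 4 :=
  AddMonoidHom.mk' (fun y => T (2 * (d * h.lift y ^ 2))) fun y z => by
    rw [← map_add, h.lift_add_sq]
    exact congrArg T (by linear_combination (d * h.lift y * h.lift z) * h.four)

lemma exists_traceHom_ne {c : R} (hc : red c ≠ 0) : ∃ y, h.traceHom c y ≠ 0 := by
  obtain ⟨r, hr⟩ := h.exists_trace_two_mul_ne hc
  refine ⟨red r, ?_⟩
  change T (2 * (c * h.lift (red r))) ≠ 0
  rwa [h.two_mul_eq (s := c * r) (by simp)]

variable [Fintype k]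

lemma exists_traceSqHom_ne {d : R} (hd : red d ≠ 0) : ∃ y, h.traceSqHom d y ≠ 0 := by
  obtain ⟨r, hr⟩ := h.exists_trace_two_mul_ne hd
  have := h.charTwo
  obtain ⟨y, hy⟩ : IsSquare (red r) := FiniteField.isSquare_of_char_two
    (ringChar.eq k 2 ▸ rfl) (red r)
  refine ⟨y, ?_⟩
  change T (2 * (d * h.lift y ^ 2)) ≠ 0
  rwa [h.two_mul_eq (s := d * r) (by simp [hy, sq])]

/-- The Teichmüller set is parametrised by the residue field through squares of lifts. -/
noncomputable def teichEquiv {m : ℕ} (hm : m ≠ 0) (hk : Fintype.card k = 2 ^ m) :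
    k ≃ {z : R // z ^ 2 ^ m = z} := by
  have hpow : ∀ y : k, y ^ 2 ^ m = y := fun y => by rw [← hk, FiniteField.pow_card]
  refine Equiv.ofBijective (fun y => ⟨h.lift y ^ 2, ?_⟩) ⟨fun y z hyz => ?_, fun X => ?_⟩
  · rw [← pow_mul, mul_comm, pow_mul]
    exact h.sq_eq (by simp [hpow])
  · have := h.charTwo
    have := congrArg red (congrArg Subtype.val hyz)
    simpa [CharTwo.sq_inj] using this
  · obtain ⟨n, rfl⟩ := Nat.exists_eq_succ_of_ne_zero hm
    refine ⟨red X.1 ^ 2 ^ n, Subtype.ext ?_⟩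
    change h.lift (red X.1 ^ 2 ^ n) ^ 2 = X.1
    rw [h.sq_eq (s := X.1 ^ 2 ^ n) (by simp), ← pow_mul, ← pow_succ, X.2]

lemma teichEquiv_apply {m : ℕ} (hm : m ≠ 0) (hk : Fintype.card k = 2 ^ m) (y : k) :
    (h.teichEquiv hm hk y).1 = h.lift y ^ 2 := rfl

/-- The exponential sum over the Teichmüller set has squared modulus `q`. -/
lemma sum_sq_add_sum_sq {a : R} (ha : red a ≠ 0) (u : ZMod 4) :
    (∑ y, reChar (u + T (a * h.lift y ^ 2))) ^ 2 +
      (∑ y, reChar (u + 1 + T (a * h.lift y ^ 2))) ^ 2 = Fintype.card k := by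
  classical
  have hdiff : ∀ y z, T (a * h.lift (z + y) ^ 2) - T (a * h.lift y ^ 2) =
      T (a * h.lift z ^ 2) + h.traceHom (a * h.lift z) y := by
    intro y z
    change _ = _ + T (2 * (a * h.lift z * h.lift y))
    rw [← map_sub, ← map_add, h.lift_add_sq]
    congr 1
    ring
  have hinner : ∀ z, ∑ y, reChar (T (a * h.lift z ^ 2) + h.traceHom (a * h.lift z) y) =
      if z = 0 then (Fintype.card k : ℤ) else 0 := by
    intro z
    split_ifs with hz
    · have h0 : ∀ y, h.traceHom (a * h.lift z) y = 0 := fun y => by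
        change T (2 * (a * h.lift z * h.lift y)) = 0
        rw [h.eq_zero_of_red (by simp [hz]), map_zero]
      have h1 : reChar 0 = 1 := rfl
      simp_rw [h0]
      simp [hz, h.lift_zero_sq, h1]
    · exact sum_reChar_add_eq_zero _ (h.exists_traceHom_ne (by simp [ha, hz])) _
  rw [sq, sq, Finset.sum_mul_sum, Finset.sum_mul_sum, ← Finset.sum_add_distrib]
  simp_rw [← Finset.sum_add_distrib, reChar_mul_add_mul]
  rw [Finset.sum_comm]
  have hshift : ∀ y, ∑ x, reChar (T (a * h.lift x ^ 2) - T (a * h.lift y ^ 2)) =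
      ∑ z, reChar (T (a * h.lift z ^ 2) + h.traceHom (a * h.lift z) y) := by
    intro y
    rw [← Equiv.sum_comp (Equiv.addRight y)]
    exact Finset.sum_congr rfl fun z _ => by rw [Equiv.coe_addRight, hdiff]
  simp_rw [hshift]
  rw [Finset.sum_comm]
  simp_rw [hinner]
  simp

lemma sum_eq_zero_of_two_mul {d : R} (hd : red d ≠ 0) (u : ZMod 4) :
    ∑ y, reChar (u + T (2 * d * h.lift y ^ 2)) = 0 := by
  simp_rw [mul_assoc]
  exact sum_reChar_add_eq_zero (h.traceSqHom d) (h.exists_traceSqHom_ne hd) u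

end IsTraceReduction

end GaloisRing

section Reduction

variable (f : Polynomial (ZMod 4))

/-- The reduction modulo 2 of a polynomial over `ℤ/4ℤ`. -/
noncomputable abbrev modTwo : Polynomial (ZMod 2) :=
  f.map (ZMod.castHom (show (2 : ℕ) ∣ 4 by norm_num) (ZMod 2))

/-- Reduction of `(ℤ/4ℤ)[x]/(f)` modulo 2. -/
noncomputable def redTwo : AdjoinRoot f →+* AdjoinRoot (modTwo f) :=
  AdjoinRoot.map (ZMod.castHom (show (2 : ℕ) ∣ 4 by norm_num) (ZMod 2)) f (modTwo f) dvd_rfl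

lemma redTwo_mk (p : Polynomial (ZMod 4)) :
    redTwo f (AdjoinRoot.mk f p) = AdjoinRoot.mk (modTwo f) (modTwo p) := by
  induction p using Polynomial.induction_on' with
  | add p q hp hq => simp only [modTwo, map_add, hp, hq, Polynomial.map_add]
  | monomial n a =>
    simp [redTwo, modTwo, ← Polynomial.C_mul_X_pow_eq_monomial]

lemma exists_eq_two_mul_of_modTwo_eq_zero (p : Polynomial (ZMod 4)) (hp : modTwo p = 0) :
    ∃ g, p = 2 * g := by
  have key : ∀ x : ZMod 4, ZMod.castHom (show (2 : ℕ) ∣ 4 by norm_num) (ZMod 2) x = 0 →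
      (2 : ZMod 4) ∣ x := by decide
  obtain ⟨g, hg⟩ := (Polynomial.C_dvd_iff_dvd_coeff 2 p).2 fun i => key _ <| by
    rw [← Polynomial.coeff_map, show p.map _ = 0 from hp, Polynomial.coeff_zero]
  exact ⟨g, hg⟩

lemma modTwo_surjective (p : Polynomial (ZMod 2)) : ∃ g, modTwo g = p :=
  Polynomial.map_surjective _ (ZMod.castHom_surjective _) p

lemma natDegree_modTwo {f : Polynomial (ZMod 4)} (hf : f.Monic) :
    (modTwo f).natDegree = f.natDegree :=
  hf.natDegree_map _

lemma card_adjoinRoot_modTwo [Fact (Irreducible (modTwo f))] :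
    Nat.card (AdjoinRoot (modTwo f)) = 2 ^ (modTwo f).natDegree := by
  have hne : modTwo f ≠ 0 := (Fact.out : Irreducible (modTwo f)).ne_zero
  have : Module.Finite (ZMod 2) (AdjoinRoot (modTwo f)) :=
    Module.Finite.of_basis (AdjoinRoot.powerBasis hne).basis
  have := Module.natCard_eq_pow_finrank (K := ZMod 2) (V := AdjoinRoot (modTwo f))
  rw [this, (AdjoinRoot.powerBasis hne).finrank, AdjoinRoot.powerBasis_dim, Nat.card_zmod]

/-- The trace of `(ℤ/4ℤ)[x]/(f)` as an additive map. -/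
noncomputable abbrev traceFour : AdjoinRoot f →+ ZMod 4 :=
  (Algebra.trace (ZMod 4) (AdjoinRoot f)).toAddMonoidHom

lemma isTraceReduction_redTwo [Fact (Irreducible (modTwo f))] (hf : f.Monic)
    (hodd : Odd f.natDegree) : IsTraceReduction (redTwo f) (traceFour f) where
  surj y := by
    obtain ⟨p, rfl⟩ := AdjoinRoot.mk_surjective y
    obtain ⟨g, rfl⟩ := modTwo_surjective p
    exact ⟨AdjoinRoot.mk f g, redTwo_mk f g⟩
  ker r hr := by
    obtain ⟨p, rfl⟩ := AdjoinRoot.mk_surjective r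
    rw [redTwo_mk, AdjoinRoot.mk_eq_zero] at hr
    obtain ⟨g, hg⟩ := hr
    obtain ⟨g, rfl⟩ := modTwo_surjective g
    obtain ⟨e, he⟩ := exists_eq_two_mul_of_modTwo_eq_zero (p - f * g) (by
      simp only [modTwo, Polynomial.map_sub, Polynomial.map_mul] at hg ⊢
      rw [hg, sub_self])
    refine ⟨AdjoinRoot.mk f e, ?_⟩
    have := congrArg (AdjoinRoot.mk f) he
    rwa [map_sub, map_mul, AdjoinRoot.mk_self, zero_mul, sub_zero, map_mul, map_ofNat] at this
  four := by
    rw [← map_ofNat (algebraMap (ZMod 4) (AdjoinRoot f)) 4,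
      show (OfNat.ofNat 4 : ZMod 4) = 0 from rfl, map_zero]
  trace := by
    refine ⟨1, ?_⟩
    have : Fact (1 < 4) := ⟨by norm_num⟩
    have := Module.Free.of_basis (AdjoinRoot.powerBasis' hf).basis
    change Algebra.trace (ZMod 4) (AdjoinRoot f) (2 * 1) ≠ 0
    rw [mul_one, ← map_ofNat (algebraMap (ZMod 4) (AdjoinRoot f)) 2, Algebra.trace_algebraMap,
      (AdjoinRoot.powerBasis' hf).finrank, AdjoinRoot.powerBasis'_dim]
    obtain ⟨n, hn⟩ := hodd
    rw [hn, nsmul_eq_mul]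
    push_cast
    generalize (n : ZMod 4) = x
    revert x
    decide

end Reduction

section Code

variable {m : ℕ} {f : Polynomial (ZMod 4)}

@[simp]
lemma cword_zero_apply (u : ZMod 4) (a : AdjoinRoot f) (X : Teich m f) :
    cword m f u a 0 X = u + traceFour f (a * X.1) := by
  simp [cword]

variable (m f) in
/-- The Kerdock code as a subgroup of the ambient space. -/
def kerdockGroup : AddSubgroup (Word m f) where
  carrier := Kerdock m f
  zero_mem' := ⟨0, 0, by ext X; simp⟩
  add_mem' := by
    rintro _ _ ⟨u, a, rfl⟩ ⟨v, b, rfl⟩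
    exact ⟨u + v, a + b, by
      ext X; simp only [Pi.add_apply, cword_zero_apply, add_mul, map_add]; ring⟩
  neg_mem' := by
    rintro _ ⟨u, a, rfl⟩
    exact ⟨-u, -a, by ext X; simp only [Pi.neg_apply, cword_zero_apply, neg_mul, map_neg]; ring⟩

variable (m f) in
/-- The codewords `c(u,a)` with `a ∈ 2R`. -/
def kerdockKer : AddSubgroup (kerdockGroup m f) where
  carrier := {v | ∃ u a, redTwo f a = 0 ∧ v.1 = cword m f u a 0}
  zero_mem' := ⟨0, 0, by simp, by ext X; simp⟩
  add_mem' := by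
    rintro ⟨_, _⟩ ⟨_, _⟩ ⟨u, a, ha, rfl⟩ ⟨v, b, hb, rfl⟩
    exact ⟨u + v, a + b, by simp [ha, hb],
      by ext X; simp only [AddSubgroup.coe_add, Pi.add_apply, cword_zero_apply, add_mul,
        map_add]; ring⟩
  neg_mem' := by
    rintro ⟨_, _⟩ ⟨u, a, ha, rfl⟩
    exact ⟨-u, -a, by simp [ha],
      by ext X; simp only [AddSubgroup.coe_neg, Pi.neg_apply, cword_zero_apply, neg_mul,
        map_neg]; ring⟩

variable (m f) in
/-- The codeword `c(u,0)` with constant entry `u`. -/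
noncomputable def constWord (u : ZMod 4) : kerdockGroup m f := ⟨cword m f u 0 0, u, 0, rfl⟩

@[simp]
lemma constWord_apply (u : ZMod 4) (X : Teich m f) : (constWord m f u).1 X = u := by
  simp [constWord]

lemma exists_kerdock_ne [Fact (Irreducible (modTwo f))]
    (h : IsTraceReduction (redTwo f) (traceFour f)) {X Y : Teich m f} (hXY : X ≠ Y) :
    ∃ v : kerdockGroup m f, v.1 X - v.1 Y ≠ 0 := by
  obtain ⟨a, ha⟩ := h.exists_trace_mul_ne (sub_ne_zero.2 (Subtype.coe_ne_coe.2 hXY))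
  refine ⟨⟨cword m f 0 a 0, 0, a, rfl⟩, ?_⟩
  rw [mul_comm, mul_sub, map_sub] at ha
  simpa using ha

variable [Fintype (Teich m f)]

/-- The sum of the real parts of `i ^ v_X`. -/
def level (v : Word m f) : ℤ := ∑ X, reChar (v X)

lemma level_eq (v : Word m f) : level v = Fintype.card (Teich m f) - leeWt m f v := by
  simp [level, reChar, leeWt, finsum_eq_sum_of_fintype]

lemma level_eq_card_iff (v : Word m f) : level v = Fintype.card (Teich m f) ↔ v = 0 := by
  have key : ∀ x : ZMod 4, symWt x = 0 ↔ x = 0 := by decide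
  rw [level_eq, leeWt, finsum_eq_sum_of_fintype, sub_eq_self, Nat.cast_eq_zero,
    Finset.sum_eq_zero_iff, funext_iff]
  simp [key]

lemma level_neg (v : Word m f) : level (-v) = level v := by
  simp [level, reChar_neg]

lemma level_sub_constWord (v : kerdockGroup m f) :
    level (v - constWord m f 2).1 = -level v.1 := by
  have key : ∀ x : ZMod 4, reChar (x - 2) = -reChar x := by decide
  simp [level, key]

variable [Fact (Irreducible (modTwo f))] (h : IsTraceReduction (redTwo f) (traceFour f))
include h

/-- The level is an eigenvector of convolution with itself. -/
lemma sum_level_mul_level [Fintype (kerdockGroup m f)] (z : kerdockGroup m f) :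
    2 * ∑ x : kerdockGroup m f, level x.1 * level (z - x).1 =
      Fintype.card (kerdockGroup m f) * level z.1 := by
  classical
  let ev (X : Teich m f) : kerdockGroup m f →+ ZMod 4 :=
    (Pi.evalAddMonoidHom _ X).comp (kerdockGroup m f).subtype
  have hev : ∀ X v, ev X v = v.1 X := fun _ _ => rfl
  have hplus : ∀ X Y, ∑ x, reChar (-z.1 Y + (ev X + ev Y) x) = 0 := fun X Y =>
    sum_reChar_add_eq_zero _ ⟨constWord m f 1, by
      rw [AddMonoidHom.add_apply, hev, hev, constWord_apply, constWord_apply]; decide⟩ _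
  have hminus : ∀ X Y, ∑ x, reChar (z.1 Y + (ev X - ev Y) x) =
      if X = Y then Fintype.card (kerdockGroup m f) * reChar (z.1 Y) else 0 := by
    intro X Y
    split_ifs with hXY
    · simp [hXY]
    · exact sum_reChar_add_eq_zero _ (exists_kerdock_ne h hXY) _
  have hterm : ∀ X Y, ∑ x : kerdockGroup m f, 2 * (reChar (x.1 X) * reChar ((z - x).1 Y)) =
      if X = Y then Fintype.card (kerdockGroup m f) * reChar (z.1 Y) else 0 := by
    intro X Y
    rw [← hminus]
    refine Eq.trans ?_ ((congrArg (_ + ·) (hplus X Y)).trans (add_zero _))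
    rw [← Finset.sum_add_distrib]
    refine Finset.sum_congr rfl fun x _ => ?_
    rw [two_mul_reChar_mul]
    simp only [AddMonoidHom.add_apply, AddMonoidHom.sub_apply, hev, AddSubgroup.coe_sub,
      Pi.sub_apply]
    congr 2 <;> ring
  simp_rw [level, Finset.sum_mul_sum, Finset.mul_sum]
  rw [Finset.sum_comm]
  refine Finset.sum_congr rfl fun X _ => ?_
  rw [Finset.sum_comm]
  simp_rw [hterm]
  simp

variable [Fintype (AdjoinRoot (modTwo f))] (hm : m ≠ 0)
  (hk : Fintype.card (AdjoinRoot (modTwo f)) = 2 ^ m)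
include hm hk

lemma level_cword (u : ZMod 4) (a : AdjoinRoot f) :
    level (cword m f u a 0) = ∑ y, reChar (u + traceFour f (a * h.lift y ^ 2)) := by
  rw [level, ← Equiv.sum_comp (h.teichEquiv hm hk)]
  exact Finset.sum_congr rfl fun y _ => by rw [cword_zero_apply, IsTraceReduction.teichEquiv_apply]

lemma level_of_mem_kerdockKer {v : kerdockGroup m f} (hv : v ∈ kerdockKer m f) :
    level v.1 = 2 ^ m ∨ level v.1 = 0 ∨ level v.1 = -2 ^ m := by
  obtain ⟨u, a, ha, hva⟩ := hv
  rw [hva, level_cword h hm hk]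
  obtain ⟨d, rfl⟩ := h.ker a ha
  by_cases hd : redTwo f d = 0
  · have key : ∀ x : ZMod 4, reChar x = 1 ∨ reChar x = 0 ∨ reChar x = -1 := by decide
    simp only [h.eq_zero_of_red hd, zero_mul, map_zero, add_zero, Finset.sum_const,
      Finset.card_univ, hk, nsmul_eq_mul]
    rcases key u with hu | hu | hu <;> simp [hu]
  · exact Or.inr (Or.inl (h.sum_eq_zero_of_two_mul hd u))

lemma level_of_notMem_kerdockKer (hodd : Odd m) {v : kerdockGroup m f}
    (hv : v ∉ kerdockKer m f) :
    level v.1 = 2 ^ ((m - 1) / 2) ∨ level v.1 = -2 ^ ((m - 1) / 2) := by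
  obtain ⟨_, u, a, rfl⟩ := v
  have ha : redTwo f a ≠ 0 := fun ha => hv ⟨u, a, ha, rfl⟩
  have hsum := h.sum_sq_add_sum_sq ha u
  obtain ⟨n, rfl⟩ := hodd
  rw [hk] at hsum
  rw [level_cword h hm hk]
  have := sq_eq_of_sq_add_sq_eq_two_pow n _ _ (hsum.trans (by push_cast; rfl))
  simpa using this

end Code

/-- The values of the level on the five Lee weight classes. -/
def classLevel (m : ℕ) : Fin 5 → ℤ :=
  ![2 ^ m, 2 ^ ((m - 1) / 2), 0, -2 ^ ((m - 1) / 2), -2 ^ m]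

lemma mem_Kclass_iff {m : ℕ} {f : Polynomial (ZMod 4)} [Fintype (Teich m f)]
    (hcard : Fintype.card (Teich m f) = 2 ^ m) (i : Fin 5) (z : Word m f) :
    z ∈ Kclass m f i ↔ z ∈ kerdockGroup m f ∧ level z = classLevel m i := by
  have hle : 2 ^ ((m - 1) / 2) ≤ 2 ^ m := Nat.pow_le_pow_right (by norm_num) (by omega)
  change _ ↔ z ∈ Kerdock m f ∧ _
  rw [level_eq, hcard]
  fin_cases i <;> simp only [Kclass, classLevel, Fin.reduceFinMk, Fin.zero_eta, Fin.mk_one,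
    Fin.isValue, Matrix.cons_val, Set.mem_ofPred_eq] <;>
    refine and_congr_right fun _ => ?_ <;> zify [hle] <;> constructor <;> intro h <;> linarith

lemma classLevel_injective {m : ℕ} (hm : m ≠ 0) : Function.Injective (classLevel m) := by
  have hpos : (0 : ℤ) < 2 ^ ((m - 1) / 2) := by positivity
  have hlt : (2 : ℤ) ^ ((m - 1) / 2) < 2 ^ m := pow_lt_pow_right₀ (by norm_num) (by omega)
  intro i j hij
  fin_cases i <;> fin_cases j <;> simp [classLevel] at hij ⊢ <;> omega

/-- For odd `m ≥ 3` the Lee-weight classes `D_0, …, D_4` partition the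
Kerdock code, each is closed under negation, and the induced translation relations form a
4-class association scheme: for all `i, j` and all codewords `z, z'` in the same class,
the number of pairs `(r,s) ∈ D_i × D_j` with `r + s = z` equals the number of pairs with
`r + s = z'`. -/
theorem statement0 (m : ℕ) (hm : Odd m) (hm3 : 3 ≤ m)
    (f : Polynomial (ZMod 4)) (hmonic : f.Monic) (hdeg : f.natDegree = m)
    (hirr : Irreducible (f.map (ZMod.castHom (show (2:ℕ) ∣ 4 by norm_num) (ZMod 2)))) :
    (∀ z ∈ Kerdock m f, ∃! i : Fin 5, z ∈ Kclass m f i) ∧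
    (∀ i : Fin 5, ∀ z : Word m f, z ∈ Kclass m f i ↔ -z ∈ Kclass m f i) ∧
    (∀ i j k : Fin 5, ∀ z z' : Word m f, z ∈ Kclass m f k → z' ∈ Kclass m f k →
      Nat.card {p : Word m f × Word m f //
          p.1 ∈ Kclass m f i ∧ p.2 ∈ Kclass m f j ∧ p.1 + p.2 = z} =
      Nat.card {p : Word m f × Word m f //
          p.1 ∈ Kclass m f i ∧ p.2 ∈ Kclass m f j ∧ p.1 + p.2 = z'}) := by
  have hm0 : m ≠ 0 := by omega
  have : Fact (Irreducible (modTwo f)) := ⟨hirr⟩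
  have h := isTraceReduction_redTwo f hmonic (hdeg ▸ hm)
  have hk : Nat.card (AdjoinRoot (modTwo f)) = 2 ^ m := by
    rw [card_adjoinRoot_modTwo, natDegree_modTwo hmonic, hdeg]
  have : Finite (AdjoinRoot (modTwo f)) := Nat.finite_of_card_ne_zero (by rw [hk]; positivity)
  have := Fintype.ofFinite (AdjoinRoot (modTwo f))
  rw [Nat.card_eq_fintype_card] at hk
  have := Fintype.ofEquiv _ (h.teichEquiv hm0 hk)
  have hcard : Fintype.card (Teich m f) = 2 ^ m := by
    rw [← hk, Fintype.card_congr (h.teichEquiv hm0 hk)]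
  have := Fintype.ofFinite (kerdockGroup m f)
  have hmem := mem_Kclass_iff (f := f) hcard
  refine ⟨fun z hz => ?_, fun i z => ?_, fun i j k z z' hz hz' => ?_⟩
  · suffices hex : ∃ i, level z = classLevel m i by
      obtain ⟨i, hi⟩ := hex
      refine ⟨i, (hmem i z).2 ⟨hz, hi⟩, fun i' hi' => classLevel_injective hm0 ?_⟩
      rw [← ((hmem i' z).1 hi').2, hi]
    by_cases hH : (⟨z, hz⟩ : kerdockGroup m f) ∈ kerdockKer m f
    · rcases level_of_mem_kerdockKer h hm0 hk hH with hl | hl | hl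
      exacts [⟨0, hl⟩, ⟨2, hl⟩, ⟨4, hl⟩]
    · rcases level_of_notMem_kerdockKer h hm0 hk hm hH with hl | hl
      exacts [⟨1, hl⟩, ⟨3, hl⟩]
  · rw [hmem, hmem, level_neg, neg_mem_iff]
  · rw [hmem] at hz hz'
    have hcount : ∀ w (hw : w ∈ kerdockGroup m f),
        Nat.card {p : Word m f × Word m f //
          p.1 ∈ Kclass m f i ∧ p.2 ∈ Kclass m f j ∧ p.1 + p.2 = w} =
        Nat.card {r : kerdockGroup m f // level r.1 = classLevel m i ∧
          level ((⟨w, hw⟩ : kerdockGroup m f) - r).1 = classLevel m j} := by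
      intro w hw
      refine Nat.card_congr
        { toFun := fun p => ⟨⟨p.1.1, ((hmem i _).1 p.2.1).1⟩, ((hmem i _).1 p.2.1).2, ?_⟩
          invFun := fun r => ⟨(r.1.1, w - r.1.1), (hmem i _).2 ⟨r.1.2, r.2.1⟩,
            (hmem j _).2 ⟨sub_mem hw r.1.2, r.2.2⟩, add_sub_cancel _ _⟩
          left_inv := fun p => ?_
          right_inv := fun r => rfl }
      · obtain ⟨⟨x, y⟩, hx, hy, rfl⟩ := p
        simpa using ((hmem j _).1 hy).2
      · obtain ⟨⟨x, y⟩, hx, hy, rfl⟩ := p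
        simp
    rw [hcount z hz.1, hcount z' hz'.1]
    have hlt : (2 : ℤ) ^ ((m - 1) / 2) < 2 ^ m := pow_lt_pow_right₀ (by norm_num) (by omega)
    have hzero : ∀ x : kerdockGroup m f, level x.1 = 2 ^ m ↔ x = 0 := fun x => by
      have := level_eq_card_iff x.1
      rw [hcard] at this
      rw [← Subtype.coe_inj, AddSubgroup.coe_zero, ← this]
      norm_num
    have key := conv_eq_of_level_eq (fun x : kerdockGroup m f => level x.1) (kerdockKer m f)
      (constWord m f 2) (2 ^ m) (2 ^ ((m - 1) / 2)) _ (by positivity) hlt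
      ⟨2, 0, map_zero _, rfl⟩ hzero level_sub_constWord
      (fun x hx => level_of_mem_kerdockKer h hm0 hk hx)
      (fun x hx => level_of_notMem_kerdockKer h hm0 hk hm hx)
      (sum_level_mul_level h) (fun v => if v = classLevel m i then 1 else 0)
      (fun v => if v = classLevel m j then 1 else 0) ⟨z, hz.1⟩ ⟨z', hz'.1⟩
      (hz.2.trans hz'.2.symm)
    rw [← card_level_eq_conv, ← card_level_eq_conv] at key
    exact_mod_cast key
end

section
/- Let m ≥ 3 be an odd integer and q = 2^m. Partition the Delsarte–Goethals code 𝒟𝒢 into eight classes: S_0 = {z : w_L(z) = 0}, S_1 = {z : w_L(z) = q − 2^{(m+1)/2}}, S_2 = {z : w_L(z) = q − 2^{(m−1)/2}}, S_3 = {z : w_L(z) = q and z ∈ 𝒦}, S_4 = {z : w_L(z) = q and z ∉ 𝒦}, S_5 = {z : w_L(z) = q + 2^{(m−1)/2}}, S_6 = {z : w_L(z) = q + 2^{(m+1)/2}}, S_7 = {z : w_L(z) = 2q}. Then S_0, …, S_7 form a partition of 𝒟𝒢 with S_i = −S_i for each i, and the induced translation relations form a 7-class association scheme: for all i, j ∈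 {0,…,7} and all codewords z, z′ lying in the same class S_k, the number of pairs (r,s) ∈ S_i × S_j with r + s = z equals the number of pairs (r,s) ∈ S_i × S_j with r + s = z′. -/
open Polynomial

/-- The quaternary Delsarte–Goethals code
`𝒟𝒢 = {c(u,a,b) : u ∈ ℤ/4ℤ, a ∈ R, b ∈ 𝒯}`. -/
def DG (m : ℕ) (f : Polynomial (ZMod 4)) : Set (Word m f) :=
  {v | ∃ u a b, b ^ 2 ^ m = b ∧ v = cword m f u a b}

/-- The partition `S_0, …, S_7` of the Delsarte–Goethals code: by Lee weights
`0, q - √(2q), q - √(q/2), q, q, q + √(q/2), q + √(2q), 2q` (where `q = 2^m`,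
`√(2q) = 2^((m+1)/2)`, `√(q/2) = 2^((m-1)/2)`), the two weight-`q` classes being
distinguished by membership in the Kerdock code. -/
noncomputable def DGclass (m : ℕ) (f : Polynomial (ZMod 4)) : Fin 8 → Set (Word m f) :=
  ![{z | z ∈ DG m f ∧ leeWt m f z = 0},
    {z | z ∈ DG m f ∧ leeWt m f z = 2 ^ m - 2 ^ ((m + 1) / 2)},
    {z | z ∈ DG m f ∧ leeWt m f z = 2 ^ m - 2 ^ ((m - 1) / 2)},
    {z | z ∈ DG m f ∧ leeWt m f z = 2 ^ m ∧ z ∈ Kerdock m f},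
    {z | z ∈ DG m f ∧ leeWt m f z = 2 ^ m ∧ z ∉ Kerdock m f},
    {z | z ∈ DG m f ∧ leeWt m f z = 2 ^ m + 2 ^ ((m - 1) / 2)},
    {z | z ∈ DG m f ∧ leeWt m f z = 2 ^ m + 2 ^ ((m + 1) / 2)},
    {z | z ∈ DG m f ∧ leeWt m f z = 2 * 2 ^ m}]

namespace Goethals

/-- The additive character `k ↦ i ^ k` of `ℤ/4ℤ`. -/
noncomputable def chi : AddChar (ZMod 4) ℂ := AddChar.zmodChar 4 Complex.I_pow_four

lemma chi_one : chi 1 = Complex.I := by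
  have : (1 : ZMod 4).val = 1 := rfl
  simp [chi, AddChar.zmodChar_apply, this]

lemma chi_two : chi 2 = -1 := by
  have : (2 : ZMod 4).val = 2 := rfl
  simp [chi, AddChar.zmodChar_apply, this]

lemma chi_three : chi 3 = -Complex.I := by
  have : (3 : ZMod 4).val = 3 := rfl
  simp [chi, AddChar.zmodChar_apply, this]

lemma chi_eq_one_iff {k : ZMod 4} : chi k = 1 ↔ k = 0 := by
  refine ⟨fun h => ?_, fun h => by simp [h]⟩
  fin_cases k
  · rfl
  · exact absurd (chi_one.symm.trans h) (by simp [Complex.ext_iff])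
  · exact absurd (chi_two.symm.trans h) (by norm_num)
  · exact absurd (chi_three.symm.trans h) (by simp [Complex.ext_iff])

section Fourier

variable {Γ : Type*} [AddCommGroup Γ] [Fintype Γ] (p : Γ →+ Γ →+ ZMod 4)

/-- The Fourier transform of `f` with respect to the pairing `p`. -/
noncomputable def pairFourier (f : Γ → ℂ) (z : Γ) : ℂ := ∑ ψ, f ψ * chi (p ψ z)

lemma sum_chi_eq_ite {G : Type*} [AddCommGroup G] [Fintype G] (l : G →+ ZMod 4)
    [Decidable (∀ z, l z = 0)] :
    ∑ z, chi (l z) = if ∀ z, l z = 0 then (Fintype.card G : ℂ) else 0 := by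
  split_ifs with h
  · simp [h]
  · have : chi.compAddMonoidHom l ≠ 0 := by
      intro h0
      refine h fun z => chi_eq_one_iff.1 ?_
      simpa using DFunLike.congr_fun h0 z
    simpa using AddChar.sum_eq_zero_iff_ne_zero.2 this

lemma sum_chi_pairing [DecidableEq Γ] (hp : ∀ ψ, (∀ z, p ψ z = 0) → ψ = 0) (ψ : Γ) :
    ∑ z, chi (p ψ z) = if ψ = 0 then (Fintype.card Γ : ℂ) else 0 := by
  classical
  rw [sum_chi_eq_ite]
  refine if_congr ⟨hp ψ, ?_⟩ rfl rfl
  rintro rfl z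
  simp

lemma sum_pairFourier_mul (hp : ∀ ψ, (∀ z, p ψ z = 0) → ψ = 0) (f g : Γ → ℂ) (z : Γ) :
    ∑ r, pairFourier p f r * pairFourier p g (z - r)
      = Fintype.card Γ * pairFourier p (fun ψ => f ψ * g ψ) z := by
  classical
  have key : ∀ r, pairFourier p f r * pairFourier p g (z - r)
      = ∑ ψ, ∑ φ, f ψ * g φ * chi (p φ z) * chi (p (ψ - φ) r) := by
    intro r
    rw [pairFourier, pairFourier, Finset.sum_mul_sum]
    refine Finset.sum_congr rfl fun ψ _ => Finset.sum_congr rfl fun φ _ => ?_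
    simp only [map_add, map_neg, AddMonoidHom.add_apply,
      AddMonoidHom.neg_apply, sub_eq_add_neg, AddChar.map_add_eq_mul]
    ring
  simp_rw [key]
  rw [Finset.sum_comm]
  rw [pairFourier, Finset.mul_sum]
  refine Finset.sum_congr rfl fun ψ _ => ?_
  rw [Finset.sum_comm]
  simp_rw [← Finset.mul_sum, sum_chi_pairing p hp, sub_eq_zero]
  simp
  ring

lemma pairFourier_zero_right (f : Γ → ℂ) : pairFourier p f 0 = ∑ ψ, f ψ := by simp [pairFourier]

lemma pairFourier_neg {g : Γ → ℂ} (hg : ∀ ψ, g (-ψ) = g ψ) (z : Γ) :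
    pairFourier p g (-z) = pairFourier p g z := by
  rw [pairFourier, ← Equiv.sum_comp (Equiv.neg Γ)]
  simp [pairFourier, hg]

/-- Parseval's identity for even functions. -/
lemma sum_pairFourier_mul_pairFourier (hp : ∀ ψ, (∀ z, p ψ z = 0) → ψ = 0) (f : Γ → ℂ) {g : Γ → ℂ}
    (hg : ∀ ψ, g (-ψ) = g ψ) :
    ∑ z, pairFourier p f z * pairFourier p g z = Fintype.card Γ * ∑ ψ, f ψ * g ψ := by
  have h := sum_pairFourier_mul p hp f g 0
  simp only [zero_sub, pairFourier_neg p hg, pairFourier_zero_right] at h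
  exact h

/-- The number of walks of length `k` from `0` to `ψ` in the Cayley graph of `D`. -/
def walk {Γ : Type*} [AddCommGroup Γ] [DecidableEq Γ] (D : Finset Γ) : ℕ → Γ → ℕ
  | 0, ψ => if ψ = 0 then 1 else 0
  | k + 1, ψ => ∑ g ∈ D, walk D k (ψ - g)

variable [DecidableEq Γ] (D : Finset Γ)

omit [Fintype Γ] in
lemma walk_neg (hD : ∀ g ∈ D, -g ∈ D) (k : ℕ) (ψ : Γ) : walk D k (-ψ) = walk D k ψ := by
  induction k generalizing ψ with
  | zero => simp [walk]
  | succ k ih =>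
    rw [walk, walk]
    refine Finset.sum_nbij' (fun g => -g) (fun g => -g) hD hD (by simp) (by simp) fun g _ => ?_
    rw [← ih]
    congr 1
    abel

lemma pairFourier_walk (k : ℕ) (z : Γ) :
    pairFourier p (fun ψ => (walk D k ψ : ℂ)) z = (∑ g ∈ D, chi (p g z)) ^ k := by
  induction k with
  | zero => simp [pairFourier, walk]
  | succ k ih =>
    rw [pow_succ, ← ih, pairFourier, pairFourier]
    simp only [walk, Nat.cast_sum, Finset.sum_mul, Finset.mul_sum]
    rw [Finset.sum_comm]
    refine Finset.sum_congr rfl fun g _ => ?_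
    rw [← Equiv.sum_comp (Equiv.addRight g)]
    refine Finset.sum_congr rfl fun ψ _ => ?_
    simp [AddChar.map_add_eq_mul]
    ring

omit [Fintype Γ] in
lemma walk_one (ψ : Γ) : walk D 1 ψ = if ψ ∈ D then 1 else 0 := by
  simp [walk, sub_eq_zero]

omit [Fintype Γ] in
lemma walk_two_pos_iff (ψ : Γ) : 0 < walk D 2 ψ ↔ ∃ g ∈ D, ψ - g ∈ D := by
  rw [walk, Finset.sum_pos_iff]
  simp only [walk_one]
  constructor
  · rintro ⟨g, hg, h⟩
    exact ⟨g, hg, by by_contra h'; simp [h'] at h⟩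
  · rintro ⟨g, hg, h⟩
    exact ⟨g, hg, by simp [h]⟩

omit [Fintype Γ] in
lemma two_le_walk_two (h4 : ∀ g : Γ, 4 • g = 0) (hD : ∀ g ∈ D, -g ∈ D)
    (hne : ∀ g ∈ D, -g ≠ g) {ψ : Γ} (h : 0 < walk D 2 ψ) : 2 ≤ walk D 2 ψ := by
  obtain ⟨g, hg, hg'⟩ := (walk_two_pos_iff D ψ).1 h
  have two : ∀ k ∈ D, ψ - k ∈ D → g ≠ k → 2 ≤ walk D 2 ψ := by
    intro k hk hk' hgk
    rw [walk]
    calc 2 = ∑ x ∈ ({g, k} : Finset Γ), 1 := by rw [Finset.sum_pair hgk]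
      _ ≤ ∑ x ∈ ({g, k} : Finset Γ), walk D 1 (ψ - x) := by
          refine Finset.sum_le_sum fun x hx => ?_
          simp only [Finset.mem_insert, Finset.mem_singleton] at hx
          rcases hx with rfl | rfl <;> simp [walk_one, *]
      _ ≤ _ := by
          refine Finset.sum_le_sum_of_subset ?_
          simp [Finset.insert_subset_iff, hg, hk]
  by_cases hgg : g = ψ - g
  · refine two (-g) (hD g hg) ?_ (hne g hg).symm
    have : ψ - -g = -g := by
      have e : ψ = g + g := by rw [eq_sub_iff_add_eq] at hgg; exact hgg.symm
      rw [e, ← sub_eq_zero]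
      have := h4 g
      rw [← this]
      abel
    rw [this]
    exact hD g hg
  · exact two (ψ - g) hg' (by simpa using hg) hgg

omit [Fintype Γ] in
lemma six_le_walk_three (h4 : ∀ g : Γ, 4 • g = 0) (hD : ∀ g ∈ D, -g ∈ D)
    (hne : ∀ g ∈ D, -g ≠ g) {ψ : Γ} (hψ : ψ ∉ D) (h : 0 < walk D 3 ψ) : 6 ≤ walk D 3 ψ := by
  have six : ∀ a ∈ D, ∀ b ∈ D, ∀ c ∈ D, a ≠ b → a ≠ c → b ≠ c → 0 < walk D 2 (ψ - a) →
      0 < walk D 2 (ψ - b) → 0 < walk D 2 (ψ - c) → 6 ≤ walk D 3 ψ := by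
    intro a ha b hb c hc hab hac hbc pa pb pc
    have e : (6 : ℕ) = ∑ _x ∈ ({a, b, c} : Finset Γ), 2 := by
      rw [Finset.sum_const, Finset.card_eq_three.2 ⟨a, b, c, hab, hac, hbc, rfl⟩]; rfl
    rw [walk, e]
    calc _ ≤ ∑ x ∈ ({a, b, c} : Finset Γ), walk D 2 (ψ - x) := by
          refine Finset.sum_le_sum fun x hx => two_le_walk_two D h4 hD hne ?_
          simp only [Finset.mem_insert, Finset.mem_singleton] at hx
          rcases hx with rfl | rfl | rfl <;> assumption
      _ ≤ _ := by
          refine Finset.sum_le_sum_of_subset ?_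
          simp [Finset.insert_subset_iff, ha, hb, hc]
  have three : ∀ g : Γ, g + g + g = -g := by
    intro g
    rw [← sub_eq_zero, ← h4 g]
    abel
  have repeated : ∀ g ∈ D, ∀ k ∈ D, ψ = g + g + k → 6 ≤ walk D 3 ψ := by
    intro g hg k hk e
    have hgk : g ≠ k := by
      rintro rfl
      exact hψ (by rw [e, three]; exact hD _ hg)
    have hgk' : -g ≠ k := by
      rintro rfl
      exact hψ (by simpa [e] using hg)
    refine six g hg (-g) (hD _ hg) k hk (hne g hg).symm hgk hgk' ?_ ?_ ?_
    · exact (walk_two_pos_iff D _).2 ⟨g, hg, by simpa [e, add_sub_assoc] using hk⟩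
    · refine (walk_two_pos_iff D _).2 ⟨k, hk, ?_⟩
      have : ψ - -g - k = g + g + g := by rw [e]; abel
      rw [this, three]
      exact hD _ hg
    · exact (walk_two_pos_iff D _).2 ⟨g, hg, by simpa [e] using hg⟩
  rw [walk, Finset.sum_pos_iff] at h
  obtain ⟨a, ha, h⟩ := h
  obtain ⟨b, hb, hc⟩ := (walk_two_pos_iff D _).1 h
  obtain ⟨c, rfl⟩ : ∃ c, ψ = a + b + c := ⟨ψ - a - b, by abel⟩
  have hc : c ∈ D := by
    convert hc using 1
    abel
  by_cases hab : a = b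
  · exact repeated a ha c hc (by rw [hab])
  by_cases hac : a = c
  · exact repeated a ha b hb (by rw [hac]; abel)
  by_cases hbc : b = c
  · exact repeated b hb a ha (by rw [hbc]; abel)
  refine six a ha b hb c hc hab hac hbc ?_ ?_ ?_
  · exact (walk_two_pos_iff D _).2 ⟨b, hb, by convert hc using 1; abel⟩
  · exact (walk_two_pos_iff D _).2 ⟨a, ha, by convert hc using 1; abel⟩
  · exact (walk_two_pos_iff D _).2 ⟨a, ha, by convert hb using 1; abel⟩

end Fourier

/-- A connection set `D` in a self-dual group of exponent four whose eigenvalues `n` are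
`0, ±a, ±2a` off the annihilator of the subgroup `K`, and whose closed walks of length four
and walks of length four into `K` are known. -/
structure WalkData (Γ : Type*) [AddCommGroup Γ] [Fintype Γ] [DecidableEq Γ] where
  /-- the self-duality pairing -/
  p : Γ →+ Γ →+ ZMod 4
  symm : ∀ ψ z, p ψ z = p z ψ
  nondeg : ∀ ψ, (∀ z, p ψ z = 0) → ψ = 0
  four_smul : ∀ g : Γ, 4 • g = 0
  /-- the connection set -/
  D : Finset Γ
  neg_mem : ∀ g ∈ D, -g ∈ D
  neg_ne : ∀ g ∈ D, -g ≠ g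
  /-- the involution detecting the parity of walks -/
  o : Γ
  o_ne : o ≠ 0
  o_add_o : o + o = 0
  pairing_o : ∀ g ∈ D, p g o = 2
  /-- the subgroup singled out in the dual partition -/
  K : AddSubgroup Γ
  o_perp : ∀ ψ ∈ K, p ψ o = 0
  /-- half of the largest nontrivial eigenvalue -/
  a : ℤ
  a_ne : a ≠ 0
  card_D : (D.card : ℤ) = a ^ 2
  card_univ : 2 * (Fintype.card Γ : ℤ) = (a ^ 2) ^ 3
  card_K : 4 * (Nat.card K : ℤ) = (a ^ 2) ^ 2
  /-- the eigenvalues -/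
  n : Γ → ℤ
  n_eq : ∀ z, (n z : ℂ) = ∑ g ∈ D, chi (p g z)
  n_mem : ∀ z, ¬ (∀ ψ ∈ K, p ψ z = 0) →
    n z = 0 ∨ n z = a ∨ n z = -a ∨ n z = 2 * a ∨ n z = -(2 * a)
  n_perp : ∀ z, (∀ ψ ∈ K, p ψ z = 0) → z ≠ 0 → z ≠ o → n z = 0
  walk_four_zero : (walk D 4 0 : ℤ) = 3 * (a ^ 2) ^ 2 - 2 * a ^ 2
  walk_two_K : ∀ ψ ∈ K, ψ ≠ 0 → walk D 2 ψ = 0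
  walk_four_K : ∀ ψ ∈ K, ψ ≠ 0 → walk D 4 ψ = 0 ∨ (walk D 4 ψ : ℤ) = 6 * a ^ 2

namespace WalkData

variable {Γ : Type*} [AddCommGroup Γ] [Fintype Γ] [DecidableEq Γ] (S : WalkData Γ)

/-- The size of the connection set, as a real number. -/
def N : ℝ := (S.a : ℝ) ^ 2

/-- The number of walks of length `k`, as a real number. -/
def w (k : ℕ) (ψ : Γ) : ℝ := walk S.D k ψ

/-- The annihilator of `K`. -/
def Perp (z : Γ) : Prop := ∀ ψ ∈ S.K, S.p ψ z = 0

open Classical in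
/-- The indicator function of `K`. -/
noncomputable def indK (ψ : Γ) : ℝ := if ψ ∈ S.K then 1 else 0

/-- The parity character of the dual group. -/
def sgn (ψ : Γ) : ℝ := if S.p ψ S.o = 0 then 1 else -1

/-- The indicator function of `0`. -/
def ind0 (ψ : Γ) : ℝ := if ψ = 0 then 1 else 0

lemma N_pos : 0 < S.N := by
  have := S.a_ne
  unfold N
  positivity

lemma card_eq : (Fintype.card Γ : ℝ) = S.N ^ 3 / 2 := by
  have := S.card_univ
  have : 2 * (Fintype.card Γ : ℝ) = S.N ^ 3 := by unfold N; exact_mod_cast this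
  linarith

lemma card_D_eq : (S.D.card : ℝ) = S.N := by
  have := S.card_D
  unfold N
  exact_mod_cast this

lemma card_K_eq : (Nat.card S.K : ℝ) = S.N ^ 2 / 4 := by
  have := S.card_K
  have : 4 * (Nat.card S.K : ℝ) = S.N ^ 2 := by unfold N; exact_mod_cast this
  linarith

lemma n_zero : (S.n 0 : ℝ) = S.N := by
  have h := S.n_eq 0
  simp only [map_zero, AddChar.map_zero_eq_one, Finset.sum_const, nsmul_eq_mul, mul_one] at h
  rw [← S.card_D_eq]
  exact_mod_cast h

lemma n_o : (S.n S.o : ℝ) = -S.N := by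
  have h := S.n_eq S.o
  rw [Finset.sum_congr rfl fun g hg => by rw [S.pairing_o g hg, chi_two]] at h
  simp only [Finset.sum_const, nsmul_eq_mul, mul_neg, mul_one] at h
  rw [← S.card_D_eq]
  exact_mod_cast h

lemma perp_zero : S.Perp 0 := by simp [Perp]

lemma perp_o : S.Perp S.o := S.o_perp

lemma pairing_o_eq (ψ : Γ) : S.p ψ S.o = 0 ∨ S.p ψ S.o = 2 := by
  have h : S.p ψ S.o + S.p ψ S.o = 0 := by rw [← map_add, S.o_add_o, map_zero]
  generalize S.p ψ S.o = x at h
  revert x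
  decide

lemma chi_pairing_o (ψ : Γ) : chi (S.p ψ S.o) = (S.sgn ψ : ℂ) := by
  have h2 : (2 : ZMod 4) ≠ 0 := by decide
  rcases S.pairing_o_eq ψ with h | h <;> simp [sgn, h, chi_two, h2]

lemma sgn_eq (ψ : Γ) : S.sgn ψ = 1 ∨ S.sgn ψ = -1 := by
  unfold sgn
  split_ifs <;> simp

lemma pairing_o_of_walk {k : ℕ} {ψ : Γ} (h : walk S.D k ψ ≠ 0) : S.p ψ S.o = 2 * k := by
  induction k generalizing ψ with
  | zero =>
    have : ψ = 0 := by by_contra h'; simp [walk, h'] at h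
    simp [this]
  | succ k ih =>
    rw [walk] at h
    obtain ⟨g, hg, h⟩ := Finset.exists_ne_zero_of_sum_ne_zero h
    have := ih h
    rw [map_sub, AddMonoidHom.sub_apply, S.pairing_o g hg] at this
    push_cast
    linear_combination this

lemma sgn_mul_w (k : ℕ) (ψ : Γ) : S.sgn ψ * S.w k ψ = (-1) ^ k * S.w k ψ := by
  by_cases h : walk S.D k ψ = 0
  · simp [w, h]
  · congr 1
    have h2 : (2 : ZMod 4) ≠ 0 := by decide
    have h4 : (2 * 2 : ZMod 4) = 0 := by decide
    have := S.pairing_o_of_walk h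
    rw [sgn, this]
    rcases Nat.even_or_odd' k with ⟨j, rfl | rfl⟩
    · simp [← mul_assoc, h4]
    · simp [mul_add, ← mul_assoc, h4, h2, pow_succ]

lemma w_zero (ψ : Γ) : S.w 0 ψ = ind0 ψ := by simp [w, walk, ind0]

lemma w_one (ψ : Γ) : S.w 1 ψ = if ψ ∈ S.D then 1 else 0 := by simp [w, walk_one]

lemma pairFourier_w (k : ℕ) (z : Γ) :
    pairFourier S.p (fun ψ => (S.w k ψ : ℂ)) z = (S.n z : ℂ) ^ k := by
  have := pairFourier_walk S.p S.D k z
  rw [← S.n_eq] at this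
  simpa [w] using this

lemma sum_w (k : ℕ) : ∑ ψ, S.w k ψ = S.N ^ k := by
  have h := S.pairFourier_w k 0
  rw [pairFourier_zero_right] at h
  rw [← S.n_zero]
  exact_mod_cast h

lemma card_mul_sum_w_mul_w (j k : ℕ) :
    S.N ^ 3 / 2 * ∑ ψ, S.w j ψ * S.w k ψ = ∑ z, (S.n z : ℝ) ^ (j + k) := by
  have h := sum_pairFourier_mul_pairFourier S.p S.nondeg (fun ψ => (S.w j ψ : ℂ))
    (g := fun ψ => (S.w k ψ : ℂ)) (fun ψ => by simp [w, walk_neg S.D S.neg_mem])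
  simp only [pairFourier_w, ← pow_add] at h
  rw [← card_eq]
  exact_mod_cast h.symm

open Classical in
lemma pairFourier_indK (z : Γ) :
    pairFourier S.p (fun ψ => (S.indK ψ : ℂ)) z = if S.Perp z then (Nat.card S.K : ℂ) else 0 := by
  have h := sum_chi_eq_ite ((S.p.flip z).comp S.K.subtype)
  simp only [AddMonoidHom.comp_apply, AddSubgroup.subtype_apply, AddMonoidHom.flip_apply,
    Subtype.forall, ← Nat.card_eq_fintype_card] at h
  have e : (if S.Perp z then (Nat.card S.K : ℂ) else 0) = ∑ ψ : S.K, chi (S.p ψ z) := by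
    rw [h]
    exact if_congr Iff.rfl rfl rfl
  rw [e, pairFourier]
  simp only [indK, apply_ite (Complex.ofReal), Complex.ofReal_one, Complex.ofReal_zero, ite_mul,
    one_mul, zero_mul]
  rw [← Finset.sum_filter]
  exact Finset.sum_subtype _ (by simp) _

lemma n_eq_of_ne {z : Γ} (h0 : z ≠ 0) (ho : z ≠ S.o) :
    (S.n z : ℝ) ^ 2 * ((S.n z : ℝ) ^ 2 - S.N) * ((S.n z : ℝ) ^ 2 - 4 * S.N) = 0 := by
  by_cases hz : S.Perp z
  · simp [S.n_perp z hz h0 ho]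
  · unfold N
    rcases S.n_mem z hz with h | h | h | h | h <;> rw [h] <;> push_cast <;> ring

lemma sum_zero_o (f : Γ → ℝ) (hf : ∀ z, z ≠ 0 → z ≠ S.o → f z = 0) :
    ∑ z, f z = f 0 + f S.o := by
  rw [← Finset.sum_pair S.o_ne.symm]
  refine (Finset.sum_subset (Finset.subset_univ _) fun z _ hz => ?_).symm
  simp only [Finset.mem_insert, Finset.mem_singleton, not_or] at hz
  exact hf z hz.1 hz.2

lemma moment_recursion (k : ℕ) (hk : Even k) :
    ∑ z, (S.n z : ℝ) ^ (k + 6) = 5 * S.N * ∑ z, (S.n z : ℝ) ^ (k + 4)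
      - 4 * S.N ^ 2 * ∑ z, (S.n z : ℝ) ^ (k + 2)
      + 2 * S.N ^ k * (S.N ^ 2 * (S.N ^ 2 - S.N) * (S.N ^ 2 - 4 * S.N)) := by
  have h := S.sum_zero_o (fun z => (S.n z : ℝ) ^ k *
    ((S.n z : ℝ) ^ 2 * ((S.n z : ℝ) ^ 2 - S.N) * ((S.n z : ℝ) ^ 2 - 4 * S.N)))
    (fun z h0 ho => by rw [S.n_eq_of_ne h0 ho, mul_zero])
  simp only [n_zero, n_o, neg_sq, hk.neg_pow] at h
  have e : ∑ z, (S.n z : ℝ) ^ k *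
      ((S.n z : ℝ) ^ 2 * ((S.n z : ℝ) ^ 2 - S.N) * ((S.n z : ℝ) ^ 2 - 4 * S.N))
      = ∑ z, (S.n z : ℝ) ^ (k + 6) - 5 * S.N * ∑ z, (S.n z : ℝ) ^ (k + 4)
      + 4 * S.N ^ 2 * ∑ z, (S.n z : ℝ) ^ (k + 2) := by
    rw [Finset.mul_sum, Finset.mul_sum, ← Finset.sum_sub_distrib, ← Finset.sum_add_distrib]
    exact Finset.sum_congr rfl fun z _ => by ring
  linarith

lemma w_four_zero : S.w 4 0 = 3 * S.N ^ 2 - 2 * S.N := by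
  have := S.walk_four_zero
  unfold w N
  exact_mod_cast this

lemma moment_two : ∑ z, (S.n z : ℝ) ^ 2 = S.N ^ 3 / 2 * S.N := by
  rw [← S.card_mul_sum_w_mul_w 1 1]
  congr 1
  simp [w_one, S.card_D_eq]

lemma moment_four : ∑ z, (S.n z : ℝ) ^ 4 = S.N ^ 3 / 2 * (3 * S.N ^ 2 - 2 * S.N) := by
  rw [← S.card_mul_sum_w_mul_w 0 4]
  congr 1
  simp [w_zero, ind0, S.w_four_zero]

lemma moment_six : ∑ z, (S.n z : ℝ) ^ 6
    = S.N ^ 3 / 2 * (15 * S.N ^ 3 - 30 * S.N ^ 2 + 16 * S.N) := by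
  have := S.moment_recursion 0 (by decide)
  simp only [zero_add, S.moment_four, S.moment_two] at this
  rw [this]
  ring

lemma moment_eight : ∑ z, (S.n z : ℝ) ^ 8
    = S.N ^ 3 / 2 * (4 * S.N ^ 5 + 43 * S.N ^ 4 - 126 * S.N ^ 3 + 80 * S.N ^ 2) := by
  have := S.moment_recursion 2 (by decide)
  norm_num only [S.moment_four, S.moment_six] at this
  rw [this]
  ring

lemma sum_w_mul_w {j k : ℕ} {c : ℝ} (h : ∑ z, (S.n z : ℝ) ^ (j + k) = S.N ^ 3 / 2 * c) :
    ∑ ψ, S.w j ψ * S.w k ψ = c := by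
  rw [← card_mul_sum_w_mul_w] at h
  have := S.N_pos
  exact mul_left_cancel₀ (by positivity) h

lemma sum_ind0_mul (f : Γ → ℝ) : ∑ ψ, ind0 ψ * f ψ = f 0 := by simp [ind0]

lemma sum_indK : ∑ ψ, S.indK ψ = S.N ^ 2 / 4 := by
  classical
  have h := S.pairFourier_indK 0
  rw [pairFourier_zero_right, if_pos S.perp_zero] at h
  rw [← card_K_eq]
  exact_mod_cast h

lemma sum_indK_mul_w_four : ∑ ψ, S.indK ψ * S.w 4 ψ = S.N ^ 3 := by
  classical
  have h := sum_pairFourier_mul_pairFourier S.p S.nondeg (fun ψ => (S.indK ψ : ℂ))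
    (g := fun ψ => (S.w 4 ψ : ℂ)) (fun ψ => by simp [w, walk_neg S.D S.neg_mem])
  simp only [pairFourier_w, pairFourier_indK] at h
  have h' : ∑ z, (if S.Perp z then (Nat.card S.K : ℝ) else 0) * (S.n z : ℝ) ^ 4
      = Fintype.card Γ * ∑ ψ, S.indK ψ * S.w 4 ψ := by
    have e : ∀ z, ((if S.Perp z then (Nat.card S.K : ℂ) else 0) * (S.n z : ℂ) ^ 4)
        = (((if S.Perp z then (Nat.card S.K : ℝ) else 0) * (S.n z : ℝ) ^ 4 : ℝ) : ℂ) := by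
      intro z
      split_ifs <;> push_cast <;> rfl
    simp only [e] at h
    exact_mod_cast h
  rw [S.sum_zero_o _ ?_] at h'
  · simp only [if_pos S.perp_zero, if_pos S.perp_o, n_zero, n_o, card_K_eq, S.card_eq] at h'
    have := S.N_pos
    have h3 : S.N ^ 3 ≠ 0 := by positivity
    refine mul_left_cancel₀ h3 ?_
    linarith
  · intro z h0 ho
    by_cases hz : S.Perp z
    · simp [S.n_perp z hz h0 ho]
    · simp [hz]

lemma pairFourier_sgn (z : Γ) :
    pairFourier S.p (fun ψ => (S.sgn ψ : ℂ)) z = if z = S.o then (Fintype.card Γ : ℂ) else 0 := by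
  have h := sum_chi_pairing S.p S.nondeg (S.o + z)
  have e : S.o + z = 0 ↔ z = S.o := by
    rw [add_eq_zero_iff_neg_eq, neg_eq_of_add_eq_zero_right S.o_add_o, eq_comm]
  simp only [e] at h
  rw [← h, pairFourier]
  refine Finset.sum_congr rfl fun ψ _ => ?_
  rw [S.symm _ ψ, map_add, AddChar.map_add_eq_mul, chi_pairing_o]

lemma sum_sgn : ∑ ψ, S.sgn ψ = 0 := by
  have h := S.pairFourier_sgn 0
  rw [pairFourier_zero_right, if_neg S.o_ne.symm] at h
  exact_mod_cast h

omit [AddCommGroup Γ] [DecidableEq Γ] in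
lemma forall_eq_zero_of_sum {f : Γ → ℝ} (hf : ∀ ψ, 0 ≤ f ψ) (h : ∑ ψ, f ψ = 0) (ψ : Γ) :
    f ψ = 0 :=
  (Finset.sum_eq_zero_iff_of_nonneg fun x _ => hf x).1 h ψ (Finset.mem_univ ψ)

lemma w_two_zero : S.w 2 0 = S.N := by
  have h := S.sum_w_mul_w (j := 0) (k := 2) S.moment_two
  simpa [w_zero, sum_ind0_mul] using h

lemma w_two_eq {ψ : Γ} (hψ : ψ ≠ 0) : S.w 2 ψ = 0 ∨ S.w 2 ψ = 2 := by
  have h := forall_eq_zero_of_sum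
    (f := fun ψ => S.w 2 ψ * S.w 2 ψ - 2 * S.w 2 ψ - ind0 ψ * (S.N * (S.N - 2))) ?_ ?_ ψ
  · simp only [ind0, if_neg hψ, zero_mul, sub_zero] at h
    have : S.w 2 ψ * (S.w 2 ψ - 2) = 0 := by linarith
    rcases mul_eq_zero.1 this with h | h
    · exact Or.inl h
    · exact Or.inr (by linarith)
  · intro ψ
    by_cases h0 : ψ = 0
    · simp only [h0, w_two_zero, ind0, if_pos]
      linarith
    · simp only [ind0, if_neg h0]
      rcases Nat.eq_zero_or_pos (walk S.D 2 ψ) with h | h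
      · simp [w, h]
      · have := two_le_walk_two S.D S.four_smul S.neg_mem S.neg_ne h
        have : (2 : ℝ) ≤ S.w 2 ψ := by unfold w; exact_mod_cast this
        nlinarith
  · rw [Finset.sum_sub_distrib, Finset.sum_sub_distrib, ← Finset.mul_sum,
      S.sum_w_mul_w S.moment_four, sum_w, sum_ind0_mul]
    ring

/-- The indicator function of the elements of weight two. -/
noncomputable def indTwo (ψ : Γ) : ℝ := (S.w 2 ψ - S.N * ind0 ψ) / 2

lemma indTwo_zero : S.indTwo 0 = 0 := by simp [indTwo, w_two_zero, ind0]

lemma indTwo_of_ne {ψ : Γ} (hψ : ψ ≠ 0) : S.indTwo ψ = S.w 2 ψ / 2 := by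
  simp [indTwo, ind0, hψ]

lemma w_three_eq (ψ : Γ) : (ψ ∈ S.D → S.w 3 ψ = 3 * S.N - 2) ∧
    (ψ ∉ S.D → S.w 3 ψ = 0 ∨ S.w 3 ψ = 6) := by
  have h := forall_eq_zero_of_sum
    (f := fun ψ => S.w 3 ψ * S.w 3 ψ - 6 * S.w 3 ψ
      + (10 - 6 * S.N) * (S.w 1 ψ * S.w 3 ψ) + (3 * S.N - 2) ^ 2 * S.w 1 ψ) ?_ ?_ ψ
  · constructor
    · intro hψ
      simp only [w_one, if_pos hψ] at h
      have : (S.w 3 ψ - (3 * S.N - 2)) ^ 2 = 0 := by linarith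
      have := pow_eq_zero_iff (two_ne_zero) |>.1 this
      linarith
    · intro hψ
      simp only [w_one, if_neg hψ] at h
      have : S.w 3 ψ * (S.w 3 ψ - 6) = 0 := by linarith
      rcases mul_eq_zero.1 this with h | h
      · exact Or.inl h
      · exact Or.inr (by linarith)
  · intro ψ
    by_cases hψ : ψ ∈ S.D
    · simp only [w_one, if_pos hψ]
      nlinarith [sq_nonneg (S.w 3 ψ - (3 * S.N - 2))]
    · simp only [w_one, if_neg hψ]
      rcases Nat.eq_zero_or_pos (walk S.D 3 ψ) with h | h
      · simp [w, h]
      · have := six_le_walk_three S.D S.four_smul S.neg_mem S.neg_ne hψ h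
        have : (6 : ℝ) ≤ S.w 3 ψ := by unfold w; exact_mod_cast this
        nlinarith
  · simp only [Finset.sum_sub_distrib, Finset.sum_add_distrib, ← Finset.mul_sum, sum_w]
    rw [S.sum_w_mul_w S.moment_six, S.sum_w_mul_w S.moment_four]
    ring

lemma indK_eq (ψ : Γ) : (ψ ∈ S.K ∧ S.indK ψ = 1 ∧ S.sgn ψ = 1) ∨ (ψ ∉ S.K ∧ S.indK ψ = 0) := by
  by_cases h : ψ ∈ S.K
  · exact Or.inl ⟨h, by simp [indK, h], by simp [sgn, S.o_perp ψ h]⟩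
  · exact Or.inr ⟨h, by simp [indK, h]⟩

lemma indK_zero : S.indK 0 = 1 := by simp [indK]

lemma sgn_zero : S.sgn 0 = 1 := by simp [sgn]

lemma w_two_of_mem_K {ψ : Γ} (hψ : ψ ∈ S.K) (h0 : ψ ≠ 0) : S.w 2 ψ = 0 := by
  simp [w, S.walk_two_K ψ hψ h0]

lemma w_four_of_mem_K {ψ : Γ} (hψ : ψ ∈ S.K) (h0 : ψ ≠ 0) : S.w 4 ψ = 0 ∨ S.w 4 ψ = 6 * S.N := by
  rcases S.walk_four_K ψ hψ h0 with h | h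
  · exact Or.inl (by simp [w, h])
  · refine Or.inr ?_
    unfold w N
    exact_mod_cast h

/-- The indicator function of the even elements outside `K` that do not have weight two. -/
noncomputable def indRest (ψ : Γ) : ℝ := (1 + S.sgn ψ) / 2 - S.indK ψ - S.indTwo ψ

lemma w_four_variance (ψ : Γ) : S.indTwo ψ * (S.w 4 ψ - (12 * S.N - 16)) ^ 2 = 0 ∧
    S.indRest ψ * (S.w 4 ψ - 4 * (S.N - 4)) ^ 2 = 0 := by
  have nonneg : ∀ ψ, 0 ≤ S.indTwo ψ ∧ 0 ≤ S.indRest ψ ∧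
      0 ≤ (S.indK ψ - ind0 ψ) * (S.w 4 ψ * (S.w 4 ψ - 6 * S.N)) := by
    intro ψ
    by_cases h0 : ψ = 0
    · subst h0
      simp [indTwo_zero, indRest, indK_zero, sgn_zero, ind0]
    · have hs : S.indTwo ψ ≠ 0 → S.sgn ψ = 1 := by
        intro h
        rw [S.indTwo_of_ne h0] at h
        have h2 : S.w 2 ψ ≠ 0 := by
          rintro h'
          simp [h'] at h
        exact mul_right_cancel₀ h2 (by simpa using S.sgn_mul_w 2 ψ)
      have h2 : S.indTwo ψ = 0 ∨ S.indTwo ψ = 1 := by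
        rw [S.indTwo_of_ne h0]
        rcases S.w_two_eq h0 with h | h <;> simp [h]
      rcases S.indK_eq ψ with ⟨hK, hk, hs'⟩ | ⟨hK, hk⟩
      · have : S.indTwo ψ = 0 := by rw [S.indTwo_of_ne h0, S.w_two_of_mem_K hK h0, zero_div]
        rcases S.w_four_of_mem_K hK h0 with h | h <;> simp [indRest, this, hk, hs', ind0, h0, h]
      · refine ⟨by rcases h2 with h | h <;> simp [h], ?_, by simp [hk, ind0, h0]⟩
        rcases h2 with h | h
        · rcases S.sgn_eq ψ with h' | h' <;> simp [indRest, h, h', hk]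
        · simp [indRest, h, hs (by simp [h]), hk]
  have h := forall_eq_zero_of_sum
    (f := fun ψ => S.indTwo ψ * (S.w 4 ψ - (12 * S.N - 16)) ^ 2
      + S.indRest ψ * (S.w 4 ψ - 4 * (S.N - 4)) ^ 2
      + (S.indK ψ - ind0 ψ) * (S.w 4 ψ * (S.w 4 ψ - 6 * S.N))) ?_ ?_ ψ
  · have := nonneg ψ
    have h1 := mul_nonneg this.1 (sq_nonneg (S.w 4 ψ - (12 * S.N - 16)))
    have h2 := mul_nonneg this.2.1 (sq_nonneg (S.w 4 ψ - 4 * (S.N - 4)))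
    constructor <;> linarith [this.2.2]
  · intro ψ
    have := nonneg ψ
    have h1 := mul_nonneg this.1 (sq_nonneg (S.w 4 ψ - (12 * S.N - 16)))
    have h2 := mul_nonneg this.2.1 (sq_nonneg (S.w 4 ψ - 4 * (S.N - 4)))
    linarith [this.2.2]
  · have e : ∀ ψ, S.indTwo ψ * (S.w 4 ψ - (12 * S.N - 16)) ^ 2
        + S.indRest ψ * (S.w 4 ψ - 4 * (S.N - 4)) ^ 2
        + (S.indK ψ - ind0 ψ) * (S.w 4 ψ * (S.w 4 ψ - 6 * S.N))
        = S.w 4 ψ * S.w 4 ψ - 8 * (S.N - 4) * S.w 4 ψ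
          + (-8 * S.N) * (S.w 2 ψ * S.w 4 ψ)
          + (2 * S.N - 32) * (S.indK ψ * S.w 4 ψ)
          + ((12 * S.N - 16) ^ 2 - (4 * (S.N - 4)) ^ 2) / 2 * S.w 2 ψ
          + (4 * (S.N - 4)) ^ 2 * (1 / 2 + S.sgn ψ / 2 - S.indK ψ)
          + ind0 ψ * (8 * S.N * S.N * S.w 4 ψ
            - ((12 * S.N - 16) ^ 2 - (4 * (S.N - 4)) ^ 2) / 2 * S.N
            - S.w 4 ψ * S.w 4 ψ + 6 * S.N * S.w 4 ψ) := by
      intro ψ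
      have := S.sgn_mul_w 4 ψ
      unfold indRest indTwo
      linear_combination (S.w 4 ψ / 2 - 4 * (S.N - 4)) * this
    simp only [e]
    simp only [Finset.sum_add_distrib, Finset.sum_sub_distrib, ← Finset.mul_sum, sum_ind0_mul,
      sum_w, sum_indK_mul_w_four, sum_indK, ← Finset.sum_div, sum_sgn, w_four_zero]
    rw [S.sum_w_mul_w S.moment_eight, S.sum_w_mul_w S.moment_six]
    simp only [Finset.sum_const, Finset.card_univ, nsmul_eq_mul, S.card_eq]
    ring

/-- Equality of all the generators of the dual partition. -/
def DualEquiv (ψ φ : Γ) : Prop :=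
  (∀ k ≤ 4, S.w k ψ = S.w k φ) ∧ S.sgn ψ = S.sgn φ ∧ S.indK ψ = S.indK φ

/-- Equality of the eigenvalue and of membership in the annihilator of `K`. -/
def Equiv (z z' : Γ) : Prop := S.n z = S.n z' ∧ (S.Perp z ↔ S.Perp z')

/-- The eight value vectors of `(w 0, w 1, w 2, w 3, w 4, sgn, indK)`. -/
lemma dual_class_cases (ψ : Γ) :
    (S.w 0 ψ = 1 ∧ S.w 1 ψ = 0 ∧ S.w 2 ψ = S.N ∧ S.w 3 ψ = 0 ∧
      S.w 4 ψ = 3 * S.N ^ 2 - 2 * S.N ∧ S.sgn ψ = 1 ∧ S.indK ψ = 1) ∨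
    (S.w 0 ψ = 0 ∧ S.w 1 ψ = 1 ∧ S.w 2 ψ = 0 ∧ S.w 3 ψ = 3 * S.N - 2 ∧
      S.w 4 ψ = 0 ∧ S.sgn ψ = -1 ∧ S.indK ψ = 0) ∨
    (S.w 0 ψ = 0 ∧ S.w 1 ψ = 0 ∧ S.w 2 ψ = 2 ∧ S.w 3 ψ = 0 ∧
      S.w 4 ψ = 12 * S.N - 16 ∧ S.sgn ψ = 1 ∧ S.indK ψ = 0) ∨
    (S.w 0 ψ = 0 ∧ S.w 1 ψ = 0 ∧ S.w 2 ψ = 0 ∧ S.w 3 ψ = 6 ∧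
      S.w 4 ψ = 0 ∧ S.sgn ψ = -1 ∧ S.indK ψ = 0) ∨
    (S.w 0 ψ = 0 ∧ S.w 1 ψ = 0 ∧ S.w 2 ψ = 0 ∧ S.w 3 ψ = 0 ∧
      S.w 4 ψ = 4 * (S.N - 4) ∧ S.sgn ψ = 1 ∧ S.indK ψ = 0) ∨
    (S.w 0 ψ = 0 ∧ S.w 1 ψ = 0 ∧ S.w 2 ψ = 0 ∧ S.w 3 ψ = 0 ∧
      S.w 4 ψ = 0 ∧ S.sgn ψ = -1 ∧ S.indK ψ = 0) ∨
    (S.w 0 ψ = 0 ∧ S.w 1 ψ = 0 ∧ S.w 2 ψ = 0 ∧ S.w 3 ψ = 0 ∧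
      S.w 4 ψ = 6 * S.N ∧ S.sgn ψ = 1 ∧ S.indK ψ = 1) ∨
    (S.w 0 ψ = 0 ∧ S.w 1 ψ = 0 ∧ S.w 2 ψ = 0 ∧ S.w 3 ψ = 0 ∧
      S.w 4 ψ = 0 ∧ S.sgn ψ = 1 ∧ S.indK ψ = 1) := by
  have par := fun k => S.sgn_mul_w k ψ
  have p1 := par 1
  have p2 := par 2
  have p3 := par 3
  have p4 := par 4
  norm_num at p1 p2 p3 p4
  by_cases h0 : ψ = 0
  · subst h0
    rw [sgn_zero] at p1 p3
    refine Or.inl ⟨by simp [w_zero, ind0], by linarith, S.w_two_zero, by linarith,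
      S.w_four_zero, S.sgn_zero, S.indK_zero⟩
  have hw0 : S.w 0 ψ = 0 := by simp [w_zero, ind0, h0]
  refine Or.inr ?_
  rcases S.sgn_eq ψ with hs | hs
  · have hw1 : S.w 1 ψ = 0 := by rw [hs] at p1; linarith
    have hw3 : S.w 3 ψ = 0 := by rw [hs] at p3; linarith
    rcases S.indK_eq ψ with ⟨hK, hk, _⟩ | ⟨hK, hk⟩
    · have hw2 := S.w_two_of_mem_K hK h0
      rcases S.w_four_of_mem_K hK h0 with h | h <;> simp [hw0, hw1, hw2, hw3, h, hs, hk]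
    · have var := S.w_four_variance ψ
      rw [indRest, S.indTwo_of_ne h0, hs, hk] at var
      rcases S.w_two_eq h0 with h | h
      · rw [h] at var
        have : (S.w 4 ψ - 4 * (S.N - 4)) ^ 2 = 0 := by linarith [var.2]
        have : S.w 4 ψ = 4 * (S.N - 4) := by
          have := pow_eq_zero_iff (two_ne_zero) |>.1 this
          linarith
        simp [hw0, hw1, h, hw3, this, hs, hk]
      · rw [h] at var
        have : (S.w 4 ψ - (12 * S.N - 16)) ^ 2 = 0 := by linarith [var.1]
        have : S.w 4 ψ = 12 * S.N - 16 := by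
          have := pow_eq_zero_iff (two_ne_zero) |>.1 this
          linarith
        simp [hw0, hw1, h, hw3, this, hs, hk]
  · have hw2 : S.w 2 ψ = 0 := by rw [hs] at p2; linarith
    have hw4 : S.w 4 ψ = 0 := by rw [hs] at p4; linarith
    have hk : S.indK ψ = 0 := by
      rcases S.indK_eq ψ with ⟨_, _, h⟩ | ⟨_, h⟩
      · rw [h] at hs
        norm_num at hs
      · exact h
    by_cases hD : ψ ∈ S.D
    · simp [hw0, hw2, hw4, hk, hs, w_one, hD, (S.w_three_eq ψ).1 hD]
    · rcases (S.w_three_eq ψ).2 hD with h | h <;> simp [hw0, hw2, hw4, hk, hs, w_one, hD, h]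

end WalkData

/-- A space of functions containing a partition of unity by indicator functions contains all
functions which are constant on the parts. -/
lemma mem_of_partition {ι X : Type*} [Fintype ι] [DecidableEq ι] (A : Submodule ℝ (X → ℝ))
    (e : ι → X → ℝ) (he : ∀ i, e i ∈ A) (part : ∀ x, ∃ i, ∀ j, e j x = if j = i then 1 else 0)
    (f : X → ℝ) (hf : ∀ x y, (∀ i, e i x = e i y) → f x = f y) : f ∈ A := by
  classical
  let c : ι → ℝ := fun i => if h : ∃ x, e i x = 1 then f h.choose else 0
  have : f = ∑ i, c i • e i := by
    funext x
    obtain ⟨i, hi⟩ := part x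
    have hx : ∃ x, e i x = 1 := ⟨x, by simp [hi]⟩
    obtain ⟨l, hl⟩ := part hx.choose
    have hil : i = l := by
      by_contra h
      have := hl i
      rw [hx.choose_spec, if_neg h] at this
      exact one_ne_zero this
    simp only [Finset.sum_apply, Pi.smul_apply, hi, smul_eq_mul, mul_ite, mul_one, mul_zero,
      Finset.sum_ite_eq', Finset.mem_univ, if_true, c, dif_pos hx]
    exact hf _ _ fun j => by rw [hi, hl, hil]
  rw [this]
  exact A.sum_mem fun i _ => A.smul_mem _ (he i)

/-- The subspace of functions which are constant on the classes of a relation. -/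
def invariants {X : Type*} (E : Type*) [AddCommGroup E] [Module ℝ E] (r : X → X → Prop) :
    Submodule ℝ (X → E) where
  carrier := {f | ∀ x y, r x y → f x = f y}
  add_mem' hf hg x y h := by simp [hf x y h, hg x y h]
  zero_mem' := by simp
  smul_mem' c f hf x y h := by simp [hf x y h]

/-- The Fourier transform of real functions, as a linear map. -/
noncomputable def realFourier {Γ : Type*} [AddCommGroup Γ] [Fintype Γ] (p : Γ →+ Γ →+ ZMod 4) :
    (Γ → ℝ) →ₗ[ℝ] (Γ → ℂ) where
  toFun f := pairFourier p fun ψ => (f ψ : ℂ)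
  map_add' f g := by
    funext z
    simp [pairFourier, add_mul, Finset.sum_add_distrib]
  map_smul' c f := by
    funext z
    simp [pairFourier, mul_assoc, Finset.mul_sum]

/-- The inclusion of real functions into complex functions. -/
noncomputable def ofRealFun (X : Type*) : (X → ℝ) →ₗ[ℝ] (X → ℂ) :=
  Complex.ofRealCLM.toLinearMap.compLeft X

namespace WalkData

variable {Γ : Type*} [AddCommGroup Γ] [Fintype Γ] [DecidableEq Γ] (S : WalkData Γ)

/-- The functions whose Fourier transform is constant on the classes of `Equiv`. -/
noncomputable def good : Submodule ℝ (Γ → ℝ) := (invariants ℂ S.Equiv).comap (realFourier S.p)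

/-- The Fourier transforms of the functions which are constant on the classes of `DualEquiv`. -/
noncomputable def dualGood : Submodule ℝ (Γ → ℝ) :=
  ((invariants ℝ S.DualEquiv).map (realFourier S.p)).comap (ofRealFun Γ)

lemma N_ne_zero : S.N ≠ 0 := S.N_pos.ne'

lemma eq_zero_iff (z : Γ) : z = 0 ↔ (S.n z : ℝ) = S.N ∧ S.Perp z := by
  have := S.N_pos
  constructor
  · rintro rfl
    exact ⟨S.n_zero, S.perp_zero⟩
  · rintro ⟨hn, hz⟩
    by_contra h0
    by_cases ho : z = S.o
    · rw [ho, n_o] at hn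
      linarith
    · rw [S.n_perp z hz h0 ho] at hn
      simp at hn
      linarith

lemma eq_o_iff (z : Γ) : z = S.o ↔ (S.n z : ℝ) = -S.N ∧ S.Perp z := by
  have := S.N_pos
  constructor
  · rintro rfl
    exact ⟨S.n_o, S.perp_o⟩
  · rintro ⟨hn, hz⟩
    by_contra ho
    by_cases h0 : z = 0
    · rw [h0, n_zero] at hn
      linarith
    · rw [S.n_perp z hz h0 ho] at hn
      simp at hn
      linarith

lemma w_mem_good (k : ℕ) : S.w k ∈ S.good := by
  intro z z' h
  simp [realFourier, pairFourier_w, h.1]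

lemma indK_mem_good : S.indK ∈ S.good := by
  classical
  intro z z' h
  simp [realFourier, pairFourier_indK, h.2]

lemma sgn_mem_good : S.sgn ∈ S.good := by
  intro z z' h
  have : z = S.o ↔ z' = S.o := by rw [eq_o_iff, eq_o_iff, h.1, h.2]
  simp [realFourier, pairFourier_sgn, this]

lemma pairFourier_one (z : Γ) :
    pairFourier S.p (fun _ => 1) z = if z = 0 then (Fintype.card Γ : ℂ) else 0 := by
  rw [← sum_chi_pairing S.p S.nondeg z, pairFourier]
  simp [S.symm z]

lemma one_mem_good : (1 : Γ → ℝ) ∈ S.good := by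
  intro z z' h
  have : z = 0 ↔ z' = 0 := by rw [S.eq_zero_iff, S.eq_zero_iff, h.1, h.2]
  simp [realFourier, pairFourier_one, this]

/-- The indicator functions of the classes of the dual partition. -/
noncomputable def dualInd : Fin 8 → Γ → ℝ :=
  let e4 : Γ → ℝ := (1 / 2 : ℝ) • (1 + S.sgn) - S.indK - (1 / 2 : ℝ) • (S.w 2 - S.N • S.w 0)
  let e6 : Γ → ℝ := (6 * S.N)⁻¹ • (S.w 4 - (3 * S.N ^ 2 - 2 * S.N) • S.w 0
    - ((12 * S.N - 16) / 2) • (S.w 2 - S.N • S.w 0) - (4 * (S.N - 4)) • e4)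
  let e3 : Γ → ℝ := (1 / 6 : ℝ) • (S.w 3 - (3 * S.N - 2) • S.w 1)
  ![S.w 0, S.w 1, (1 / 2 : ℝ) • (S.w 2 - S.N • S.w 0), e3, e4,
    (1 / 2 : ℝ) • (1 - S.sgn) - S.w 1 - e3, e6, S.indK - S.w 0 - e6]

lemma dualInd_mem_good (i : Fin 8) : S.dualInd i ∈ S.good := by
  have h := S.w_mem_good
  have h1 := S.one_mem_good
  have hs := S.sgn_mem_good
  have hk := S.indK_mem_good
  have h2 : (1 / 2 : ℝ) • (S.w 2 - S.N • S.w 0) ∈ S.good :=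
    S.good.smul_mem _ (S.good.sub_mem (h 2) (S.good.smul_mem _ (h 0)))
  have h3 : (1 / 6 : ℝ) • (S.w 3 - (3 * S.N - 2) • S.w 1) ∈ S.good :=
    S.good.smul_mem _ (S.good.sub_mem (h 3) (S.good.smul_mem _ (h 1)))
  have h4 : (1 / 2 : ℝ) • (1 + S.sgn) - S.indK - (1 / 2 : ℝ) • (S.w 2 - S.N • S.w 0) ∈ S.good :=
    S.good.sub_mem (S.good.sub_mem (S.good.smul_mem _ (S.good.add_mem h1 hs)) hk) h2
  have h6 := S.good.smul_mem (6 * S.N)⁻¹ (S.good.sub_mem (S.good.sub_mem (S.good.sub_mem (h 4)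
    (S.good.smul_mem (3 * S.N ^ 2 - 2 * S.N) (h 0))) (S.good.smul_mem ((12 * S.N - 16) / 2)
    (S.good.sub_mem (h 2) (S.good.smul_mem S.N (h 0))))) (S.good.smul_mem (4 * (S.N - 4)) h4))
  fin_cases i
  · exact h 0
  · exact h 1
  · exact h2
  · exact h3
  · exact h4
  · exact S.good.sub_mem (S.good.sub_mem (S.good.smul_mem _ (S.good.sub_mem h1 hs)) (h 1)) h3
  · exact h6
  · exact S.good.sub_mem (S.good.sub_mem hk (h 0)) h6

lemma dualInd_part (ψ : Γ) : ∃ i, ∀ j, S.dualInd j ψ = if j = i then 1 else 0 := by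
  have hN := S.N_ne_zero
  have two : (2⁻¹ + 2⁻¹ - 1 : ℝ) = 0 := by norm_num
  rcases S.dual_class_cases ψ with h | h | h | h | h | h | h | h <;>
    obtain ⟨h0, h1, h2, h3, h4, hs, hk⟩ := h
  · refine ⟨0, fun j => ?_⟩
    fin_cases j <;> simp [dualInd, h0, h1, h2, h3, h4, hs, hk, two]
  · refine ⟨1, fun j => ?_⟩
    fin_cases j <;> simp [dualInd, h0, h1, h2, h3, h4, hs, hk]
    norm_num
  · refine ⟨2, fun j => ?_⟩
    fin_cases j <;> simp [dualInd, h0, h1, h2, h3, h4, hs, hk] <;> norm_num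
  · refine ⟨3, fun j => ?_⟩
    fin_cases j <;> simp [dualInd, h0, h1, h2, h3, h4, hs, hk]
    norm_num
  · refine ⟨4, fun j => ?_⟩
    fin_cases j <;> simp [dualInd, h0, h1, h2, h3, h4, hs, hk] <;> norm_num
  · refine ⟨5, fun j => ?_⟩
    fin_cases j <;> simp [dualInd, h0, h1, h2, h3, h4, hs, hk]
    norm_num
  · refine ⟨6, fun j => ?_⟩
    have : S.N⁻¹ * 6⁻¹ * (6 * S.N) = 1 := by field_simp
    fin_cases j <;> simp [dualInd, h0, h1, h2, h3, h4, hs, hk, two, this]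
  · refine ⟨7, fun j => ?_⟩
    fin_cases j <;> simp [dualInd, h0, h1, h2, h3, h4, hs, hk, two]

lemma dualEquiv_of_dualInd {ψ φ : Γ} (h : ∀ i, S.dualInd i ψ = S.dualInd i φ) :
    S.DualEquiv ψ φ := by
  have hN := S.N_ne_zero
  have h0 := h 0
  have h1 := h 1
  have h2 := h 2
  have h3 := h 3
  have h4 := h 4
  have h6 := h 6
  have h7 := h 7
  simp only [dualInd, Matrix.cons_val, Pi.sub_apply, Pi.add_apply, Pi.smul_apply,
    Pi.one_apply, smul_eq_mul] at h0 h1 h2 h3 h4 h6 h7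
  have w2 : S.w 2 ψ = S.w 2 φ := by linear_combination 2 * h2 + S.N * h0
  have k : S.indK ψ = S.indK φ := by linear_combination h0 + h6 + h7
  have w4 : S.w 4 ψ = S.w 4 φ := by
    have := mul_left_cancel₀ (inv_ne_zero (mul_ne_zero (by norm_num) hN)) h6
    linear_combination this + (3 * S.N ^ 2 - 2 * S.N) * h0 + (12 * S.N - 16) * h2
      + 4 * (S.N - 4) * h4
  refine ⟨fun j hj => ?_, by linear_combination 2 * (k + h2 + h4), k⟩
  interval_cases j
  · exact h0
  · exact h1
  · exact w2
  · linear_combination 6 * h3 + (3 * S.N - 2) * h1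
  · exact w4

lemma mem_good {g : Γ → ℝ} (hg : ∀ ψ φ, S.DualEquiv ψ φ → g ψ = g φ) : g ∈ S.good :=
  mem_of_partition S.good S.dualInd S.dualInd_mem_good S.dualInd_part g fun _ _ h =>
    hg _ _ (S.dualEquiv_of_dualInd h)

lemma mem_dualGood_of_pairFourier {f g : Γ → ℝ} (hg : ∀ ψ φ, S.DualEquiv ψ φ → g ψ = g φ)
    (h : ∀ z, pairFourier S.p (fun ψ => (g ψ : ℂ)) z = (f z : ℂ)) : f ∈ S.dualGood :=
  ⟨g, hg, funext h⟩

lemma n_pow_mem_dualGood {k : ℕ} (hk : k ≤ 4) : (fun z => (S.n z : ℝ) ^ k) ∈ S.dualGood :=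
  S.mem_dualGood_of_pairFourier (g := S.w k) (fun _ _ h => h.1 k hk) fun z => by
    simp [pairFourier_w]

open Classical in
lemma indPerp_mem_dualGood : (fun z => if S.Perp z then (1 : ℝ) else 0) ∈ S.dualGood := by
  have hK : (Nat.card S.K : ℝ) ≠ 0 := by rw [card_K_eq]; simp [S.N_ne_zero]
  have : (fun z => if S.Perp z then (1 : ℝ) else 0)
      = (Nat.card S.K : ℝ)⁻¹ • fun z => if S.Perp z then (Nat.card S.K : ℝ) else 0 := by
    funext z
    by_cases h : S.Perp z <;> simp only [h, Pi.smul_apply, smul_eq_mul, if_true, if_false]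
    · rw [inv_mul_cancel₀ hK]
    · simp
  rw [this]
  exact S.dualGood.smul_mem _ (S.mem_dualGood_of_pairFourier (fun _ _ h => h.2.2) fun z => by
    rw [pairFourier_indK]; split_ifs <;> simp)

include S in
lemma card_ne_zero : (Fintype.card Γ : ℝ) ≠ 0 := by rw [S.card_eq]; simp [S.N_ne_zero]

lemma ind_mem_dualGood {y : Γ} {g : Γ → ℝ} (hg : ∀ ψ φ, S.DualEquiv ψ φ → g ψ = g φ)
    (h : ∀ z, pairFourier S.p (fun ψ => (g ψ : ℂ)) z
      = if z = y then (Fintype.card Γ : ℂ) else 0) :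
    (fun z => if z = y then (1 : ℝ) else 0) ∈ S.dualGood := by
  have : (fun z => if z = y then (1 : ℝ) else 0)
      = (Fintype.card Γ : ℝ)⁻¹ • fun z => if z = y then (Fintype.card Γ : ℝ) else 0 := by
    funext z
    by_cases h : z = y <;> simp only [h, Pi.smul_apply, smul_eq_mul, if_true, if_false]
    · rw [inv_mul_cancel₀ S.card_ne_zero]
    · simp
  rw [this]
  exact S.dualGood.smul_mem _ (S.mem_dualGood_of_pairFourier hg fun z => by
    rw [h]; split_ifs <;> simp)

lemma indZero_mem_dualGood : (fun z : Γ => if z = 0 then (1 : ℝ) else 0) ∈ S.dualGood :=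
  S.ind_mem_dualGood (g := fun _ => 1) (fun _ _ _ => rfl) fun z => by
    simpa using S.pairFourier_one z

lemma indO_mem_dualGood : (fun z : Γ => if z = S.o then (1 : ℝ) else 0) ∈ S.dualGood :=
  S.ind_mem_dualGood (fun _ _ h => h.2.1) S.pairFourier_sgn

/-- The coefficients of the Lagrange polynomials for the nodes `0, 1, -1, 2, -2`. -/
noncomputable def lagrangeCoeff : Fin 5 → Fin 5 → ℝ :=
  ![![1, 0, -(5 / 4), 0, 1 / 4], ![0, 2 / 3, 2 / 3, -(1 / 6), -(1 / 6)],
    ![0, -(2 / 3), 2 / 3, 1 / 6, -(1 / 6)], ![0, -(1 / 12), -(1 / 24), 1 / 12, 1 / 24],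
    ![0, 1 / 12, -(1 / 24), -(1 / 12), 1 / 24]]

/-- The possible ratios of the eigenvalues off the annihilator of `K` to `a`. -/
def node : Fin 5 → ℝ := ![0, 1, -1, 2, -2]

lemma sum_lagrangeCoeff (i j : Fin 5) :
    ∑ k : Fin 5, lagrangeCoeff i k * node j ^ (k : ℕ) = if i = j then 1 else 0 := by
  fin_cases i <;> fin_cases j <;> simp [lagrangeCoeff, node, Fin.sum_univ_five] <;> norm_num

/-- The Lagrange polynomial of the node `i` in the eigenvalue. -/
noncomputable def lagrange (i : Fin 5) (x : ℝ) : ℝ :=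
  ∑ k : Fin 5, lagrangeCoeff i k * (x / S.a) ^ (k : ℕ)

open Classical in
/-- The indicator functions of the eigenvalue partition. -/
noncomputable def ind : Fin 3 ⊕ Fin 5 → Γ → ℝ :=
  let e0 : Γ → ℝ := fun z => if z = 0 then 1 else 0
  let e1 : Γ → ℝ := fun z => if z = S.o then 1 else 0
  let eP : Γ → ℝ := fun z => if S.Perp z then 1 else 0
  Sum.elim ![e0, e1, eP - e0 - e1] fun i => (fun z => S.lagrange i (S.n z))
    - S.lagrange i S.N • e0 - S.lagrange i (-S.N) • e1 - S.lagrange i 0 • (eP - e0 - e1)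

lemma lagrange_mem_dualGood (i : Fin 5) : (fun z => S.lagrange i (S.n z)) ∈ S.dualGood := by
  have : (fun z => S.lagrange i (S.n z))
      = ∑ k : Fin 5, (lagrangeCoeff i k / (S.a : ℝ) ^ (k : ℕ))
          • fun z => (S.n z : ℝ) ^ (k : ℕ) := by
    funext z
    simp only [lagrange, Finset.sum_apply, Pi.smul_apply, smul_eq_mul, div_pow]
    exact Finset.sum_congr rfl fun k _ => by ring
  rw [this]
  exact S.dualGood.sum_mem fun k _ => S.dualGood.smul_mem _ (S.n_pow_mem_dualGood (by omega))

lemma ind_mem (i : Fin 3 ⊕ Fin 5) : S.ind i ∈ S.dualGood := by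
  have h2 := S.dualGood.sub_mem (S.dualGood.sub_mem S.indPerp_mem_dualGood S.indZero_mem_dualGood)
    S.indO_mem_dualGood
  rcases i with i | i
  · fin_cases i
    · exact S.indZero_mem_dualGood
    · exact S.indO_mem_dualGood
    · exact h2
  · exact S.dualGood.sub_mem (S.dualGood.sub_mem (S.dualGood.sub_mem (S.lagrange_mem_dualGood i)
      (S.dualGood.smul_mem _ S.indZero_mem_dualGood)) (S.dualGood.smul_mem _ S.indO_mem_dualGood))
      (S.dualGood.smul_mem _ h2)

lemma exists_node {z : Γ} (hz : ¬ S.Perp z) : ∃ j, (S.n z : ℝ) / S.a = node j := by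
  have ha : (S.a : ℝ) ≠ 0 := by exact_mod_cast S.a_ne
  rcases S.n_mem z hz with h | h | h | h | h <;> rw [h]
  · exact ⟨0, by simp [node]⟩
  · exact ⟨1, by simp [node, ha]⟩
  · exact ⟨2, by simp [node, ha]⟩
  · exact ⟨3, by simp [node, ha]⟩
  · exact ⟨4, by simp [node]; field_simp⟩

lemma ind_part (z : Γ) : ∃ i, ∀ j, S.ind j z = if j = i then 1 else 0 := by
  by_cases hz : S.Perp z
  · by_cases h0 : z = 0
    · subst h0
      refine ⟨Sum.inl 0, ?_⟩
      rintro (j | j)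
      · fin_cases j <;> simp [ind, S.perp_zero, S.o_ne.symm]
      · simp [ind, S.perp_zero, S.o_ne.symm, S.n_zero]
    · by_cases ho : z = S.o
      · subst ho
        refine ⟨Sum.inl 1, ?_⟩
        rintro (j | j)
        · fin_cases j <;> simp [ind, S.perp_o, S.o_ne]
        · simp [ind, S.perp_o, S.o_ne, S.n_o]
      · refine ⟨Sum.inl 2, ?_⟩
        rintro (j | j)
        · fin_cases j <;> simp [ind, hz, h0, ho]
        · simp [ind, hz, h0, ho, S.n_perp z hz h0 ho]
  · have h0 : z ≠ 0 := fun h => hz (h ▸ S.perp_zero)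
    have ho : z ≠ S.o := fun h => hz (h ▸ S.perp_o)
    obtain ⟨i, hi⟩ := S.exists_node hz
    refine ⟨Sum.inr i, ?_⟩
    rintro (j | j)
    · fin_cases j <;> simp [ind, hz, h0, ho]
    · simp [ind, hz, h0, ho, lagrange, hi, sum_lagrangeCoeff]

lemma equiv_of_ind {z z' : Γ} (h : ∀ i, S.ind i z = S.ind i z') : S.Equiv z z' := by
  have ha : (S.a : ℝ) ≠ 0 := by exact_mod_cast S.a_ne
  have h0 := h (Sum.inl 0)
  have h1 := h (Sum.inl 1)
  have h2 := h (Sum.inl 2)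
  simp only [ind, Sum.elim_inl, Matrix.cons_val, Pi.sub_apply] at h0 h1 h2
  have hP : S.Perp z ↔ S.Perp z' := by
    classical
    have : (if S.Perp z then (1 : ℝ) else 0) = if S.Perp z' then 1 else 0 := by
      linear_combination h0 + h1 + h2
    by_cases hz : S.Perp z <;> by_cases hz' : S.Perp z' <;> simp [hz, hz'] at this ⊢
  have hz0 : z = 0 ↔ z' = 0 := by
    by_cases hz : z = 0 <;> by_cases hz' : z' = 0 <;> simp [hz, hz'] at h0 ⊢
  have hzo : z = S.o ↔ z' = S.o := by
    by_cases hz : z = S.o <;> by_cases hz' : z' = S.o <;> simp [hz, hz'] at h1 ⊢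
  refine ⟨?_, hP⟩
  by_cases hz : S.Perp z
  · by_cases z0 : z = 0
    · rw [z0, hz0.1 z0]
    · by_cases zo : z = S.o
      · rw [zo, hzo.1 zo]
      · rw [S.n_perp z hz z0 zo, S.n_perp z' (hP.1 hz) (mt hz0.2 z0) (mt hzo.2 zo)]
  · have ne : ∀ {y}, ¬ S.Perp y → y ≠ 0 ∧ y ≠ S.o := fun hy =>
      ⟨fun h => hy (h ▸ S.perp_zero), fun h => hy (h ▸ S.perp_o)⟩
    have hz' := mt hP.2 hz
    obtain ⟨i, hi⟩ := S.exists_node hz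
    obtain ⟨j, hj⟩ := S.exists_node hz'
    have := h (Sum.inr i)
    simp [ind, hz, hz', (ne hz).1, (ne hz).2, (ne hz').1, (ne hz').2, lagrange, hi, hj,
      sum_lagrangeCoeff] at this
    rw [← this, ← hi, div_left_inj' ha] at hj
    exact_mod_cast hj.symm

lemma mem_dualGood {f : Γ → ℝ} (hf : ∀ z z', S.Equiv z z' → f z = f z') : f ∈ S.dualGood :=
  mem_of_partition S.dualGood S.ind S.ind_mem S.ind_part f fun _ _ h => hf _ _ (S.equiv_of_ind h)

/-- The convolution of functions which are constant on the eigenvalue partition is constant on the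
eigenvalue partition. -/
theorem convolution_eq {f₁ f₂ : Γ → ℝ} (h₁ : ∀ z z', S.Equiv z z' → f₁ z = f₁ z')
    (h₂ : ∀ z z', S.Equiv z z' → f₂ z = f₂ z') {z z' : Γ} (hz : S.Equiv z z') :
    ∑ r, f₁ r * f₂ (z - r) = ∑ r, f₁ r * f₂ (z' - r) := by
  obtain ⟨g₁, hg₁, e₁⟩ := S.mem_dualGood h₁
  obtain ⟨g₂, hg₂, e₂⟩ := S.mem_dualGood h₂
  have key : ∀ z, ((∑ r, f₁ r * f₂ (z - r) : ℝ) : ℂ)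
      = Fintype.card Γ * realFourier S.p (g₁ * g₂) z := by
    intro z
    have := sum_pairFourier_mul S.p S.nondeg (fun ψ => (g₁ ψ : ℂ)) (fun ψ => (g₂ ψ : ℂ)) z
    have e₁' : ∀ r, pairFourier S.p (fun ψ => (g₁ ψ : ℂ)) r = f₁ r := fun r => congrFun e₁ r
    have e₂' : ∀ r, pairFourier S.p (fun ψ => (g₂ ψ : ℂ)) r = f₂ r := fun r => congrFun e₂ r
    simp only [e₁', e₂'] at this
    push_cast
    rw [this]
    simp [realFourier]
  have := S.mem_good (g := g₁ * g₂) (fun ψ φ h => by simp [hg₁ ψ φ h, hg₂ ψ φ h]) z z' hz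
  have h := key z
  rw [this, ← key z'] at h
  exact_mod_cast h

end WalkData

/-- Multiplication by two, as a map from `ℤ/2ℤ` to `ℤ/4ℤ`. -/
def dbl : ZMod 2 →+ ZMod 4 where
  toFun x := 2 * (x.val : ZMod 4)
  map_zero' := by decide
  map_add' := by decide

lemma dbl_eq_zero_iff {x : ZMod 2} : dbl x = 0 ↔ x = 0 := by
  revert x
  decide

/-- The reduction map from `ℤ/4ℤ` to `ℤ/2ℤ`. -/
abbrev red : ZMod 4 →+* ZMod 2 := ZMod.castHom (show 2 ∣ 4 by norm_num) (ZMod 2)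

lemma dbl_red (x : ZMod 4) : dbl (red x) = 2 * x := by
  revert x
  decide

/-- The Galois ring `R` of characteristic four with residue field `F` of odd degree
`m = 2 * k + 1`, together with the traces of `R` and `F`. -/
structure GaloisRing (k : ℕ) (R F : Type*) [CommRing R] [Field F] where
  /-- the residue map -/
  π : R →+* F
  π_surj : Function.Surjective π
  two_mul_eq_zero_iff : ∀ z, 2 * z = 0 ↔ π z = 0
  exists_two_mul : ∀ z, π z = 0 → ∃ w, z = 2 * w
  /-- the trace of `R` -/
  T : R →+ ZMod 4
  /-- the trace of `F` -/
  tr : F →+ ZMod 2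
  tr_π : ∀ z, tr (π z) = red (T z)
  tr_sq : ∀ x, tr (x ^ 2) = tr x
  exists_tr_ne_zero : ∃ x, tr x ≠ 0
  card_F : Nat.card F = 2 ^ (2 * k + 1)
  card_R : Nat.card R = 4 ^ (2 * k + 1)
  charP : CharP F 2

namespace GaloisRing

variable {k : ℕ} {R F : Type*} [CommRing R] [Field F] (G : GaloisRing k R F)

include G

lemma two_eq_zero : (2 : F) = 0 := by
  have := G.charP
  exact CharTwo.two_eq_zero

lemma add_self (x : F) : x + x = 0 := by
  have := G.charP
  exact CharTwo.add_self_eq_zero x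

lemma neg_eq (x : F) : -x = x := by
  have := G.charP
  exact CharTwo.neg_eq x

lemma eq_of_add_eq_zero {x y : F} (h : x + y = 0) : x = y := by
  rw [eq_neg_of_add_eq_zero_left h, G.neg_eq]

lemma four_eq_zero : (4 : R) = 0 := by
  have : (2 : R) * 2 = 0 := by rw [G.two_mul_eq_zero_iff, map_ofNat, G.two_eq_zero]
  linear_combination this

lemma two_mul_eq_iff {z w : R} : 2 * z = 2 * w ↔ G.π z = G.π w := by
  rw [← sub_eq_zero, ← mul_sub, G.two_mul_eq_zero_iff, map_sub, sub_eq_zero]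

lemma sq_eq_of_π_eq {z w : R} (h : G.π z = G.π w) : z ^ 2 = w ^ 2 := by
  obtain ⟨v, hv⟩ := G.exists_two_mul (z - w) (by rw [map_sub, h, sub_self])
  linear_combination (z + w) * hv + (v * w + v ^ 2) * G.four_eq_zero + 2 * v * hv

lemma T_two_mul (z : R) : G.T (2 * z) = dbl (G.tr (G.π z)) := by
  rw [G.tr_π, dbl_red, two_mul, map_add, two_mul]

lemma sq_injective : Function.Injective fun x : F => x ^ 2 := by
  intro x y h
  have h : x ^ 2 = y ^ 2 := h
  have : (x + y) ^ 2 = 0 := by linear_combination h + (x * y + y ^ 2) * G.two_eq_zero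
  exact G.eq_of_add_eq_zero (pow_eq_zero_iff two_ne_zero |>.1 this)

lemma tr_mul_eq_zero {x : F} (h : ∀ y, G.tr (x * y) = 0) : x = 0 := by
  by_contra hx
  obtain ⟨y, hy⟩ := G.exists_tr_ne_zero
  apply hy
  rw [← h (x⁻¹ * y), mul_inv_cancel_left₀ hx]

lemma T_mul_eq_zero {z : R} (h : ∀ w, G.T (z * w) = 0) : z = 0 := by
  have hz : G.π z = 0 := G.tr_mul_eq_zero fun y => by
    obtain ⟨w, rfl⟩ := G.π_surj y
    rw [← map_mul, G.tr_π, h, map_zero]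
  obtain ⟨v, rfl⟩ := G.exists_two_mul z hz
  rw [G.two_mul_eq_zero_iff]
  refine G.tr_mul_eq_zero fun y => ?_
  obtain ⟨w, rfl⟩ := G.π_surj y
  rw [← map_mul, ← dbl_eq_zero_iff, ← T_two_mul, ← mul_assoc, h]

variable [Fintype F]

lemma pow_card (x : F) : x ^ 2 ^ (2 * k + 1) = x := by
  rw [← G.card_F, Nat.card_eq_fintype_card, FiniteField.pow_card]

lemma exists_sq (x : F) : ∃ y, y ^ 2 = x :=
  ⟨x ^ 2 ^ (2 * k), by rw [← pow_mul, ← pow_succ, G.pow_card]⟩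

/-- The square root in `F`. -/
noncomputable def sqrt (x : F) : F := (G.exists_sq x).choose

lemma sqrt_sq (x : F) : G.sqrt x ^ 2 = x := (G.exists_sq x).choose_spec

lemma sqrt_eq_iff {x y : F} : G.sqrt x = y ↔ x = y ^ 2 := by
  rw [← G.sq_injective.eq_iff]
  simp only [G.sqrt_sq]

lemma sqrt_add (x y : F) : G.sqrt (x + y) = G.sqrt x + G.sqrt y := by
  rw [G.sqrt_eq_iff]
  linear_combination -G.sqrt_sq x - G.sqrt_sq y - G.sqrt x * G.sqrt y * G.two_eq_zero

lemma tr_sqrt (x : F) : G.tr (G.sqrt x) = G.tr x := by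
  rw [← G.tr_sq, G.sqrt_sq]

/-- The Teichmüller lift. -/
noncomputable def τ (x : F) : R := (G.π_surj (G.sqrt x)).choose ^ 2

lemma τ_eq {x : F} {z : R} (h : G.π z ^ 2 = x) : G.τ x = z ^ 2 := by
  refine G.sq_eq_of_π_eq ?_
  rw [(G.π_surj (G.sqrt x)).choose_spec, G.sqrt_eq_iff, h]

lemma exists_lift_sqrt (x : F) : ∃ z, G.π z ^ 2 = x ∧ G.τ x = z ^ 2 := by
  obtain ⟨z, hz⟩ := G.π_surj (G.sqrt x)
  have : G.π z ^ 2 = x := by rw [hz, G.sqrt_sq]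
  exact ⟨z, this, G.τ_eq this⟩

lemma π_τ (x : F) : G.π (G.τ x) = x := by
  obtain ⟨z, hz, h⟩ := G.exists_lift_sqrt x
  rw [h, map_pow, hz]

lemma τ_zero : G.τ 0 = 0 := by
  have := G.τ_eq (x := 0) (z := 0) (by simp)
  simpa using this

lemma τ_pow (x : F) (j : ℕ) : G.τ (x ^ j) = G.τ x ^ j := by
  obtain ⟨z, hz, h⟩ := G.exists_lift_sqrt x
  rw [h, G.τ_eq (z := z ^ j), ← pow_mul, ← pow_mul, mul_comm]
  rw [map_pow, ← hz, ← pow_mul, ← pow_mul, mul_comm]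

lemma τ_add (x y : F) : G.τ (x + y) = G.τ x + G.τ y + 2 * G.τ (G.sqrt (x * y)) := by
  obtain ⟨z, hz, h⟩ := G.exists_lift_sqrt x
  obtain ⟨w, hw, h'⟩ := G.exists_lift_sqrt y
  have : 2 * G.τ (G.sqrt (x * y)) = 2 * (z * w) := by
    rw [G.two_mul_eq_iff, π_τ, G.sqrt_eq_iff, map_mul, mul_pow, hz, hw]
  rw [h, h', this, G.τ_eq (z := z + w)]
  · ring
  · rw [map_add]
    linear_combination hz + hw + G.π z * G.π w * G.two_eq_zero

lemma pow_eq_self_iff (z : R) : z ^ 2 ^ (2 * k + 1) = z ↔ G.τ (G.π z) = z := by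
  constructor
  · intro h
    have e : (z ^ 2 ^ (2 * k)) ^ 2 = z := by rw [← pow_mul, ← pow_succ, h]
    rw [G.τ_eq (z := z ^ 2 ^ (2 * k)), e]
    rw [← map_pow, e]
  · intro h
    rw [← h, ← τ_pow, G.pow_card]

/-- The residue field contains no primitive third root of unity. -/
lemma sq_add_self_add_one_ne_zero (x : F) : x ^ 2 + x + 1 ≠ 0 := by
  intro h
  have h3 : x ^ 3 = 1 := by linear_combination (x - 1) * h
  have h4 : ∀ j : ℕ, x ^ 4 ^ j = x := by
    intro j
    induction j with
    | zero => simp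
    | succ j ih => rw [pow_succ, pow_mul, ih]; linear_combination x * h3
  have := G.pow_card x
  rw [pow_succ, pow_mul, pow_mul, show 2 ^ 2 = 4 from rfl, h4] at this
  have h1 : (1 : F) = 0 := by linear_combination h - this - x * G.two_eq_zero
  exact one_ne_zero h1

end GaloisRing

namespace GaloisRing

variable {k : ℕ} {R F : Type*} [CommRing R] [Field F] (G : GaloisRing k R F)

/-- The self-duality pairing of the parameter group of the Delsarte–Goethals code. -/
def pairing : ZMod 4 × R × F →+ ZMod 4 × R × F →+ ZMod 4 :=
  AddMonoidHom.mk' (fun ψ => AddMonoidHom.mk'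
    (fun z => ψ.1 * z.1 + G.T (ψ.2.1 * z.2.1) + dbl (G.tr (ψ.2.2 * z.2.2)))
    (fun z w => by simp only [Prod.fst_add, Prod.snd_add, mul_add, map_add]; abel))
    (fun ψ φ => by
      refine AddMonoidHom.ext fun z => ?_
      simp only [AddMonoidHom.mk'_apply, AddMonoidHom.add_apply, Prod.fst_add, Prod.snd_add,
        add_mul, map_add]
      abel)

lemma pairing_apply (ψ z : ZMod 4 × R × F) :
    G.pairing ψ z = ψ.1 * z.1 + G.T (ψ.2.1 * z.2.1) + dbl (G.tr (ψ.2.2 * z.2.2)) := rfl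

lemma pairing_symm (ψ z : ZMod 4 × R × F) : G.pairing ψ z = G.pairing z ψ := by
  simp only [pairing_apply, mul_comm]

lemma pairing_nondeg (ψ : ZMod 4 × R × F) (h : ∀ z, G.pairing ψ z = 0) : ψ = 0 := by
  obtain ⟨ε, s, t⟩ := ψ
  have hε : ε = 0 := by simpa [pairing_apply] using h (1, 0, 0)
  have hs : s = 0 := G.T_mul_eq_zero fun w => by simpa [pairing_apply] using h (0, w, 0)
  have ht : t = 0 := G.tr_mul_eq_zero fun y => by
    simpa [pairing_apply, dbl_eq_zero_iff] using h (0, 0, y)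
  simp [hε, hs, ht]

include G in
lemma four_nsmul (g : ZMod 4 × R × F) : 4 • g = 0 := by
  have h4 : (4 : F) = 0 := by linear_combination 2 * G.two_eq_zero
  have : (4 : ZMod 4) = 0 := rfl
  ext <;> simp [G.four_eq_zero, h4, this]

/-- The subgroup of the pairs `(2s, t)`. -/
def subK : AddSubgroup (ZMod 4 × R × F) := AddSubgroup.prod ⊥ (G.π.toAddMonoidHom.ker.prod ⊤)

lemma mem_subK {ψ : ZMod 4 × R × F} : ψ ∈ G.subK ↔ ψ.1 = 0 ∧ G.π ψ.2.1 = 0 := by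
  simp [subK, AddSubgroup.mem_prod, AddMonoidHom.mem_ker]

lemma π_two : G.π 2 = 0 := by rw [map_ofNat, G.two_eq_zero]

lemma perp_subK_iff (z : ZMod 4 × R × F) :
    (∀ ψ ∈ G.subK, G.pairing ψ z = 0) ↔ G.π z.2.1 = 0 ∧ z.2.2 = 0 := by
  constructor
  · intro h
    refine ⟨G.tr_mul_eq_zero fun y => ?_, G.tr_mul_eq_zero fun y => ?_⟩
    · obtain ⟨w, rfl⟩ := G.π_surj y
      have := h (0, 2 * w, 0) (by simp [mem_subK, G.π_two])
      rw [mul_comm, ← map_mul, ← dbl_eq_zero_iff, ← T_two_mul, ← mul_assoc]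
      simpa [pairing_apply] using this
    · have := h (0, 0, y) (by simp [mem_subK])
      rw [mul_comm]
      simpa [pairing_apply, dbl_eq_zero_iff] using this
  · rintro ⟨h1, h2⟩ ψ hψ
    rw [mem_subK] at hψ
    obtain ⟨v, hv⟩ := G.exists_two_mul _ hψ.2
    obtain ⟨w, hw⟩ := G.exists_two_mul _ h1
    have : 2 * v * (2 * w) = 0 := by linear_combination v * w * G.four_eq_zero
    simp [pairing_apply, hψ.1, h2, hv, hw, this]

lemma card_ker : Nat.card G.π.toAddMonoidHom.ker = 2 ^ (2 * k + 1) := by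
  have h := AddSubgroup.card_eq_card_quotient_mul_card_addSubgroup G.π.toAddMonoidHom.ker
  rw [Nat.card_congr (QuotientAddGroup.quotientKerEquivOfSurjective G.π.toAddMonoidHom
    G.π_surj).toEquiv, G.card_R, G.card_F, show 4 = 2 * 2 from rfl, mul_pow] at h
  exact (Nat.eq_of_mul_eq_mul_left (by positivity) h).symm

lemma card_subK : Nat.card G.subK = 2 ^ (2 * k + 1) * 2 ^ (2 * k + 1) := by
  rw [subK, Nat.card_congr (AddSubgroup.prodEquiv _ _).toEquiv, Nat.card_prod,
    Nat.card_congr (AddSubgroup.prodEquiv _ _).toEquiv, Nat.card_prod, G.card_ker]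
  simp [G.card_F]

variable [Fintype F]

/-- The points of the connection set, indexed by a sign and an element of `F`. -/
noncomputable def point (s : Bool) (x : F) : ZMod 4 × R × F :=
  (bif s then 1 else -1, G.τ x + 2 * G.τ (bif s then 0 else x), x ^ 3)

lemma point_neg (s : Bool) (x : F) : -G.point s x = G.point (!s) x := by
  cases s <;> ext <;> simp [point, G.τ_zero, G.neg_eq]
  linear_combination -G.τ x * G.four_eq_zero
  linear_combination -G.τ x * G.four_eq_zero

lemma π_point (s : Bool) (x : F) : G.π (G.point s x).2.1 = x := by
  simp [point, π_τ, G.π_two]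

lemma point_injective : Function.Injective fun i : Bool × F => G.point i.1 i.2 := by
  rintro ⟨s, x⟩ ⟨s', x'⟩ h
  have h : G.point s x = G.point s' x' := h
  have hx : x = x' := by rw [← G.π_point s x, ← G.π_point s' x', h]
  have hs : (G.point s x).1 = (G.point s' x').1 := by rw [h]
  have h13 : (1 : ZMod 4) ≠ -1 := by decide
  cases s <;> cases s' <;> simp [point, hx, h13, h13.symm] at hs ⊢

variable [DecidableEq R] [DecidableEq F]

/-- The connection set. -/
noncomputable def conn : Finset (ZMod 4 × R × F) :=
  Finset.univ.image fun i : Bool × F => G.point i.1 i.2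

lemma mem_conn {g : ZMod 4 × R × F} : g ∈ G.conn ↔ ∃ s x, G.point s x = g := by
  simp [conn]

lemma sum_conn {M : Type*} [AddCommMonoid M] (f : ZMod 4 × R × F → M) :
    ∑ g ∈ G.conn, f g = ∑ s, ∑ x, f (G.point s x) := by
  rw [conn, Finset.sum_image fun _ _ _ _ h => G.point_injective h, Fintype.sum_prod_type]

lemma card_conn : G.conn.card = 2 * 2 ^ (2 * k + 1) := by
  rw [conn, Finset.card_image_of_injective _ G.point_injective, Finset.card_univ,
    Fintype.card_prod, Fintype.card_bool, ← Nat.card_eq_fintype_card, G.card_F]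

lemma walk_two_subK {ψ : ZMod 4 × R × F} (hψ : ψ ∈ G.subK) (h0 : ψ ≠ 0) :
    walk G.conn 2 ψ = 0 := by
  by_contra h
  obtain ⟨g, hg, hg'⟩ := (walk_two_pos_iff G.conn ψ).1 (Nat.pos_of_ne_zero h)
  obtain ⟨s, x, rfl⟩ := G.mem_conn.1 hg
  obtain ⟨s', y, h⟩ := G.mem_conn.1 hg'
  have e : ψ = G.point s x + G.point s' y := by rw [h]; abel
  rw [mem_subK, e, Prod.snd_add, Prod.fst_add, Prod.fst_add, map_add, π_point, π_point] at hψ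
  have hxy := G.eq_of_add_eq_zero hψ.2
  have hs : s' = !s := by
    have h2 : ((1 : ZMod 4) + 1 ≠ 0) ∧ ((-1 : ZMod 4) + -1 ≠ 0) := by decide
    have := hψ.1
    cases s <;> cases s' <;> simp [point, h2] at this ⊢
  apply h0
  rw [e, hs, ← hxy, ← point_neg, add_neg_cancel]

lemma walk_four_eq (ψ : ZMod 4 × R × F) : walk G.conn 4 ψ =
    ∑ x, ∑ y, ∑ z, ∑ w, ∑ s₁, ∑ s₂, ∑ s₃, ∑ s₄,
      if G.point s₁ x + G.point s₂ y + G.point s₃ z + G.point s₄ w = ψ then 1 else 0 := by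
  have e : ∀ a b c d : ZMod 4 × R × F, ψ - a - b - c - d = 0 ↔ a + b + c + d = ψ := by
    intro a b c d
    rw [show ψ - a - b - c - d = ψ - (a + b + c + d) by abel, sub_eq_zero, eq_comm]
  have comm₃ : ∀ f : Bool → Bool → F → ℕ, ∑ s, ∑ s', ∑ x, f s s' x = ∑ x, ∑ s, ∑ s', f s s' x :=
    fun f => (Finset.sum_congr rfl fun _ _ => Finset.sum_comm).trans Finset.sum_comm
  have comm₄ : ∀ f : Bool → Bool → Bool → F → ℕ,
      ∑ s, ∑ s', ∑ s'', ∑ x, f s s' s'' x = ∑ x, ∑ s, ∑ s', ∑ s'', f s s' s'' x :=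
    fun f => (Finset.sum_congr rfl fun _ _ => comm₃ _).trans Finset.sum_comm
  simp only [walk, sum_conn, e]
  rw [Finset.sum_comm]
  refine Finset.sum_congr rfl fun x _ => ?_
  rw [comm₃]
  refine Finset.sum_congr rfl fun y _ => ?_
  rw [comm₄]
  refine Finset.sum_congr rfl fun z _ => ?_
  exact (Finset.sum_congr rfl fun _ _ => comm₄ _).trans Finset.sum_comm

end GaloisRing

namespace GaloisRing

variable {k : ℕ} {R F : Type*} [CommRing R] [Field F] (G : GaloisRing k R F) [Fintype F]

lemma τ_plane (x d g : F) : G.τ x + G.τ (x + d) + G.τ (x + g) + G.τ (x + d + g)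
    = 2 * G.τ (G.sqrt (d ^ 2 + d * g + g ^ 2)) := by
  have h : 2 * (G.τ x + G.τ (x + d) + G.τ g + G.τ (G.sqrt (x * g)) + G.τ (G.sqrt ((x + d) * g)))
      = 2 * G.τ (G.sqrt (d ^ 2 + d * g + g ^ 2)) := by
    rw [G.two_mul_eq_iff]
    simp only [map_add, π_τ]
    symm
    rw [G.sqrt_eq_iff]
    have h1 := G.sqrt_sq (x * g)
    have h2 := G.sqrt_sq ((x + d) * g)
    grind [G.two_eq_zero]
  rw [← h, G.τ_add x g, G.τ_add (x + d) g]
  ring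

/-- The contribution of a sign to the second coordinate of a point. -/
def negPart (s : Bool) (x : F) : F := bif s then 0 else x

lemma π_sum_point (s₁ s₂ s₃ s₄ : Bool) {x y z w : F} {ψ : ZMod 4 × R × F} (hψ : ψ ∈ G.subK)
    (h : G.point s₁ x + G.point s₂ y + G.point s₃ z + G.point s₄ w = ψ) : w = x + y + z := by
  have := (G.mem_subK.1 hψ).2
  rw [← h] at this
  simp only [Prod.snd_add, Prod.fst_add, map_add, π_point] at this
  exact (G.eq_of_add_eq_zero this).symm

lemma sum_point_eq_iff (s₁ s₂ s₃ s₄ : Bool) (x d g : F) {s : R} {t : F} :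
    G.point s₁ x + G.point s₂ (x + d) + G.point s₃ (x + g) + G.point s₄ (x + d + g) = (0, 2 * s, t)
      ↔ ((bif s₁ then 1 else -1) + (bif s₂ then 1 else -1) + (bif s₃ then 1 else -1)
        + (bif s₄ then 1 else -1) : ZMod 4) = 0
      ∧ d ^ 2 + d * g + g ^ 2 + (negPart s₁ x + negPart s₂ (x + d) + negPart s₃ (x + g)
        + negPart s₄ (x + d + g)) ^ 2 = G.π s ^ 2
      ∧ d * g * (d + g) = t := by
  simp only [Prod.ext_iff, Prod.fst_add, Prod.snd_add, point]
  refine and_congr Iff.rfl (and_congr ?_ ?_)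
  · have e : G.τ x + 2 * G.τ (bif s₁ then 0 else x)
        + (G.τ (x + d) + 2 * G.τ (bif s₂ then 0 else x + d))
        + (G.τ (x + g) + 2 * G.τ (bif s₃ then 0 else x + g))
        + (G.τ (x + d + g) + 2 * G.τ (bif s₄ then 0 else x + d + g))
        = 2 * (G.τ (G.sqrt (d ^ 2 + d * g + g ^ 2)) + G.τ (negPart s₁ x) + G.τ (negPart s₂ (x + d))
          + G.τ (negPart s₃ (x + g)) + G.τ (negPart s₄ (x + d + g))) := by
      unfold negPart
      linear_combination G.τ_plane x d g
    rw [e, G.two_mul_eq_iff, ← G.sq_injective.eq_iff]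
    simp only [map_add, π_τ]
    have h := G.sqrt_sq (d ^ 2 + d * g + g ^ 2)
    generalize G.sqrt (d ^ 2 + d * g + g ^ 2) = r at h
    have e : (r + negPart s₁ x + negPart s₂ (x + d) + negPart s₃ (x + g)
        + negPart s₄ (x + d + g)) ^ 2 = d ^ 2 + d * g + g ^ 2 + (negPart s₁ x + negPart s₂ (x + d)
        + negPart s₃ (x + g) + negPart s₄ (x + d + g)) ^ 2 := by
      linear_combination h + r * (negPart s₁ x + negPart s₂ (x + d)
        + negPart s₃ (x + g) + negPart s₄ (x + d + g)) * G.two_eq_zero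
    rw [e]
  · have e : x ^ 3 + (x + d) ^ 3 + (x + g) ^ 3 + (x + d + g) ^ 3 = d * g * (d + g) := by
      linear_combination (2 * x ^ 3 + 3 * x ^ 2 * d + 3 * x ^ 2 * g + 3 * x * d ^ 2 + 3 * x * g ^ 2
        + d ^ 3 + g ^ 3 + d ^ 2 * g + d * g ^ 2 + 3 * x * d * g) * G.two_eq_zero
    rw [e]

variable [DecidableEq F]

/-- The pairs `(d, g)` with `d² + dg + g² = σ` and `dg(d + g) = t`. -/
def flagsOne (σ t : F) : Finset (F × F) :=
  {i | i.1 ^ 2 + i.1 * i.2 + i.2 ^ 2 = σ ∧ i.1 * i.2 * (i.1 + i.2) = t}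

/-- The pairs `(d, g)` with `dg = σ` and `dg(d + g) = t`. -/
def flagsTwo (σ t : F) : Finset (F × F) :=
  {i | i.1 * i.2 = σ ∧ i.1 * i.2 * (i.1 + i.2) = t}

include G in
lemma card_flagsTwo_comm (σ t : F) : (flagsTwo σ t).card
    = ∑ d : F, ∑ g, if d * g + g ^ 2 = σ ∧ d * g * (d + g) = t then 1 else 0 := by
  rw [← Fintype.sum_prod_type' (f := fun d g => if d * g + g ^ 2 = σ ∧ d * g * (d + g) = t then 1
    else 0), Finset.sum_boole]
  refine Finset.card_nbij' (fun i => (i.1 + i.2, i.2)) (fun i => (i.1 + i.2, i.2)) ?_ ?_ ?_ ?_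
  · rintro ⟨d, g⟩ h
    simp only [flagsTwo, Finset.coe_filter, Finset.mem_univ, true_and, Set.mem_ofPred_eq] at h ⊢
    grind [G.two_eq_zero]
  · rintro ⟨d, g⟩ h
    simp only [flagsTwo, Finset.coe_filter, Finset.mem_univ, true_and, Set.mem_ofPred_eq] at h ⊢
    grind [G.two_eq_zero]
  · rintro ⟨d, g⟩ -
    simp [add_assoc, G.add_self]
  · rintro ⟨d, g⟩ -
    simp [add_assoc, G.add_self]

include G in
omit [Fintype F] in
lemma sum_signs (x d g σ t : F) : (∑ s₁, ∑ s₂, ∑ s₃, ∑ s₄,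
    if ((bif s₁ then 1 else -1) + (bif s₂ then 1 else -1) + (bif s₃ then 1 else -1)
        + (bif s₄ then 1 else -1) : ZMod 4) = 0
      ∧ d ^ 2 + d * g + g ^ 2 + (negPart s₁ x + negPart s₂ (x + d) + negPart s₃ (x + g)
        + negPart s₄ (x + d + g)) ^ 2 = σ ∧ d * g * (d + g) = t then 1 else 0)
    = 2 * ((if d ^ 2 + d * g + g ^ 2 = σ ∧ d * g * (d + g) = t then 1 else 0)
      + (if d * g + g ^ 2 = σ ∧ d * g * (d + g) = t then 1 else 0)
      + (if g * d + d ^ 2 = σ ∧ g * d * (g + d) = t then 1 else 0)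
      + (if d * g = σ ∧ d * g * (d + g) = t then 1 else 0)) := by
  have h2 := G.two_eq_zero
  have d1 : (1 + 1 + 1 + 1 : ZMod 4) = 0 := by decide
  have d2 : (-1 + -1 + -1 + -1 : ZMod 4) = 0 := by decide
  have d3 : (1 + 1 + 1 + -1 : ZMod 4) ≠ 0 := by decide
  have d4 : (1 + 1 + -1 + 1 : ZMod 4) ≠ 0 := by decide
  have d5 : (1 + -1 + 1 + 1 : ZMod 4) ≠ 0 := by decide
  have d6 : (-1 + 1 + 1 + 1 : ZMod 4) ≠ 0 := by decide
  have d7 : (-1 + -1 + -1 + 1 : ZMod 4) ≠ 0 := by decide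
  have d8 : (-1 + -1 + 1 + -1 : ZMod 4) ≠ 0 := by decide
  have d9 : (-1 + 1 + -1 + -1 : ZMod 4) ≠ 0 := by decide
  have d10 : (1 + -1 + -1 + -1 : ZMod 4) ≠ 0 := by decide
  have d11 : (1 + 1 + -1 + -1 : ZMod 4) = 0 := by decide
  have d12 : (1 + -1 + 1 + -1 : ZMod 4) = 0 := by decide
  have d13 : (1 + -1 + -1 + 1 : ZMod 4) = 0 := by decide
  have d14 : (-1 + 1 + 1 + -1 : ZMod 4) = 0 := by decide
  have d15 : (-1 + 1 + -1 + 1 : ZMod 4) = 0 := by decide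
  have d16 : (-1 + -1 + 1 + 1 : ZMod 4) = 0 := by decide
  have e1 : d ^ 2 + d * g + g ^ 2 + (x + (x + d) + (x + g) + (x + d + g)) ^ 2
      = d ^ 2 + d * g + g ^ 2 := by grind
  have e2 : d ^ 2 + d * g + g ^ 2 + (x + (x + d)) ^ 2 = d * g + g ^ 2 := by grind
  have e3 : d ^ 2 + d * g + g ^ 2 + (x + (x + g)) ^ 2 = g * d + d ^ 2 := by grind
  have e4 : d ^ 2 + d * g + g ^ 2 + (x + (x + d + g)) ^ 2 = d * g := by grind
  have e5 : d ^ 2 + d * g + g ^ 2 + (x + d + (x + g)) ^ 2 = d * g := by grind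
  have e6 : d ^ 2 + d * g + g ^ 2 + (x + d + (x + d + g)) ^ 2 = g * d + d ^ 2 := by grind
  have e7 : d ^ 2 + d * g + g ^ 2 + (x + g + (x + d + g)) ^ 2 = d * g + g ^ 2 := by grind
  have e8 : g * d * (g + d) = d * g * (d + g) := by ring
  simp only [Fintype.sum_bool, cond_true, cond_false, negPart, d1, d2, d3, d4, d5, d6, d7, d8, d9,
    d10, d11, d12, d13, d14, d15, d16, true_and, false_and, if_false, add_zero, zero_add, e1, e2,
    e3, e4, e5, e6, e7, e8, zero_pow two_ne_zero]
  ring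

variable [DecidableEq R]

lemma walk_four_subK (s : R) (t : F) : walk G.conn 4 (0, 2 * s, t) = 2 * 2 ^ (2 * k + 1) *
    ((flagsOne (G.π s ^ 2) t).card + 3 * (flagsTwo (G.π s ^ 2) t).card) := by
  have hK : ((0, 2 * s, t) : ZMod 4 × R × F) ∈ G.subK := by simp [mem_subK, G.π_two]
  have key : ∀ x, (∑ y, ∑ z, ∑ w, ∑ s₁, ∑ s₂, ∑ s₃, ∑ s₄,
      if G.point s₁ x + G.point s₂ y + G.point s₃ z + G.point s₄ w = (0, 2 * s, t) then 1 else 0)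
      = 2 * ((flagsOne (G.π s ^ 2) t).card + 3 * (flagsTwo (G.π s ^ 2) t).card) := by
    intro x
    rw [← Equiv.sum_comp (Equiv.addLeft x)]
    have : ∀ d, (∑ z, ∑ w, ∑ s₁, ∑ s₂, ∑ s₃, ∑ s₄, if G.point s₁ x + G.point s₂ (x + d)
        + G.point s₃ z + G.point s₄ w = (0, 2 * s, t) then 1 else 0) = ∑ g,
        2 * ((if d ^ 2 + d * g + g ^ 2 = G.π s ^ 2 ∧ d * g * (d + g) = t then 1 else 0)
          + (if d * g + g ^ 2 = G.π s ^ 2 ∧ d * g * (d + g) = t then 1 else 0)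
          + (if g * d + d ^ 2 = G.π s ^ 2 ∧ g * d * (g + d) = t then 1 else 0)
          + (if d * g = G.π s ^ 2 ∧ d * g * (d + g) = t then 1 else 0)) := by
      intro d
      rw [← Equiv.sum_comp (Equiv.addLeft x)]
      refine Finset.sum_congr rfl fun g _ => ?_
      rw [Finset.sum_eq_single (x + d + g)]
      · exact (Finset.sum_congr rfl fun s₁ _ => Finset.sum_congr rfl fun s₂ _ =>
          Finset.sum_congr rfl fun s₃ _ => Finset.sum_congr rfl fun s₄ _ =>
          if_congr (G.sum_point_eq_iff s₁ s₂ s₃ s₄ x d g) rfl rfl).trans (G.sum_signs x d g _ _)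
      · intro w _ hw
        refine Finset.sum_eq_zero fun s₁ _ => Finset.sum_eq_zero fun s₂ _ =>
          Finset.sum_eq_zero fun s₃ _ => Finset.sum_eq_zero fun s₄ _ => if_neg fun h => hw ?_
        rw [G.π_sum_point s₁ s₂ s₃ s₄ hK h]
        simp only [Equiv.coe_addLeft]
        linear_combination x * G.two_eq_zero
      · simp
    refine (Finset.sum_congr rfl fun d _ => this d).trans ?_
    simp only [← Finset.mul_sum, Finset.sum_add_distrib]
    rw [← G.card_flagsTwo_comm, Finset.sum_comm (f := fun d g => if g * d + d ^ 2 = G.π s ^ 2 ∧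
      g * d * (g + d) = t then 1 else 0), ← G.card_flagsTwo_comm]
    have e₁ : (flagsOne (G.π s ^ 2) t).card = ∑ d : F, ∑ g,
        if d ^ 2 + d * g + g ^ 2 = G.π s ^ 2 ∧ d * g * (d + g) = t then 1 else 0 := by
      rw [← Fintype.sum_prod_type' (f := fun d g => if d ^ 2 + d * g + g ^ 2 = G.π s ^ 2 ∧
        d * g * (d + g) = t then 1 else 0), Finset.sum_boole, flagsOne, Nat.cast_id]
    have e₂ : (flagsTwo (G.π s ^ 2) t).card = ∑ d : F, ∑ g,
        if d * g = G.π s ^ 2 ∧ d * g * (d + g) = t then 1 else 0 := by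
      rw [← Fintype.sum_prod_type' (f := fun d g => if d * g = G.π s ^ 2 ∧
        d * g * (d + g) = t then 1 else 0), Finset.sum_boole, flagsTwo, Nat.cast_id]
    rw [← e₁, ← e₂]
    ring
  rw [walk_four_eq, Finset.sum_congr rfl fun x _ => key x, Finset.sum_const, Finset.card_univ,
    ← Nat.card_eq_fintype_card, G.card_F]
  simp only [smul_eq_mul]
  ring

end GaloisRing

namespace GaloisRing

variable {k : ℕ} {R F : Type*} [CommRing R] [Field F] (G : GaloisRing k R F) [Fintype F]

include G in
lemma eq_zero_of_sq_add_mul_add_sq_eq_zero {d g : F} (h : d ^ 2 + d * g + g ^ 2 = 0) :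
    d = 0 ∧ g = 0 := by
  have hg : g = 0 := by
    by_contra hg
    apply G.sq_add_self_add_one_ne_zero (d / g)
    field_simp
    linear_combination h
  subst hg
  simpa using h

variable [DecidableEq F]

lemma mem_flagsOne {σ t : F} {i : F × F} :
    i ∈ flagsOne σ t ↔ i.1 ^ 2 + i.1 * i.2 + i.2 ^ 2 = σ ∧ i.1 * i.2 * (i.1 + i.2) = t := by
  simp [flagsOne]

lemma mem_flagsTwo {σ t : F} {i : F × F} :
    i ∈ flagsTwo σ t ↔ i.1 * i.2 = σ ∧ i.1 * i.2 * (i.1 + i.2) = t := by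
  simp [flagsTwo]

include G

lemma card_flagsOne_zero_zero : (flagsOne (0 : F) 0).card = 1 := by
  rw [Finset.card_eq_one]
  refine ⟨(0, 0), Finset.ext fun ⟨d, g⟩ => ?_⟩
  rw [mem_flagsOne, Finset.mem_singleton, Prod.mk_inj]
  constructor
  · exact fun h => G.eq_zero_of_sq_add_mul_add_sq_eq_zero h.1
  · rintro ⟨rfl, rfl⟩
    simp

lemma card_flagsTwo_zero_zero : (flagsTwo (0 : F) 0).card + 1 = 2 * 2 ^ (2 * k + 1) := by
  have e : flagsTwo (0 : F) 0 = ({0} ×ˢ Finset.univ) ∪ (Finset.univ ×ˢ {0}) := by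
    ext ⟨d, g⟩
    rw [mem_flagsTwo]
    simp only [Finset.mem_union, Finset.mem_product, Finset.mem_singleton, Finset.mem_univ,
      and_true, true_and, mul_eq_zero]
    tauto
  have i : (({0} : Finset F) ×ˢ (Finset.univ : Finset F))
      ∩ ((Finset.univ : Finset F) ×ˢ ({0} : Finset F)) = {(0, 0)} := by
    ext ⟨d, g⟩
    simp [eq_comm]
  have := Finset.card_union_add_card_inter (({0} : Finset F) ×ˢ (Finset.univ : Finset F))
    ((Finset.univ : Finset F) ×ˢ ({0} : Finset F))
  rw [← e, i] at this
  simp only [Finset.card_singleton, Finset.card_product, Finset.card_univ,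
    ← Nat.card_eq_fintype_card, G.card_F] at this
  omega

lemma card_flagsOne_zero {σ : F} (hσ : σ ≠ 0) : (flagsOne σ 0).card = 3 := by
  obtain ⟨r, rfl⟩ := G.exists_sq σ
  have hr : r ≠ 0 := by rintro rfl; simp at hσ
  rw [Finset.card_eq_three]
  refine ⟨(r, 0), (0, r), (r, r), by simp [hr], by simp [hr.symm], by simp [hr.symm], ?_⟩
  ext ⟨d, g⟩
  rw [mem_flagsOne]
  simp only [Finset.mem_insert, Finset.mem_singleton, Prod.mk_inj]
  have h2 := G.two_eq_zero
  constructor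
  · rintro ⟨h, h'⟩
    rcases mul_eq_zero.1 h' with h' | h'
    · rcases mul_eq_zero.1 h' with rfl | rfl
      · exact Or.inr (Or.inl ⟨rfl, G.sq_injective (by simpa using h)⟩)
      · exact Or.inl ⟨G.sq_injective (by simpa using h), rfl⟩
    · obtain rfl := G.eq_of_add_eq_zero h'
      have : d = r := G.sq_injective (show d ^ 2 = r ^ 2 by linear_combination h - d ^ 2 * h2)
      exact Or.inr (Or.inr ⟨this, this⟩)
  · rintro (⟨rfl, rfl⟩ | ⟨rfl, rfl⟩ | ⟨rfl, rfl⟩)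
    · simp
    · simp
    · exact ⟨by linear_combination g ^ 2 * h2, by linear_combination g ^ 3 * h2⟩

lemma card_flagsTwo_zero {σ : F} (hσ : σ ≠ 0) : (flagsTwo σ 0).card = 1 := by
  obtain ⟨r, rfl⟩ := G.exists_sq σ
  rw [Finset.card_eq_one]
  refine ⟨(r, r), Finset.ext fun ⟨d, g⟩ => ?_⟩
  rw [mem_flagsTwo, Finset.mem_singleton, Prod.mk_inj]
  constructor
  · rintro ⟨h, h'⟩
    simp only at h h'
    rw [h] at h'
    obtain rfl := G.eq_of_add_eq_zero ((mul_eq_zero.1 h').resolve_left hσ)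
    have : d = r := G.sq_injective (show d ^ 2 = r ^ 2 by rw [← h, sq])
    exact ⟨this, this⟩
  · rintro ⟨rfl, rfl⟩
    exact ⟨(sq _).symm, by linear_combination g ^ 3 * G.two_eq_zero⟩

lemma card_flagsOne {σ t : F} (ht : t ≠ 0) {i : F × F} (hi : i ∈ flagsOne σ t) :
    (flagsOne σ t).card = 6 := by
  obtain ⟨d, g⟩ := i
  have hi' := mem_flagsOne.1 hi
  simp only at hi'
  have h2 := G.two_eq_zero
  have hd : d ≠ 0 := by rintro rfl; apply ht; rw [← hi'.2]; ring
  have hg : g ≠ 0 := by rintro rfl; apply ht; rw [← hi'.2]; ring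
  have hdg : d ≠ g := by
    rintro rfl
    apply ht
    rw [← hi'.2]
    linear_combination d ^ 3 * h2
  have root : ∀ y, y ^ 3 + σ * y + t = 0 → y = d ∨ y = g ∨ y = d + g := by
    intro y hy
    have : (y - d) * ((y - g) * (y - (d + g))) = 0 := by
      linear_combination hy + y * hi'.1 + hi'.2 - (d * g * (d + g) + y ^ 2 * (d + g)
        - d * g * y) * h2
    simpa only [mul_eq_zero, sub_eq_zero] using this
  have e : flagsOne σ t = {(d, g), (g, d), (d, d + g), (d + g, d), (g, d + g), (d + g, g)} := by
    ext ⟨x, y⟩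
    rw [mem_flagsOne]
    simp only [Finset.mem_insert, Finset.mem_singleton, Prod.mk_inj]
    constructor
    · rintro ⟨h, h'⟩
      have hx := root x (by
        linear_combination -x * h - h' + (x ^ 3 + x ^ 2 * y + x * y ^ 2) * h2)
      have hy := root y (by
        linear_combination -y * h - h' + (y ^ 3 + x ^ 2 * y + x * y ^ 2) * h2)
      have hxy : x ≠ y := by
        rintro rfl
        apply ht
        rw [← h']
        linear_combination x ^ 3 * h2
      rcases hx with rfl | rfl | rfl <;> rcases hy with rfl | rfl | rfl <;> simp_all
    · obtain ⟨h, h'⟩ := hi'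
      rintro (⟨rfl, rfl⟩ | ⟨rfl, rfl⟩ | ⟨rfl, rfl⟩ | ⟨rfl, rfl⟩ | ⟨rfl, rfl⟩ | ⟨rfl, rfl⟩) <;>
      grind
  rw [e]
  have e1 : d + g ≠ d := by simpa using hg
  have e2 : d + g ≠ g := by simpa using hd
  have e3 : d ≠ d + g := e1.symm
  have e4 : g ≠ d + g := e2.symm
  repeat rw [Finset.card_insert_of_notMem (by simp [hdg, hdg.symm, hd, hg])]
  simp

lemma card_flagsTwo {σ t : F} (ht : t ≠ 0) {i : F × F} (hi : i ∈ flagsTwo σ t) :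
    (flagsTwo σ t).card = 2 := by
  obtain ⟨d, g⟩ := i
  have hi' := mem_flagsTwo.1 hi
  simp only at hi'
  have h2 := G.two_eq_zero
  obtain ⟨rfl, rfl⟩ := hi'
  have hdg : d ≠ g := by
    rintro rfl
    apply ht
    linear_combination d ^ 3 * h2
  rw [Finset.card_eq_two]
  refine ⟨(d, g), (g, d), by simp [hdg], ?_⟩
  ext ⟨x, y⟩
  rw [mem_flagsTwo]
  simp only [Finset.mem_insert, Finset.mem_singleton, Prod.mk_inj]
  constructor
  · rintro ⟨h, h'⟩
    rw [h] at h'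
    have hs : x + y = d + g := mul_left_cancel₀ (left_ne_zero_of_mul ht) h'
    have : (x - d) * (x - g) = 0 := by linear_combination x * hs - h
    rcases mul_eq_zero.1 this with h0 | h0
    · rw [sub_eq_zero] at h0
      subst h0
      exact Or.inl ⟨rfl, add_left_cancel hs⟩
    · rw [sub_eq_zero] at h0
      subst h0
      exact Or.inr ⟨rfl, by linear_combination hs⟩
  · rintro (⟨rfl, rfl⟩ | ⟨rfl, rfl⟩)
    · simp
    · constructor <;> ring

lemma flagsOne_or_flagsTwo_eq_empty {σ t : F} (ht : t ≠ 0) :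
    flagsOne σ t = ∅ ∨ flagsTwo σ t = ∅ := by
  by_contra! h
  obtain ⟨⟨⟨x, y⟩, hi⟩, ⟨d, g⟩, hj⟩ := h
  rw [mem_flagsOne] at hi
  rw [mem_flagsTwo] at hj
  obtain ⟨h1, h2⟩ := hi
  obtain ⟨h3, h4⟩ := hj
  simp only at h1 h2 h3 h4
  have hc := G.two_eq_zero
  rw [← h4] at ht
  have hs : d + g ≠ 0 := right_ne_zero_of_mul ht
  have hy : y ≠ 0 := by rintro rfl; rw [h4, ← h2] at ht; simp at ht
  have hx : x ≠ 0 := by rintro rfl; rw [h4, ← h2] at ht; simp at ht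
  have hxy : x + y ≠ 0 := by intro h; rw [h4, ← h2, h] at ht; simp at ht
  have key : (d * (x * (x + y)) * y + x * (d + g) * (x * (x + y)) + (d + g) * y ^ 3) ^ 2
      + (d * (x * (x + y)) * y + x * (d + g) * (x * (x + y)) + (d + g) * y ^ 3)
        * ((d + g) * y * (x * (x + y)))
      + ((d + g) * y * (x * (x + y))) ^ 2 = 0 := by
    have e1 : d * g * (y * (x * (x + y))) ^ 2 = σ * t ^ 2 := by rw [h3, ← h2]; ring
    have e2 : (d + g) ^ 2 * (x ^ 2 + x * y + y ^ 2) ^ 3 = σ * t ^ 2 := by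
      rw [h1, ← h4, h3]; ring
    linear_combination e1 + e2 + (d * (x * (x + y)) * y * (x * (d + g) * (x * (x + y)))
      + d * (x * (x + y)) * y * ((d + g) * y ^ 3)
      + x * (d + g) * (x * (x + y)) * ((d + g) * y ^ 3)
      + (d * y * (x * (x + y))) ^ 2
      - (d + g) ^ 2 * ((x * (x + y)) ^ 2 * y ^ 2 + x * (x + y) * y ^ 4) + σ * t ^ 2) * hc
  exact (mul_ne_zero (mul_ne_zero hs hy) (mul_ne_zero hx hxy))
    (G.eq_zero_of_sq_add_mul_add_sq_eq_zero key).2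

lemma card_flags {σ t : F} (h : σ ≠ 0 ∨ t ≠ 0) :
    (flagsOne σ t).card + 3 * (flagsTwo σ t).card = 0 ∨
    (flagsOne σ t).card + 3 * (flagsTwo σ t).card = 6 := by
  by_cases ht : t = 0
  · subst ht
    have hσ : σ ≠ 0 := by simpa using h
    rw [G.card_flagsOne_zero hσ, G.card_flagsTwo_zero hσ]
    simp
  · rcases (flagsOne σ t).eq_empty_or_nonempty with h1 | ⟨i, h1⟩
    · rcases (flagsTwo σ t).eq_empty_or_nonempty with h2 | ⟨j, h2⟩
      · simp [h1, h2]
      · simp [h1, G.card_flagsTwo ht h2]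
    · have h2 := (G.flagsOne_or_flagsTwo_eq_empty ht).resolve_left (Finset.ne_empty_of_mem h1)
      simp [h2, G.card_flagsOne ht h1]

variable [DecidableEq R]

lemma walk_four_zero :
    (walk G.conn 4 0 : ℤ) = 3 * (2 * 2 ^ (2 * k + 1)) ^ 2 - 2 * (2 * 2 ^ (2 * k + 1)) := by
  have h := G.walk_four_subK 0 0
  have h1 := G.card_flagsOne_zero_zero
  have h2 := G.card_flagsTwo_zero_zero
  rw [map_zero, zero_pow two_ne_zero, h1, mul_zero, Prod.mk_zero_zero, Prod.mk_zero_zero] at h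
  zify at h h2
  rw [h]
  linear_combination (6 * 2 ^ (2 * k + 1)) * h2

lemma walk_four_subK_eq_or {ψ : ZMod 4 × R × F} (hψ : ψ ∈ G.subK) (h0 : ψ ≠ 0) :
    walk G.conn 4 ψ = 0 ∨ (walk G.conn 4 ψ : ℤ) = 6 * (2 * 2 ^ (2 * k + 1)) := by
  obtain ⟨ε, s, t⟩ := ψ
  obtain ⟨rfl, hs⟩ := G.mem_subK.1 hψ
  obtain ⟨s, rfl⟩ := G.exists_two_mul s hs
  have h : G.π s ^ 2 ≠ 0 ∨ t ≠ 0 := by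
    by_contra! h
    apply h0
    rw [h.2, (G.two_mul_eq_zero_iff s).2 (by simpa using h.1)]
    rfl
  rw [G.walk_four_subK]
  rcases G.card_flags h with h | h
  · left
    rw [h, mul_zero]
  · right
    rw [h]
    push_cast
    ring

end GaloisRing

/-- The real part of `chi`. -/
def reZ : ZMod 4 → ℤ := ![1, 0, -1, 0]

/-- The imaginary part of `chi`. -/
def imZ : ZMod 4 → ℤ := ![0, 1, 0, -1]

lemma chi_eq (j : ZMod 4) : chi j = reZ j + imZ j * Complex.I := by
  fin_cases j
  · exact chi.map_zero_eq_one.trans (by simp [reZ, imZ])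
  · exact chi_one.trans (by simp [reZ, imZ])
  · exact chi_two.trans (by simp [reZ, imZ])
  · exact chi_three.trans (by simp [reZ, imZ])

lemma reZ_neg (j : ZMod 4) : reZ (-j) = reZ j := by
  revert j
  decide

lemma imZ_neg (j : ZMod 4) : imZ (-j) = -imZ j := by
  revert j
  decide

lemma even_of_sq_add_sq {P I M : ℤ} (h : P ^ 2 + I ^ 2 = 4 * M) :
    ∃ P' I', P = 2 * P' ∧ I = 2 * I' := by
  rcases Int.even_or_odd' P with ⟨p, rfl | rfl⟩ <;> rcases Int.even_or_odd' I with ⟨i, rfl | rfl⟩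
  · exact ⟨p, i, rfl, rfl⟩
  all_goals
    ring_nf at h
    omega

lemma eq_or_of_sq_add_sq {k : ℕ} {P I c : ℤ} (hc : c = 0 ∨ c = 2 ∨ c = 4 ∨ c = 8)
    (h : P ^ 2 + I ^ 2 = c * 4 ^ k) :
    P = 0 ∧ c ≠ 2 ∨ P = 2 ^ k ∨ P = -2 ^ k ∨ P = 2 ^ (k + 1) ∨ P = -2 ^ (k + 1) := by
  induction k generalizing P I with
  | zero =>
    have hP : P ^ 2 ≤ 8 := by rcases hc with rfl | rfl | rfl | rfl <;> nlinarith [sq_nonneg I]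
    have hI : I ^ 2 ≤ 8 := by rcases hc with rfl | rfl | rfl | rfl <;> nlinarith [sq_nonneg P]
    have h1 : P ≤ 2 := by nlinarith
    have h2 : -2 ≤ P := by nlinarith
    have h3 : I ≤ 2 := by nlinarith
    have h4 : -2 ≤ I := by nlinarith
    interval_cases P <;> interval_cases I <;> simp at h ⊢ <;> omega
  | succ k ih =>
    obtain ⟨P, I, rfl, rfl⟩ := even_of_sq_add_sq (M := c * 4 ^ k) (by rw [h, pow_succ]; ring)
    have := ih (P := P) (I := I) (by rw [pow_succ 4] at h; linarith)
    have e : (2 : ℤ) ^ (k + 1 + 1) = 2 * 2 ^ (k + 1) := by ring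
    have e' : (2 : ℤ) ^ (k + 1) = 2 * 2 ^ k := by ring
    rw [e]
    rw [e'] at *
    omega

namespace GaloisRing

variable {k : ℕ} {R F : Type*} [CommRing R] [Field F] (G : GaloisRing k R F) [Fintype F]

/-- The codeword with parameters `z`, as a function on `F`. -/
noncomputable def val (z : ZMod 4 × R × F) (x : F) : ZMod 4 := G.pairing (G.point true x) z

/-- The quadratic part of a codeword. -/
noncomputable def quad (z : ZMod 4 × R × F) (x : F) : ZMod 4 :=
  G.T (G.τ x * z.2.1) + dbl (G.tr (x ^ 3 * z.2.2))

lemma val_eq (z : ZMod 4 × R × F) (x : F) : G.val z x = z.1 + G.quad z x := by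
  simp [val, quad, pairing_apply, point, G.τ_zero, add_assoc]

/-- The linearization of the quadratic part of a codeword. -/
noncomputable def lin (z : ZMod 4 × R × F) : F →+ F := AddMonoidHom.mk'
  (fun x => G.π z.2.1 ^ 2 * x + z.2.2 * x ^ 2 + G.sqrt (z.2.2 * x)) fun x y => by
    rw [mul_add z.2.2, G.sqrt_add]
    linear_combination z.2.2 * x * y * G.two_eq_zero

lemma lin_apply (z : ZMod 4 × R × F) (x : F) :
    G.lin z x = G.π z.2.1 ^ 2 * x + z.2.2 * x ^ 2 + G.sqrt (z.2.2 * x) := rfl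

lemma lin_eq_zero_iff (z : ZMod 4 × R × F) (x : F) :
    G.lin z x = 0 ↔ G.π z.2.1 ^ 4 * x ^ 2 + z.2.2 ^ 2 * x ^ 4 + z.2.2 * x = 0 := by
  rw [← pow_eq_zero_iff (two_ne_zero), lin_apply]
  have e : (G.π z.2.1 ^ 2 * x + z.2.2 * x ^ 2 + G.sqrt (z.2.2 * x)) ^ 2
      = G.π z.2.1 ^ 4 * x ^ 2 + z.2.2 ^ 2 * x ^ 4 + z.2.2 * x := by
    linear_combination G.sqrt_sq (z.2.2 * x) + (G.π z.2.1 ^ 2 * x * (z.2.2 * x ^ 2)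
      + (G.π z.2.1 ^ 2 * x + z.2.2 * x ^ 2) * G.sqrt (z.2.2 * x)) * G.two_eq_zero
  rw [e]

lemma quad_add (z : ZMod 4 × R × F) (x y : F) :
    G.quad z (x + y) = G.quad z x + G.quad z y + dbl (G.tr (G.lin z y * x)) := by
  have h1 : G.T (G.τ (x + y) * z.2.1) = G.T (G.τ x * z.2.1) + G.T (G.τ y * z.2.1)
      + dbl (G.tr (x * y * G.π z.2.1 ^ 2)) := by
    rw [G.τ_add, ← G.tr_sqrt, show (G.τ x + G.τ y + 2 * G.τ (G.sqrt (x * y))) * z.2.1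
      = G.τ x * z.2.1 + G.τ y * z.2.1 + 2 * (G.τ (G.sqrt (x * y)) * z.2.1) by ring, map_add,
      map_add, T_two_mul, map_mul G.π, π_τ]
    have : G.sqrt (x * y * G.π z.2.1 ^ 2) = G.sqrt (x * y) * G.π z.2.1 := by
      rw [G.sqrt_eq_iff, mul_pow, G.sqrt_sq]
    rw [this]
  have h2 : G.tr (x ^ 2 * y * z.2.2) = G.tr (G.sqrt (z.2.2 * y) * x) := by
    rw [← G.tr_sqrt]
    congr 1
    rw [G.sqrt_eq_iff, mul_pow, G.sqrt_sq]
    ring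
  have e : (x + y) ^ 3 * z.2.2 = x ^ 3 * z.2.2 + y ^ 3 * z.2.2 + x ^ 2 * y * z.2.2
      + z.2.2 * y ^ 2 * x := by
    linear_combination (x ^ 2 * y + x * y ^ 2) * z.2.2 * G.two_eq_zero
  have e' : G.lin z y * x = x * y * G.π z.2.1 ^ 2 + z.2.2 * y ^ 2 * x
      + G.sqrt (z.2.2 * y) * x := by
    rw [lin_apply]
    ring
  rw [quad, h1, e, e', quad, quad]
  simp only [map_add, h2]
  abel

/-- The restriction of the quadratic part of a codeword to its radical. -/
noncomputable def radQuad (z : ZMod 4 × R × F) : (G.lin z).ker →+ ZMod 4 :=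
  AddMonoidHom.mk' (fun x => G.quad z x) fun x y => by
    rw [AddSubgroup.coe_add, quad_add, (AddMonoidHom.mem_ker).1 y.2, zero_mul, map_zero,
      map_zero, add_zero]

lemma card_ker_lin (z : ZMod 4 × R × F) (hz : G.π z.2.1 ≠ 0 ∨ z.2.2 ≠ 0) :
    Nat.card (G.lin z).ker = 1 ∨ z.2.2 ≠ 0 ∧
      (Nat.card (G.lin z).ker = 2 ∨ Nat.card (G.lin z).ker = 4) := by
  classical
  by_cases hb : z.2.2 = 0
  · left
    have hα : G.π z.2.1 ≠ 0 := by simpa [hb] using hz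
    rw [AddSubgroup.card_eq_one, AddSubgroup.eq_bot_iff_forall]
    intro x hx
    rw [AddMonoidHom.mem_ker, lin_eq_zero_iff, hb] at hx
    simpa [hα] using hx
  · have hdvd := AddSubgroup.card_addSubgroup_dvd_card (G.lin z).ker
    rw [G.card_F, Nat.dvd_prime_pow Nat.prime_two] at hdvd
    obtain ⟨i, -, hi⟩ := hdvd
    set f : F[X] := C (G.π z.2.1 ^ 4) * X ^ 2 + C (z.2.2 ^ 2) * X ^ 4 + C z.2.2 * X with hf
    have hf0 : f ≠ 0 := by
      intro h
      have := congrArg (fun g => g.coeff 4) h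
      simp only [hf, coeff_add, coeff_C_mul, coeff_X_pow, coeff_X] at this
      simp [hb] at this
    have hdeg : f.natDegree ≤ 4 := by rw [hf]; compute_degree
    have hle : Nat.card (G.lin z).ker ≤ 4 := by
      rw [Nat.card_eq_fintype_card, Fintype.card_subtype]
      refine le_trans (Finset.card_le_card ?_)
        ((Multiset.toFinset_card_le _).trans ((card_roots' f).trans hdeg))
      intro x hx
      rw [Multiset.mem_toFinset, mem_roots hf0, IsRoot.def]
      have hx : G.lin z x = 0 := by simpa using hx
      rw [lin_eq_zero_iff] at hx
      simpa [hf] using hx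
    rw [hi] at hle ⊢
    have : i ≤ 2 := (Nat.pow_le_pow_iff_right (a := 2) (by norm_num)).1 hle
    interval_cases i <;> simp [hb]

lemma sum_chi_dbl_tr (c : F) [Decidable (c = 0)] :
    ∑ x, chi (dbl (G.tr (c * x))) = if c = 0 then (2 : ℂ) ^ (2 * k + 1) else 0 := by
  classical
  have h := sum_chi_eq_ite ((dbl.comp G.tr).comp (AddMonoidHom.mulLeft c))
  have h2 : (Fintype.card F : ℂ) = 2 ^ (2 * k + 1) := by
    rw [← Nat.card_eq_fintype_card, G.card_F]
    push_cast
    rfl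
  rw [h2] at h
  refine h.trans (if_congr ⟨fun h => G.tr_mul_eq_zero fun y => ?_, ?_⟩ rfl rfl)
  · rw [← dbl_eq_zero_iff]
    exact h y
  · rintro rfl y
    simp

/-- The real part of the character sum of a codeword. -/
noncomputable def reSum (z : ZMod 4 × R × F) : ℤ := ∑ x, reZ (G.val z x)

/-- The imaginary part of the character sum of a codeword. -/
noncomputable def imSum (z : ZMod 4 × R × F) : ℤ := ∑ x, imZ (G.val z x)

lemma sum_chi_val (z : ZMod 4 × R × F) :
    ∑ x, chi (G.val z x) = G.reSum z + G.imSum z * Complex.I := by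
  simp [chi_eq, Finset.sum_add_distrib, Finset.sum_mul, reSum, imSum]

lemma sum_chi_neg_val (z : ZMod 4 × R × F) :
    ∑ x, chi (-G.val z x) = G.reSum z - G.imSum z * Complex.I := by
  simp [chi_eq, Finset.sum_add_distrib, Finset.sum_mul, reSum, imSum, reZ_neg, imZ_neg,
    sub_eq_add_neg]

lemma reSum_sq_add_imSum_sq (z : ZMod 4 × R × F) :
    G.reSum z ^ 2 + G.imSum z ^ 2 = 0 ∧ Nat.card (G.lin z).ker ≠ 1 ∨
    G.reSum z ^ 2 + G.imSum z ^ 2 = 2 ^ (2 * k + 1) * Nat.card (G.lin z).ker := by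
  classical
  have h : (G.reSum z ^ 2 + G.imSum z ^ 2 : ℂ) = 2 ^ (2 * k + 1) *
      ∑ y : (G.lin z).ker, chi (G.radQuad z y) := by
    have h1 : (G.reSum z ^ 2 + G.imSum z ^ 2 : ℂ)
        = ∑ x, ∑ y, chi (G.quad z y) * chi (dbl (G.tr (G.lin z y * x))) := by
      calc (G.reSum z ^ 2 + G.imSum z ^ 2 : ℂ)
          = (∑ x, chi (-G.val z x)) * ∑ x, chi (G.val z x) := by
            rw [sum_chi_val, sum_chi_neg_val]
            linear_combination (G.imSum z : ℂ) ^ 2 * Complex.I_sq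
        _ = _ := by
            rw [Finset.sum_mul]
            refine Finset.sum_congr rfl fun x _ => ?_
            rw [Finset.mul_sum, ← Equiv.sum_comp (Equiv.addLeft x)]
            refine Finset.sum_congr rfl fun y _ => ?_
            rw [← AddChar.map_add_eq_mul, ← AddChar.map_add_eq_mul, Equiv.coe_addLeft, val_eq,
              val_eq, quad_add]
            congr 1
            abel
    rw [h1, Finset.sum_comm]
    simp only [← Finset.mul_sum, sum_chi_dbl_tr, mul_ite, mul_zero]
    rw [← Finset.sum_filter, Finset.mul_sum]
    simp only [mul_comm _ ((2 : ℂ) ^ (2 * k + 1))]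
    exact Finset.sum_subtype _ (fun x => by simp) _
  rw [sum_chi_eq_ite] at h
  split_ifs at h with hr
  · right
    rw [← Nat.card_eq_fintype_card] at h
    exact_mod_cast h
  · left
    rw [mul_zero] at h
    refine ⟨by exact_mod_cast h, fun h1 => hr fun y => ?_⟩
    have := (Nat.card_eq_one_iff_unique.1 h1).1
    rw [Subsingleton.elim y 0, map_zero]

lemma reSum_mem {z : ZMod 4 × R × F} (hz : G.π z.2.1 ≠ 0 ∨ z.2.2 ≠ 0) :
    G.reSum z = 0 ∧ z.2.2 ≠ 0 ∨ G.reSum z = 2 ^ k ∨ G.reSum z = -2 ^ k ∨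
      G.reSum z = 2 ^ (k + 1) ∨ G.reSum z = -2 ^ (k + 1) := by
  have e : (2 : ℤ) ^ (2 * k + 1) = 2 * 4 ^ k := by rw [pow_succ, pow_mul]; norm_num [mul_comm]
  rcases G.reSum_sq_add_imSum_sq z with ⟨h, hc⟩ | h
  · have hb := ((G.card_ker_lin z hz).resolve_left hc).1
    have := eq_or_of_sq_add_sq (k := k) (c := 0) (by simp) (by rw [h, zero_mul])
    tauto
  · rw [e, mul_right_comm] at h
    rcases G.card_ker_lin z hz with hc | ⟨hb, hc | hc⟩
    · rw [hc] at h
      exact Or.inr (by simpa using eq_or_of_sq_add_sq (by simp) h)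
    · rw [hc] at h
      have := eq_or_of_sq_add_sq (by simp) h
      tauto
    · rw [hc] at h
      have := eq_or_of_sq_add_sq (by simp) h
      tauto

lemma reSum_of_perp {z : ZMod 4 × R × F} (hz : G.π z.2.1 = 0 ∧ z.2.2 = 0) (h0 : z ≠ 0)
    (ho : z ≠ (2, 0, 0)) : G.reSum z = 0 := by
  obtain ⟨u, a, b⟩ := z
  obtain ⟨ha, rfl⟩ := hz
  obtain ⟨w, rfl⟩ := G.exists_two_mul a ha
  have hv : ∀ x, G.val (u, 2 * w, 0) x = u + dbl (G.tr (G.π w * x)) := by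
    intro x
    rw [val_eq, quad, mul_left_comm, T_two_mul, map_mul, π_τ]
    simp [mul_comm]
  by_cases hw : G.π w = 0
  · rw [(G.two_mul_eq_zero_iff w).2 hw] at h0 ho
    have hu : ∀ u : ZMod 4, u ≠ 0 → u ≠ 2 → reZ u = 0 := by decide
    refine Finset.sum_eq_zero fun x _ => ?_
    rw [hv, hw, zero_mul, map_zero, map_zero, add_zero]
    exact hu u (by rintro rfl; exact h0 rfl) (by rintro rfl; exact ho rfl)
  · classical
    have h := G.sum_chi_val (u, 2 * w, 0)
    simp only [hv, AddChar.map_add_eq_mul, ← Finset.mul_sum, sum_chi_dbl_tr, if_neg hw] at h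
    simpa using (congrArg Complex.re h).symm

omit [Fintype F] in
lemma ne_zero_or_of_not_perp {z : ZMod 4 × R × F} (hz : ¬ ∀ ψ ∈ G.subK, G.pairing ψ z = 0) :
    G.π z.2.1 ≠ 0 ∨ z.2.2 ≠ 0 := by
  rwa [perp_subK_iff, not_and_or] at hz

/-- The connection set of the Delsarte–Goethals code. -/
noncomputable def walkData [Fintype R] [DecidableEq R] [DecidableEq F] :
    WalkData (ZMod 4 × R × F) where
  p := G.pairing
  symm := G.pairing_symm
  nondeg := G.pairing_nondeg
  four_smul := G.four_nsmul
  D := G.conn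
  neg_mem g hg := by
    obtain ⟨s, x, rfl⟩ := G.mem_conn.1 hg
    exact G.mem_conn.2 ⟨!s, x, (G.point_neg s x).symm⟩
  neg_ne g hg h := by
    obtain ⟨s, x, rfl⟩ := G.mem_conn.1 hg
    rw [point_neg] at h
    simpa using congrArg Prod.fst (G.point_injective (a₁ := (!s, x)) (a₂ := (s, x)) h)
  o := (2, 0, 0)
  o_ne h := by
    have h2 : (2 : ZMod 4) ≠ 0 := by decide
    exact h2 (congrArg Prod.fst h)
  o_add_o := by
    have h2 : (2 : ZMod 4) + 2 = 0 := by decide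
    simp [h2]
  pairing_o g hg := by
    obtain ⟨s, x, rfl⟩ := G.mem_conn.1 hg
    have h2 : (-2 : ZMod 4) = 2 := by decide
    cases s <;> simp [pairing_apply, point, h2]
  K := G.subK
  o_perp ψ hψ := by simp [pairing_apply, (G.mem_subK.1 hψ).1]
  a := 2 ^ (k + 1)
  a_ne := by positivity
  card_D := by
    rw [card_conn]
    push_cast
    ring
  card_univ := by
    rw [Fintype.card_prod, Fintype.card_prod, ZMod.card, ← Nat.card_eq_fintype_card,
      ← Nat.card_eq_fintype_card, G.card_F, G.card_R, show 4 = 2 ^ 2 from rfl, ← pow_mul]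
    push_cast
    ring
  card_K := by
    rw [card_subK]
    push_cast
    ring
  n z := 2 * G.reSum z
  n_eq z := by
    have e : ∀ x, G.pairing (G.point false x) z = -G.val z x := by
      intro x
      rw [val, ← AddMonoidHom.neg_apply, ← map_neg, point_neg, Bool.not_true]
    have h : ∀ x, G.pairing (G.point true x) z = G.val z x := fun _ => rfl
    simp only [sum_conn, Fintype.sum_bool, e, h, sum_chi_val, sum_chi_neg_val]
    push_cast
    ring
  n_mem z hz := by
    rw [pow_succ]
    have h := G.reSum_mem (G.ne_zero_or_of_not_perp hz)
    rw [pow_succ] at h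
    omega
  n_perp z hz h0 ho := by rw [G.reSum_of_perp ((G.perp_subK_iff z).1 hz) h0 ho, mul_zero]
  walk_four_zero := by
    rw [walk_four_zero]
    ring
  walk_two_K ψ hψ h0 := G.walk_two_subK hψ h0
  walk_four_K ψ hψ h0 := by
    refine (G.walk_four_subK_eq_or hψ h0).imp_right fun h => ?_
    rw [h]
    ring

end GaloisRing

section AdjoinRoot

variable {A : Type*} [CommRing A] {f : A[X]}

lemma trace_adjoinRoot_mk (hf : f.Monic) (g : A[X]) :
    Algebra.trace A (AdjoinRoot f) (AdjoinRoot.mk f g)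
      = ∑ i ∈ Finset.range f.natDegree, ((g * X ^ i) %ₘ f).coeff i := by
  let b : Module.Basis (Fin f.natDegree) A (AdjoinRoot f) := AdjoinRoot.powerBasisAux' hf
  have hb : ∀ i, b i = AdjoinRoot.mk f (X ^ (i : ℕ)) := fun i => by
    rw [map_pow, AdjoinRoot.mk_X]
    exact (AdjoinRoot.powerBasis' hf).basis_eq_pow i
  rw [Algebra.trace_eq_matrix_trace b, Matrix.trace,
    ← Fin.sum_univ_eq_sum_range (fun i => ((g * X ^ i) %ₘ f).coeff i)]
  refine Finset.sum_congr rfl fun i _ => ?_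
  rw [Matrix.diag_apply, Algebra.leftMulMatrix_eq_repr_mul, hb, ← map_mul]
  exact (AdjoinRoot.powerBasisAux'_repr_apply_to_fun hf _ _).trans
    (by rw [AdjoinRoot.modByMonicHom_mk])

lemma card_adjoinRoot (hf : f.Monic) : Nat.card (AdjoinRoot f) = Nat.card A ^ f.natDegree := by
  rw [Nat.card_congr (AdjoinRoot.powerBasisAux' hf).equivFun.toEquiv, Nat.card_fun,
    Nat.card_eq_fintype_card (α := Fin _), Fintype.card_fin]

end AdjoinRoot

lemma red_eq_zero_iff (x : ZMod 4) : red x = 0 ↔ 2 * x = 0 := by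
  revert x
  decide

lemma map_red_eq_zero_iff (p : (ZMod 4)[X]) : p.map red = 0 ↔ 2 * p = 0 := by
  rw [Polynomial.ext_iff, Polynomial.ext_iff]
  refine forall_congr' fun i => ?_
  rw [coeff_map, coeff_zero, coeff_zero, red_eq_zero_iff, ← C_ofNat, coeff_C_mul]

lemma exists_two_mul_of_map_red_eq_zero {p : (ZMod 4)[X]} (h : p.map red = 0) :
    ∃ q, p = 2 * q := by
  have := (C_dvd_iff_dvd_coeff (2 : ZMod 4) p).2 fun i => by
    have h := congrArg (fun g => g.coeff i) h
    simp only [coeff_map, coeff_zero] at h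
    generalize p.coeff i = x at h
    revert x
    decide
  exact this

lemma exists_map_red (p : (ZMod 2)[X]) : ∃ q : (ZMod 4)[X], q.map red = p :=
  Polynomial.map_surjective red (ZMod.castHom_surjective _) p

section

variable (f : (ZMod 4)[X])

/-- The reduction of `AdjoinRoot f` modulo two. -/
noncomputable def residue : AdjoinRoot f →+* AdjoinRoot (f.map red) :=
  AdjoinRoot.map red f (f.map red) dvd_rfl

lemma residue_mk (g : (ZMod 4)[X]) :
    residue f (AdjoinRoot.mk f g) = AdjoinRoot.mk (f.map red) (g.map red) := by
  rw [residue, AdjoinRoot.map, AdjoinRoot.lift_mk, ← eval₂_map]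
  exact AdjoinRoot.aeval_eq _

lemma residue_surjective : Function.Surjective (residue f) := by
  intro x
  obtain ⟨p, rfl⟩ := AdjoinRoot.mk_surjective x
  obtain ⟨q, rfl⟩ := exists_map_red p
  exact ⟨AdjoinRoot.mk f q, residue_mk f q⟩

lemma exists_two_mul_of_residue_eq_zero {z : AdjoinRoot f} (h : residue f z = 0) :
    ∃ w, z = 2 * w := by
  obtain ⟨p, rfl⟩ := AdjoinRoot.mk_surjective z
  rw [residue_mk, AdjoinRoot.mk_eq_zero] at h
  obtain ⟨r, hr⟩ := h
  obtain ⟨r, rfl⟩ := exists_map_red r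
  obtain ⟨q, hq⟩ := exists_two_mul_of_map_red_eq_zero (p := p - f * r) (by simp [hr])
  refine ⟨AdjoinRoot.mk f q, ?_⟩
  have := congrArg (AdjoinRoot.mk f) hq
  rw [map_mul, map_ofNat] at this
  simpa using this

variable {f}

lemma two_mul_eq_zero_iff_residue (hf : f.Monic) (z : AdjoinRoot f) :
    2 * z = 0 ↔ residue f z = 0 := by
  constructor
  · obtain ⟨p, rfl⟩ := AdjoinRoot.mk_surjective z
    intro h
    have h : AdjoinRoot.mk f (2 * p) = 0 := by rw [map_mul, map_ofNat, h]
    rw [AdjoinRoot.mk_eq_zero] at h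
    obtain ⟨r, hr⟩ := h
    have h2 : (2 * p).map red = 0 := by
      rw [map_red_eq_zero_iff, ← mul_assoc]
      have : (2 * 2 : (ZMod 4)[X]) = 0 := by
        rw [← C_ofNat, ← C_mul]
        simp [show (2 * 2 : ZMod 4) = 0 from rfl]
      rw [this, zero_mul]
    rw [hr, Polynomial.map_mul] at h2
    obtain ⟨q, rfl⟩ := exists_two_mul_of_map_red_eq_zero
      ((mul_eq_zero.1 h2).resolve_left (hf.map red).ne_zero)
    have : (p - f * q).map red = 0 := by
      rw [map_red_eq_zero_iff]
      linear_combination hr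
    rw [residue_mk, AdjoinRoot.mk_eq_zero]
    refine ⟨q.map red, ?_⟩
    simpa [sub_eq_zero] using this
  · intro h
    obtain ⟨w, rfl⟩ := exists_two_mul_of_residue_eq_zero f h
    have : (2 * 2 : AdjoinRoot f) = 0 := by
      rw [← map_ofNat (AdjoinRoot.of f), ← map_mul, show (2 * 2 : ZMod 4) = 0 from rfl, map_zero]
    rw [← mul_assoc, this, zero_mul]

lemma trace_residue (hf : f.Monic) (z : AdjoinRoot f) :
    Algebra.trace (ZMod 2) (AdjoinRoot (f.map red)) (residue f z)
      = red (Algebra.trace (ZMod 4) (AdjoinRoot f) z) := by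
  obtain ⟨p, rfl⟩ := AdjoinRoot.mk_surjective z
  rw [residue_mk, trace_adjoinRoot_mk (hf.map red), trace_adjoinRoot_mk hf, hf.natDegree_map,
    map_sum]
  refine Finset.sum_congr rfl fun i _ => ?_
  rw [← coeff_map, map_modByMonic _ hf, Polynomial.map_mul, Polynomial.map_pow, map_X]

lemma trace_sq {K : Type*} [Field K] [Algebra (ZMod 2) K] [Algebra.IsAlgebraic (ZMod 2) K] (x : K) :
    Algebra.trace (ZMod 2) K (x ^ 2) = Algebra.trace (ZMod 2) K x := by
  have := Algebra.trace_eq_of_algEquiv (FiniteField.frobeniusAlgEquivOfAlgebraic (ZMod 2) K) x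
  simpa using this

/-- The Galois ring `AdjoinRoot f`. -/
noncomputable def galoisRing {k : ℕ} [Fact (Irreducible (f.map red))] (hf : f.Monic)
    (hdeg : f.natDegree = 2 * k + 1) : GaloisRing k (AdjoinRoot f) (AdjoinRoot (f.map red)) where
  π := residue f
  π_surj := residue_surjective f
  two_mul_eq_zero_iff := two_mul_eq_zero_iff_residue hf
  exists_two_mul _ := exists_two_mul_of_residue_eq_zero f
  T := (Algebra.trace (ZMod 4) (AdjoinRoot f)).toAddMonoidHom
  tr := (Algebra.trace (ZMod 2) (AdjoinRoot (f.map red))).toAddMonoidHom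
  tr_π := trace_residue hf
  tr_sq x := by
    have := (hf.map red).finite_adjoinRoot
    exact trace_sq x
  exists_tr_ne_zero := by
    have := (hf.map red).finite_adjoinRoot
    have h := Algebra.trace_ne_zero (ZMod 2) (AdjoinRoot (f.map red))
    by_contra! h0
    exact h (LinearMap.ext h0)
  card_F := by
    rw [card_adjoinRoot (hf.map red), hf.natDegree_map, hdeg, Nat.card_zmod]
  card_R := by
    rw [card_adjoinRoot hf, hdeg, Nat.card_zmod]
  charP := charP_of_injective_algebraMap
    (algebraMap (ZMod 2) (AdjoinRoot (f.map red))).injective 2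

end

namespace GaloisRing

variable {k : ℕ} {R F : Type*} [CommRing R] [Field F] (G : GaloisRing k R F) [Fintype F]

/-- The character sum common to the codewords of a class. -/
def classSum (k : ℕ) : Fin 8 → ℤ :=
  ![2 ^ (2 * k + 1), 2 ^ (k + 1), 2 ^ k, 0, 0, -2 ^ k, -2 ^ (k + 1), -2 ^ (2 * k + 1)]

/-- The parameter `z` belongs to the class with index `i`. -/
def InClass (z : ZMod 4 × R × F) (i : Fin 8) : Prop :=
  G.reSum z = classSum k i ∧ ((G.π z.2.1 = 0 ∧ z.2.2 = 0) ↔ i = 0 ∨ i = 3 ∨ i = 7)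

lemma val_add (z w : ZMod 4 × R × F) : G.val (z + w) = G.val z + G.val w := by
  funext x
  simp [val]

lemma val_neg (z : ZMod 4 × R × F) : G.val (-z) = -G.val z := by
  funext x
  simp [val]

lemma reSum_neg (z : ZMod 4 × R × F) : G.reSum (-z) = G.reSum z := by
  simp [reSum, val_neg, reZ_neg]

lemma inClass_neg {z : ZMod 4 × R × F} {i : Fin 8} (h : G.InClass z i) : G.InClass (-z) i := by
  simpa [InClass, reSum_neg] using h

include G in
lemma card_eq : Fintype.card F = 2 ^ (2 * k + 1) := by
  rw [← Nat.card_eq_fintype_card, G.card_F]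

lemma reSum_zero : G.reSum 0 = 2 ^ (2 * k + 1) := by
  have h : reZ 0 = 1 := rfl
  simp [reSum, val, h, G.card_eq]

lemma reSum_two : G.reSum (2, 0, 0) = -2 ^ (2 * k + 1) := by
  have h : reZ 2 = -1 := rfl
  simp [reSum, val_eq, quad, h, G.card_eq]

lemma reSum_cases (z : ZMod 4 × R × F) :
    z = 0 ∨ z = (2, 0, 0) ∨ (G.π z.2.1 = 0 ∧ z.2.2 = 0) ∧ G.reSum z = 0 ∨
    ¬ (G.π z.2.1 = 0 ∧ z.2.2 = 0) ∧ (G.reSum z = 0 ∧ z.2.2 ≠ 0 ∨ G.reSum z = 2 ^ k ∨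
      G.reSum z = -2 ^ k ∨ G.reSum z = 2 ^ (k + 1) ∨ G.reSum z = -2 ^ (k + 1)) := by
  by_cases hz : G.π z.2.1 = 0 ∧ z.2.2 = 0
  · by_cases h0 : z = 0
    · exact Or.inl h0
    · by_cases ho : z = (2, 0, 0)
      · exact Or.inr (Or.inl ho)
      · exact Or.inr (Or.inr (Or.inl ⟨hz, G.reSum_of_perp hz h0 ho⟩))
  · exact Or.inr (Or.inr (Or.inr ⟨hz, G.reSum_mem (not_and_or.1 hz)⟩))

lemma exists_inClass (z : ZMod 4 × R × F) : ∃ i, G.InClass z i := by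
  rcases G.reSum_cases z with rfl | rfl | ⟨hz, h⟩ | ⟨hz, ⟨h, -⟩ | h | h | h | h⟩
  · exact ⟨0, by rw [reSum_zero]; rfl, by simp⟩
  · exact ⟨7, by rw [reSum_two]; rfl, by simp⟩
  · exact ⟨3, by rw [h]; rfl, by simp [hz]⟩
  · exact ⟨4, by rw [h]; rfl, by simp [hz]⟩
  · exact ⟨2, by rw [h]; rfl, by simp [hz]⟩
  · exact ⟨5, by rw [h]; rfl, by simp [hz]⟩
  · exact ⟨1, by rw [h]; rfl, by simp [hz]⟩
  · exact ⟨6, by rw [h]; rfl, by simp [hz]⟩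

omit [Fintype F] in
lemma pow_lt (hk : 1 ≤ k) :
    0 < (2 : ℤ) ^ k ∧ (2 : ℤ) ^ (k + 1) = 2 * 2 ^ k ∧ (2 : ℤ) ^ (k + 1) < 2 ^ (2 * k + 1) :=
  ⟨by positivity, by ring, pow_lt_pow_right₀ (by norm_num) (by omega)⟩

lemma inClass_unique (hk : 1 ≤ k) {z : ZMod 4 × R × F} {i j : Fin 8} (hi : G.InClass z i)
    (hj : G.InClass z j) : i = j := by
  obtain ⟨h0, h1, h2⟩ := pow_lt hk
  have hs : classSum k i = classSum k j := hi.1.symm.trans hj.1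
  have hp : (i = 0 ∨ i = 3 ∨ i = 7) ↔ (j = 0 ∨ j = 3 ∨ j = 7) := hi.2.symm.trans hj.2
  fin_cases i <;> fin_cases j <;> simp [classSum] at hs hp ⊢ <;> omega

lemma equiv_of_inClass [Fintype R] [DecidableEq R] [DecidableEq F] {z z' : ZMod 4 × R × F}
    {i : Fin 8} (hz : G.InClass z i) (hz' : G.InClass z' i) : G.walkData.Equiv z z' :=
  ⟨congrArg (2 * ·) (hz.1.trans hz'.1.symm),
    (G.perp_subK_iff z).trans ((hz.2.trans hz'.2.symm).trans (G.perp_subK_iff z').symm)⟩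

lemma inClass_congr [Fintype R] [DecidableEq R] [DecidableEq F] {z z' : ZMod 4 × R × F}
    (h : G.walkData.Equiv z z') (i : Fin 8) : G.InClass z i ↔ G.InClass z' i := by
  have h1 : 2 * G.reSum z = 2 * G.reSum z' := h.1
  have h2 := (G.perp_subK_iff z).symm.trans (h.2.trans (G.perp_subK_iff z'))
  rw [InClass, InClass, h2, mul_left_cancel₀ two_ne_zero h1]

lemma card_inClass_sub [Fintype R] {z z' : ZMod 4 × R × F} (i j : Fin 8) {l : Fin 8}
    (hz : G.InClass z l) (hz' : G.InClass z' l) :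
    Nat.card {r // G.InClass r i ∧ G.InClass (z - r) j}
      = Nat.card {r // G.InClass r i ∧ G.InClass (z' - r) j} := by
  classical
  have key : ∀ z, (Nat.card {r // G.InClass r i ∧ G.InClass (z - r) j} : ℝ)
      = ∑ r, (if G.InClass r i then (1 : ℝ) else 0) * if G.InClass (z - r) j then 1 else 0 := by
    intro z
    simp only [← ite_and, mul_ite, mul_one, mul_zero, Finset.sum_boole]
    rw [Nat.card_eq_fintype_card, Fintype.card_subtype]
    simp only [and_comm]
  have h := G.walkData.convolution_eq (f₁ := fun r => if G.InClass r i then 1 else 0)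
    (f₂ := fun r => if G.InClass r j then 1 else 0)
    (fun _ _ h => if_congr (G.inClass_congr h i) rfl rfl)
    (fun _ _ h => if_congr (G.inClass_congr h j) rfl rfl) (G.equiv_of_inClass hz hz')
  rw [← key, ← key] at h
  exact_mod_cast h

lemma inClass_iff (hk : 1 ≤ k) (z : ZMod 4 × R × F) {i : Fin 8} (h3 : i ≠ 3) (h4 : i ≠ 4) :
    G.InClass z i ↔ G.reSum z = classSum k i := by
  refine ⟨And.left, fun h => ?_⟩
  obtain ⟨j, hj⟩ := G.exists_inClass z
  obtain ⟨p0, p1, p2⟩ := pow_lt hk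
  have hs : classSum k i = classSum k j := h.symm.trans hj.1
  have : i = j := by
    fin_cases i <;> fin_cases j <;> simp [classSum] at hs h3 h4 ⊢ <;> omega
  rwa [this]

lemma inClass_three_iff (hk : 1 ≤ k) (z : ZMod 4 × R × F) :
    G.InClass z 3 ↔ G.reSum z = 0 ∧ z.2.2 = 0 := by
  refine ⟨fun h => ⟨h.1, (h.2.2 (by simp)).2⟩, fun ⟨h, hb⟩ => ⟨h, ?_⟩⟩
  obtain ⟨p0, p1, p2⟩ := pow_lt hk
  rcases G.reSum_cases z with rfl | rfl | hz | ⟨-, hz⟩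
  · simp
  · simp
  · simpa using hz.1
  · exfalso
    rw [h, hb] at hz
    simp at hz
    omega

lemma inClass_four_iff (z : ZMod 4 × R × F) :
    G.InClass z 4 ↔ G.reSum z = 0 ∧ z.2.2 ≠ 0 := by
  refine ⟨fun h => ⟨h.1, fun hb => ?_⟩, fun ⟨h, hb⟩ => ⟨h, by simp [hb]⟩⟩
  have hz : ¬ (G.π z.2.1 = 0 ∧ z.2.2 = 0) := fun hz => absurd (h.2.1 hz) (by simp)
  have h0 : G.reSum z = 0 := h.1
  have := G.reSum_mem (not_and_or.1 hz)
  rw [h0, hb] at this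
  have p : 0 < (2 : ℤ) ^ k := by positivity
  rw [pow_succ] at this
  simp at this
  omega

lemma val_injective (hk : 1 ≤ k) : Function.Injective G.val := by
  have h : ∀ z, G.val z = 0 → z = 0 := by
    intro z hz
    obtain ⟨h0, h1, h2⟩ := pow_lt hk
    have hs : G.reSum z = G.reSum 0 := by
      have : G.val 0 = 0 := by
        funext x
        simp [val]
      rw [reSum, reSum, hz, this]
    rw [reSum_zero] at hs
    rcases G.reSum_cases z with h | rfl | h | h
    · exact h
    · rw [reSum_two] at hs
      omega
    · omega
    · omega
  intro z w hzw
  have := h (z + -w) (by rw [val_add, val_neg, hzw, add_neg_cancel])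
  rw [← sub_eq_zero, sub_eq_add_neg, this]

end GaloisRing

noncomputable section

variable {k : ℕ} {f : (ZMod 4)[X]} [Fact (Irreducible (f.map red))]
  [Fintype (AdjoinRoot (f.map red))] (hf : f.Monic) (hdeg : f.natDegree = 2 * k + 1)

/-- Reduction modulo two identifies the Teichmüller set with the residue field. -/
def teichEquiv : Teich (2 * k + 1) f ≃ AdjoinRoot (f.map red) where
  toFun X := residue f X.1
  invFun x := ⟨(galoisRing hf hdeg).τ x, by
    rw [(galoisRing hf hdeg).pow_eq_self_iff, (galoisRing hf hdeg).π_τ]⟩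
  left_inv X := Subtype.ext (((galoisRing hf hdeg).pow_eq_self_iff X.1).1 X.2)
  right_inv x := (galoisRing hf hdeg).π_τ x

/-- The word with parameter `z`. -/
def code (z : ZMod 4 × AdjoinRoot f × AdjoinRoot (f.map red)) : Word (2 * k + 1) f :=
  fun X => (galoisRing hf hdeg).val z (teichEquiv hf hdeg X)

lemma code_add (z w : ZMod 4 × AdjoinRoot f × AdjoinRoot (f.map red)) :
    code hf hdeg (z + w) = code hf hdeg z + code hf hdeg w := by
  funext X
  rw [code, GaloisRing.val_add]
  rfl

lemma code_neg (z : ZMod 4 × AdjoinRoot f × AdjoinRoot (f.map red)) :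
    code hf hdeg (-z) = -code hf hdeg z := by
  funext X
  rw [code, GaloisRing.val_neg]
  rfl

lemma code_injective (hk : 1 ≤ k) : Function.Injective (code hf hdeg) := fun _ _ h =>
  (galoisRing hf hdeg).val_injective hk
    ((teichEquiv hf hdeg).surjective.injective_comp_right h)

lemma cword_eq_code (u : ZMod 4) (a b : AdjoinRoot f) :
    cword (2 * k + 1) f u a b = code hf hdeg (u, a, residue f b) := by
  funext X
  have hX : (galoisRing hf hdeg).τ (residue f X.1) = X.1 :=
    ((galoisRing hf hdeg).pow_eq_self_iff X.1).1 X.2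
  have hT := (galoisRing hf hdeg).T_two_mul (X.1 ^ 3 * b)
  change _ = (galoisRing hf hdeg).val (u, a, residue f b) (residue f X.1)
  rw [GaloisRing.val_eq, GaloisRing.quad, hX, ← map_pow, ← map_mul]
  change Algebra.trace (ZMod 4) (AdjoinRoot f) _ = dbl (_ : ZMod 2) at hT
  rw [cword, map_add, show 2 * b * X.1 ^ 3 = 2 * (X.1 ^ 3 * b) by ring, hT, mul_comm a]
  rfl

lemma range_code : Set.range (code hf hdeg) = DG (2 * k + 1) f := by
  ext v
  constructor
  · rintro ⟨⟨u, a, t⟩, rfl⟩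
    have ht : residue f ((galoisRing hf hdeg).τ t) = t := (galoisRing hf hdeg).π_τ t
    exact ⟨u, a, _, ((teichEquiv hf hdeg).symm t).2, by
      rw [cword_eq_code hf hdeg]
      change _ = code hf hdeg (u, a, residue f ((galoisRing hf hdeg).τ t))
      rw [ht]⟩
  · rintro ⟨u, a, b, -, rfl⟩
    exact ⟨_, (cword_eq_code hf hdeg u a b).symm⟩

lemma code_mem_kerdock_iff (hk : 1 ≤ k)
    (z : ZMod 4 × AdjoinRoot f × AdjoinRoot (f.map red)) :
    code hf hdeg z ∈ Kerdock (2 * k + 1) f ↔ z.2.2 = 0 := by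
  constructor
  · rintro ⟨u, a, h⟩
    rw [cword_eq_code hf hdeg, map_zero] at h
    rw [code_injective hf hdeg hk h]
  · intro h
    refine ⟨z.1, z.2.1, ?_⟩
    rw [cword_eq_code hf hdeg, map_zero, ← h]

lemma symWt_add_reZ : ∀ x : ZMod 4, (symWt x : ℤ) + reZ x = 1 := by
  decide

lemma leeWt_code (z : ZMod 4 × AdjoinRoot f × AdjoinRoot (f.map red)) :
    (leeWt (2 * k + 1) f (code hf hdeg z) : ℤ)
      = 2 ^ (2 * k + 1) - (galoisRing hf hdeg).reSum z := by
  have h : leeWt (2 * k + 1) f (code hf hdeg z)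
      = ∑ x, symWt ((galoisRing hf hdeg).val z x) := by
    rw [← finsum_eq_sum_of_fintype, ← finsum_comp_equiv (teichEquiv hf hdeg)]
    rfl
  have hc := (galoisRing hf hdeg).card_eq
  have hs : ∑ x, ((symWt ((galoisRing hf hdeg).val z x) : ℤ)
      + reZ ((galoisRing hf hdeg).val z x)) = 2 ^ (2 * k + 1) := by
    simp [symWt_add_reZ, hc]
  rw [Finset.sum_add_distrib] at hs
  rw [h, Nat.cast_sum, GaloisRing.reSum]
  linarith

lemma code_mem_class_iff (hk : 1 ≤ k) (z : ZMod 4 × AdjoinRoot f × AdjoinRoot (f.map red))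
    (i : Fin 8) :
    code hf hdeg z ∈ DGclass (2 * k + 1) f i ↔ (galoisRing hf hdeg).InClass z i := by
  have hz : code hf hdeg z ∈ DG (2 * k + 1) f := range_code hf hdeg ▸ Set.mem_range_self z
  have hw := leeWt_code hf hdeg z
  have hK := code_mem_kerdock_iff hf hdeg hk z
  have e1 : (2 * k + 1 + 1) / 2 = k + 1 := by omega
  have h1 : 2 ^ (k + 1) ≤ 2 ^ (2 * k + 1) := Nat.pow_le_pow_right two_pos (by omega)
  have h2 : 2 ^ k ≤ 2 ^ (2 * k + 1) := Nat.pow_le_pow_right two_pos (by omega)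
  by_cases h3 : i = 3
  · subst h3
    rw [GaloisRing.inClass_three_iff _ hk, ← hK]
    change _ ∧ _ = _ ∧ _ ↔ _
    rw [and_iff_right hz]
    refine and_congr_left fun _ => ?_
    zify
    omega
  by_cases h4 : i = 4
  · subst h4
    rw [GaloisRing.inClass_four_iff, Ne, ← hK]
    change _ ∧ _ = _ ∧ _ ↔ _
    rw [and_iff_right hz]
    refine and_congr_left fun _ => ?_
    zify
    omega
  rw [GaloisRing.inClass_iff _ hk z h3 h4]
  have key : ∀ w : ℕ, (w : ℤ) = 2 ^ (2 * k + 1) - GaloisRing.classSum k i →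
      (leeWt (2 * k + 1) f (code hf hdeg z) = w
        ↔ (galoisRing hf hdeg).reSum z = GaloisRing.classSum k i) := by
    intro w h
    zify
    omega
  fin_cases i
  all_goals first | exact absurd rfl h3 | exact absurd rfl h4 | skip
  all_goals
    refine (and_iff_right hz).trans (key _ ?_)
    simp [GaloisRing.classSum, e1, h1, h2]
  ring

lemma exists_code {i : Fin 8} {v : Word (2 * k + 1) f} (h : v ∈ DGclass (2 * k + 1) f i) :
    ∃ z, code hf hdeg z = v := by
  change v ∈ Set.range _
  rw [range_code]
  fin_cases i <;> exact h.1

include hf hdeg in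
lemma neg_mem_class (hk : 1 ≤ k) {i : Fin 8} {v : Word (2 * k + 1) f}
    (h : v ∈ DGclass (2 * k + 1) f i) : -v ∈ DGclass (2 * k + 1) f i := by
  obtain ⟨z, rfl⟩ := exists_code hf hdeg h
  rw [code_mem_class_iff hf hdeg hk] at h
  rw [← code_neg, code_mem_class_iff hf hdeg hk]
  exact GaloisRing.inClass_neg _ h

lemma card_pairs (hk : 1 ≤ k) (i j : Fin 8)
    (z : ZMod 4 × AdjoinRoot f × AdjoinRoot (f.map red)) :
    Nat.card {p : Word (2 * k + 1) f × Word (2 * k + 1) f //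
        p.1 ∈ DGclass (2 * k + 1) f i ∧ p.2 ∈ DGclass (2 * k + 1) f j
          ∧ p.1 + p.2 = code hf hdeg z}
      = Nat.card {r // (galoisRing hf hdeg).InClass r i
          ∧ (galoisRing hf hdeg).InClass (z - r) j} := by
  symm
  refine Nat.card_congr (Equiv.ofBijective (fun r => ⟨(code hf hdeg r.1, code hf hdeg (z - r.1)),
    (code_mem_class_iff hf hdeg hk _ i).2 r.2.1, (code_mem_class_iff hf hdeg hk _ j).2 r.2.2, by
      rw [← code_add, add_sub_cancel]⟩) ⟨?_, ?_⟩)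
  · intro r s h
    exact Subtype.ext (code_injective hf hdeg hk (congrArg (fun p => p.1.1) h))
  · rintro ⟨⟨v, w⟩, hv, hw, h⟩
    obtain ⟨r, rfl⟩ := exists_code hf hdeg hv
    obtain ⟨s, rfl⟩ := exists_code hf hdeg hw
    have h : r + s = z := code_injective hf hdeg hk ((code_add hf hdeg r s).trans h)
    obtain rfl : s = z - r := by rw [← h, add_sub_cancel_left]
    exact ⟨⟨r, (code_mem_class_iff hf hdeg hk _ i).1 hv,
      (code_mem_class_iff hf hdeg hk _ j).1 hw⟩, rfl⟩

end

end Goethals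

/-- For odd `m ≥ 3` the classes `S_0, …, S_7` partition the
Delsarte–Goethals code, each is closed under negation, and the induced translation
relations form a 7-class association scheme: for all `i, j` and all codewords `z, z'`
in the same class, the number of pairs `(r,s) ∈ S_i × S_j` with `r + s = z` equals the
number of pairs with `r + s = z'`. -/
theorem statement1 (m : ℕ) (hm : Odd m) (hm3 : 3 ≤ m)
    (f : Polynomial (ZMod 4)) (hmonic : f.Monic) (hdeg : f.natDegree = m)
    (hirr : Irreducible (f.map (ZMod.castHom (show (2:ℕ) ∣ 4 by norm_num) (ZMod 2)))) :
    (∀ z ∈ DG m f, ∃! i : Fin 8, z ∈ DGclass m f i) ∧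
    (∀ i : Fin 8, ∀ z : Word m f, z ∈ DGclass m f i ↔ -z ∈ DGclass m f i) ∧
    (∀ i j k : Fin 8, ∀ z z' : Word m f, z ∈ DGclass m f k → z' ∈ DGclass m f k →
      Nat.card {p : Word m f × Word m f //
          p.1 ∈ DGclass m f i ∧ p.2 ∈ DGclass m f j ∧ p.1 + p.2 = z} =
      Nat.card {p : Word m f × Word m f //
          p.1 ∈ DGclass m f i ∧ p.2 ∈ DGclass m f j ∧ p.1 + p.2 = z'}) := by
  obtain ⟨k, rfl⟩ := hm
  have hk : 1 ≤ k := by omega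
  have : Fact (Irreducible (f.map Goethals.red)) := ⟨hirr⟩
  have G := Goethals.galoisRing hmonic hdeg
  have : Finite (AdjoinRoot (f.map Goethals.red)) :=
    Nat.finite_of_card_ne_zero (by rw [G.card_F]; positivity)
  have : Finite (AdjoinRoot f) := Nat.finite_of_card_ne_zero (by rw [G.card_R]; positivity)
  let := Fintype.ofFinite (AdjoinRoot (f.map Goethals.red))
  let := Fintype.ofFinite (AdjoinRoot f)
  refine ⟨fun v hv => ?_, fun i v => ⟨Goethals.neg_mem_class hmonic hdeg hk, fun h => ?_⟩,
    fun i j l v w hv hw => ?_⟩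
  · rw [← Goethals.range_code hmonic hdeg] at hv
    obtain ⟨z, rfl⟩ := hv
    simp only [Goethals.code_mem_class_iff hmonic hdeg hk]
    obtain ⟨i, hi⟩ := (Goethals.galoisRing hmonic hdeg).exists_inClass z
    exact ⟨i, hi, fun j hj => (Goethals.galoisRing hmonic hdeg).inClass_unique hk hj hi⟩
  · rw [← neg_neg v]
    exact Goethals.neg_mem_class hmonic hdeg hk h
  · obtain ⟨z, rfl⟩ := Goethals.exists_code hmonic hdeg hv
    obtain ⟨z', rfl⟩ := Goethals.exists_code hmonic hdeg hw
    rw [Goethals.code_mem_class_iff hmonic hdeg hk] at hv hw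
    rw [Goethals.card_pairs hmonic hdeg hk, Goethals.card_pairs hmonic hdeg hk]
    exact (Goethals.galoisRing hmonic hdeg).card_inClass_sub i j hv hw
end
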